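/- Fix n ≥ 1 and a₁,…,a_n > 0 satisfying the even-scaling condition: there exists t > 0 such that e^{a_i t} is an even positive integer for every i. Let Γ ⊆ ℝ^{n+1} × ℝⁿ be a lattice in G_φ, i.e. a subgroup under the G_φ multiplication that is discrete as a subset of ℝ^{2n+1} and cocompact (there is a compact set C with Γ·C = G_φ); such a Γ is finitely generated. Then there exists a subset D ⊆ Γ such that for every finite generating set S of Γ, D is a Delone set in (Γ, d_S) and D is non-rectifiable: there is no K ≥ 1 and no bijection f : D → Γ with K⁻¹·d_S(x,y) ≤ d_S(f(x),f(y)) ≤ K·d_S(x,y) for all x,y ∈ D. -/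

import Mathlib

/-!
STATEMENT 1: Any lattice in a boundary one-dimensional, even-scaling, abelian-by-abelian
Lie group G_φ = ℝ^{n+1} ⋊_φ ℝⁿ contains a non-rectifiable Delone subset.
-/

/-- The roots α_j : ℝⁿ → ℝ, α_j(s) = a_j s_j for j ≤ n and α_{n+1}(s) = −(a₁s₁+⋯+a_n s_n). -/
noncomputable def root {n : ℕ} (a : Fin n → ℝ) (s : Fin n → ℝ) (j : Fin (n + 1)) : ℝ :=
  if h : (j : ℕ) < n then a ⟨j, h⟩ * s ⟨j, h⟩ else -(∑ i, a i * s i)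

lemma root_add {n : ℕ} (a s s' : Fin n → ℝ) (j : Fin (n + 1)) :
    root a (s + s') j = root a s j + root a s' j := by
  unfold root
  split_ifs with h
  · simp only [Pi.add_apply]; ring
  · simp only [Pi.add_apply, mul_add, Finset.sum_add_distrib]; ring

lemma root_zero {n : ℕ} (a : Fin n → ℝ) (j : Fin (n + 1)) : root a 0 j = 0 := by
  unfold root; split_ifs <;> simp

lemma root_neg {n : ℕ} (a s : Fin n → ℝ) (j : Fin (n + 1)) :
    root a (-s) j = -root a s j := by
  have := root_add a s (-s) j
  simp only [add_neg_cancel, root_zero] at this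
  linarith

/-- The group G_φ = ℝ^{n+1} ⋊_φ ℝⁿ with (x,s)·(x',s') = (x + φ(s)x', s + s'),
where φ(s) is the diagonal matrix with entries e^{α_j(s)}. -/
@[ext]
structure Gphi {n : ℕ} (a : Fin n → ℝ) where
  x : Fin (n + 1) → ℝ
  s : Fin n → ℝ

namespace Gphi

variable {n : ℕ} {a : Fin n → ℝ}

noncomputable def mul' (g h : Gphi a) : Gphi a :=
  ⟨fun j => g.x j + Real.exp (root a g.s j) * h.x j, g.s + h.s⟩

noncomputable def inv' (g : Gphi a) : Gphi a :=
  ⟨fun j => -(Real.exp (root a (-g.s) j) * g.x j), -g.s⟩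

noncomputable instance : Group (Gphi a) where
  mul := mul'
  one := ⟨fun _ => 0, 0⟩
  inv := inv'
  mul_assoc g h k := by
    show mul' (mul' g h) k = mul' g (mul' h k)
    unfold mul'
    ext j
    · show (g.x j + Real.exp (root a g.s j) * h.x j)
          + Real.exp (root a (g.s + h.s) j) * k.x j
        = g.x j + Real.exp (root a g.s j) * (h.x j + Real.exp (root a h.s j) * k.x j)
      rw [root_add, Real.exp_add]; ring
    · exact add_assoc _ _ _
  one_mul g := by
    show mul' ⟨fun _ => 0, 0⟩ g = g
    unfold mul'
    ext j
    · show 0 + Real.exp (root a 0 j) * g.x j = g.x j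
      simp [root_zero]
    · exact zero_add _
  mul_one g := by
    show mul' g ⟨fun _ => 0, 0⟩ = g
    unfold mul'
    ext j
    · show g.x j + Real.exp (root a g.s j) * 0 = g.x j
      simp
    · exact add_zero _
  inv_mul_cancel g := by
    show mul' (inv' g) g = ⟨fun _ => 0, 0⟩
    unfold mul' inv'
    ext j
    · show -(Real.exp (root a (-g.s) j) * g.x j)
          + Real.exp (root a (-g.s) j) * g.x j = 0
      ring
    · exact neg_add_cancel _

/-- The topology of ℝ^{2n+1}, transported to G_φ. -/
instance : TopologicalSpace (Gphi a) :=
  TopologicalSpace.induced (fun g => (g.x, g.s)) inferInstance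

end Gphi

/-- The word metric associated to a generating set `S`. -/
noncomputable def wordDist {G : Type*} [Group G] (S : Set G) (g h : G) : ℕ :=
  sInf {n : ℕ | ∃ l : List G, l.length = n ∧ (∀ w ∈ l, w ∈ S ∨ w⁻¹ ∈ S) ∧ g⁻¹ * h = l.prod}


namespace NR
open Finset

structure GM {d : ℕ} {Γ : Type*} (b : ℕ) (ζ : Γ → Fin d → ℤ) (ξ : Γ → Fin d → ℝ)
    (dd : Γ → Γ → ℕ) (A : ℕ) : Prop where
  self : ∀ p, dd p p = 0
  symm : ∀ p q, dd p q = dd q p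
  tri : ∀ p q r, dd p r ≤ dd p q + dd q r
  growth : ∀ p m (F : Finset Γ), (∀ q ∈ F, dd p q ≤ m) → F.card ≤ A ^ m
  m1z : ∀ p q j, |ζ p j - ζ q j| ≤ (A * dd p q : ℕ)
  m1x : ∀ p q j, |ξ p j - ξ q j| ≤ (b : ℝ) ^ (ζ p j + (A * dd p q : ℕ))
  m2 : ∀ p q (m : ℕ), (∀ j, |ζ p j - ζ q j| ≤ m) →
    (∀ j, |ξ p j - ξ q j| ≤ (b : ℝ) ^ (ζ p j + m)) → dd p q ≤ A * (m + 1)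

lemma GM.eq_of_zero {d : ℕ} {Γ : Type*} {b : ℕ} {ζ : Γ → Fin d → ℤ} {ξ : Γ → Fin d → ℝ}
    {dd : Γ → Γ → ℕ} {A : ℕ} (G : GM b ζ ξ dd A) {p q : Γ} (h : dd p q = 0) : p = q := by
  classical
  by_contra hne
  have := G.growth p 0 {p, q} (by intro r hr; simp at hr; rcases hr with rfl | rfl; simp [G.self]; simp [h])
  rw [Finset.card_pair hne] at this
  simp at this

lemma zpow_mono {b : ℕ} (hb : 2 ≤ b) {m n : ℤ} (h : m ≤ n) : (b : ℝ) ^ m ≤ (b : ℝ) ^ n := by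
  have : (1 : ℝ) ≤ b := by exact_mod_cast (by omega : 1 ≤ b)
  exact zpow_le_zpow_right₀ this h

lemma zpow_pos' {b : ℕ} (hb : 2 ≤ b) (m : ℤ) : 0 < (b : ℝ) ^ m := by
  have : (0 : ℝ) < b := by exact_mod_cast (by omega : 0 < b)
  exact zpow_pos this m

lemma two_zpow {b : ℕ} (hb : 2 ≤ b) (m : ℤ) : 2 * (b : ℝ) ^ m ≤ (b : ℝ) ^ (m + 1) := by
  have h2 : (2 : ℝ) ≤ b := by exact_mod_cast hb
  rw [zpow_add_one₀ (by linarith)]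
  nlinarith [zpow_pos' hb m]

lemma le_zpow {b : ℕ} (hb : 2 ≤ b) (m : ℕ) : (m : ℝ) ≤ (b : ℝ) ^ (m : ℤ) := by
  rw [zpow_natCast]
  have : m < b ^ m := Nat.lt_pow_self (by omega)
  exact_mod_cast this.le

lemma mul_zpow_le {b : ℕ} (hb : 2 ≤ b) (c : ℕ) (m : ℤ) : (c : ℝ) * (b : ℝ) ^ m ≤ (b : ℝ) ^ (m + c) := by
  have h2 : (0 : ℝ) < b := by exact_mod_cast (by omega : 0 < b)
  rw [add_comm m, zpow_add₀ h2.ne']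
  exact mul_le_mul_of_nonneg_right (le_zpow hb c) (zpow_pos' hb m).le

lemma zpow_lt_imp {b : ℕ} (hb : 2 ≤ b) {m n : ℤ} (h : (b : ℝ) ^ m ≤ (b : ℝ) ^ n) : m ≤ n := by
  have : (1 : ℝ) < b := by exact_mod_cast (by omega : 1 < b)
  exact (zpow_le_zpow_iff_right₀ this).1 h

lemma geom_bound {b : ℕ} (hb : 2 ≤ b) {q : ℕ} (hq : 1 ≤ q) (L : ℕ) :
    ∑ t ∈ range L, (b : ℝ) ^ (-((t / q : ℕ) : ℤ)) ≤ 4 * q := by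
  set x : ℝ := 1 - 1 / (2 * q) with hx
  have hq' : (1 : ℝ) ≤ q := by exact_mod_cast hq
  have hqi : 1 / (2 * (q : ℝ)) ≤ 1 / 2 := by
    apply one_div_le_one_div_of_le <;> linarith
  have hqp : 0 < 1 / (2 * (q : ℝ)) := by positivity
  have hx0 : 0 < x := by linarith
  have hx1 : x < 1 := by linarith
  have hbern : (1 / 2 : ℝ) ≤ x ^ q := by
    have := one_add_mul_le_pow (a := -(1 / (2 * (q : ℝ)))) (by linarith) q
    have h3 : (q : ℝ) * -(1 / (2 * (q : ℝ))) = - (1 / 2) := by field_simp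
    rw [h3] at this
    calc (1 / 2 : ℝ) = 1 + -(1 / 2) := by norm_num
      _ ≤ _ := this
      _ = _ := by rw [hx]; ring
  have key : ∀ t : ℕ, (b : ℝ) ^ (-((t / q : ℕ) : ℤ)) ≤ 2 * x ^ t := by
    intro t
    have h1 : (b : ℝ) ^ (-((t / q : ℕ) : ℤ)) ≤ (1 / 2 : ℝ) ^ (t / q) := by
      rw [zpow_neg, zpow_natCast, ← inv_pow]
      apply pow_le_pow_left₀ (by positivity)
      rw [one_div]
      apply inv_anti₀ (by norm_num); exact_mod_cast hb
    have h2 : (1 / 2 : ℝ) ^ (t / q + 1) ≤ x ^ t := by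
      calc (1 / 2 : ℝ) ^ (t / q + 1) ≤ (x ^ q) ^ (t / q + 1) :=
            pow_le_pow_left₀ (by norm_num) hbern _
        _ = x ^ (q * (t / q + 1)) := by rw [pow_mul]
        _ ≤ x ^ t := by
            apply pow_le_pow_of_le_one hx0.le hx1.le
            exact (Nat.lt_mul_div_succ t (by omega)).le
    rw [pow_succ] at h2
    linarith
  calc _ ≤ ∑ t ∈ range L, 2 * x ^ t := sum_le_sum fun t _ => key t
    _ = 2 * ∑ t ∈ range L, x ^ t := by rw [mul_sum]
    _ ≤ 2 * (2 * q) := by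
        have h5 : ∑ t ∈ range L, x ^ t ≤ (1 - x)⁻¹ := by
          rw [← tsum_geometric_of_lt_one hx0.le hx1]
          exact (summable_geometric_of_lt_one hx0.le hx1).sum_le_tsum _ (fun i _ => by positivity)
        have h6 : (1 - x)⁻¹ = 2 * q := by rw [hx]; field_simp; ring
        rw [h6] at h5; linarith
    _ = _ := by ring

section path
variable {d : ℕ} {Γ : Type*} {b : ℕ} {ζ : Γ → Fin d → ℤ} {ξ : Γ → Fin d → ℝ}
  {dd : Γ → Γ → ℕ} {A : ℕ}

lemma path_tele (P : ℕ → Γ) (j : Fin d) (L : ℕ) (f : ℕ → ℝ)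
    (h : ∀ t < L, |ξ (P t) j - ξ (P (t + 1)) j| ≤ f t) :
    |ξ (P 0) j - ξ (P L) j| ≤ ∑ t ∈ range L, f t := by
  induction L with
  | zero => simp
  | succ L ih =>
    rw [sum_range_succ]
    have h1 := ih (fun t ht => h t (by omega))
    have h2 := h L (by omega)
    have := abs_sub_le (ξ (P 0) j) (ξ (P L) j) (ξ (P (L + 1)) j)
    linarith

lemma path1 (hb : 2 ≤ b) (G : GM b ζ ξ dd A) {q c0 L g : ℕ} (hq : 1 ≤ q) (P : ℕ → Γ) (j : Fin d)
    (z : ℤ) (hP : ∀ t < L, dd (P t) (P (t + 1)) ≤ c0)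
    (hz : ∀ t < L, ζ (P t) j ≤ z + g - (t / q : ℕ)) :
    |ξ (P 0) j - ξ (P L) j| ≤ (b : ℝ) ^ (z + (g + A * c0 + 4 * q : ℕ)) := by
  have h1 : ∀ t < L, |ξ (P t) j - ξ (P (t + 1)) j| ≤
      (b : ℝ) ^ (z + (g + A * c0 : ℕ)) * (b : ℝ) ^ (-((t / q : ℕ) : ℤ)) := by
    intro t ht
    have h0 : (b : ℝ) ≠ 0 := by exact_mod_cast (by omega : b ≠ 0)
    rw [← zpow_add₀ h0]
    refine (G.m1x _ _ j).trans (zpow_mono hb ?_)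
    have h3 := hz t ht
    have h4 : A * dd (P t) (P (t + 1)) ≤ A * c0 := Nat.mul_le_mul_left _ (hP t ht)
    have h5 : ((A * dd (P t) (P (t + 1)) : ℕ) : ℤ) ≤ ((A * c0 : ℕ) : ℤ) := by exact_mod_cast h4
    push_cast at *
    linarith
  refine (path_tele P j L _ h1).trans ?_
  rw [← mul_sum]
  have h2 := geom_bound hb hq L
  have h3 := mul_zpow_le hb (4 * q) (z + (g + A * c0 : ℕ))
  have h4 := zpow_pos' hb (z + (g + A * c0 : ℕ))
  push_cast at h3 h4 h2 ⊢
  calc _ ≤ (b : ℝ) ^ (z + (g + A * c0 : ℤ)) * (4 * q) := mul_le_mul_of_nonneg_left h2 h4.le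
    _ ≤ _ := by rw [mul_comm]; convert h3 using 2; ring

lemma path2 (hb : 2 ≤ b) (G : GM b ζ ξ dd A) {c0 L : ℕ} (P : ℕ → Γ) (j : Fin d)
    (z : ℤ) (hP : ∀ t < L, dd (P t) (P (t + 1)) ≤ c0)
    (hz : ∀ t < L, ζ (P t) j ≤ z) :
    |ξ (P 0) j - ξ (P L) j| ≤ L * (b : ℝ) ^ (z + (A * c0 : ℕ)) := by
  have h1 : ∀ t < L, |ξ (P t) j - ξ (P (t + 1)) j| ≤ (b : ℝ) ^ (z + (A * c0 : ℕ)) := by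
    intro t ht
    refine (G.m1x _ _ j).trans (zpow_mono hb ?_)
    have h3 := hz t ht
    have h4 : A * dd (P t) (P (t + 1)) ≤ A * c0 := Nat.mul_le_mul_left _ (hP t ht)
    have h5 : ((A * dd (P t) (P (t + 1)) : ℕ) : ℤ) ≤ ((A * c0 : ℕ) : ℤ) := by exact_mod_cast h4
    linarith
  refine (path_tele P j L _ h1).trans ?_
  simp

end path

/-! averaging over product boxes -/
section box
variable {ι V : Type*} [Fintype ι] [DecidableEq ι] [Fintype V] [AddCommGroup V]

lemma sum_update_box (f : (ι → V) → ℝ) (i : ι) :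
    ∑ y : ι → V, ∑ v : V, f (Function.update y i v) = Fintype.card V * ∑ y, f y := by
  have h1 : ∀ y : ι → V, ∑ v : V, f (Function.update y i v) = ∑ u : V, f (y + Pi.single i u) := by
    intro y
    refine (Fintype.sum_equiv (Equiv.addLeft (y i)) _ _ fun u => ?_).symm
    congr 1
    ext l
    by_cases h : l = i
    · subst h; simp
    · simp [h]
  simp_rw [h1]
  rw [sum_comm]
  have h2 : ∀ u : V, ∑ y : ι → V, f (y + Pi.single i u) = ∑ y, f y := fun u =>
    Fintype.sum_equiv (Equiv.addRight (Pi.single i u)) _ _ fun y => rfl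
  simp [h2]

lemma sum_swap_box (f : (ι → V) → ℝ) (i : ι) :
    ∑ y : ι → V, ∑ w : ι → V, f (Function.update w i (y i)) =
      Fintype.card (ι → V) * ∑ y, f y := by
  rw [← Fintype.sum_prod_type' (f := fun (y w : ι → V) => f (Function.update w i (y i)))]
  have hinv : Function.Involutive (fun p : (ι → V) × (ι → V) =>
      (Function.update p.1 i (p.2 i), Function.update p.2 i (p.1 i))) := by
    rintro ⟨y, w⟩
    simp
  rw [Fintype.sum_equiv hinv.toPerm _ (fun p => f p.2) (fun p => by simp)]
  rw [Fintype.sum_prod_type' (f := fun (_ w : ι → V) => f w)]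
  simp

lemma sum_two_box (g : V → V → ℝ) {i0 i1 : ι} (h : i0 ≠ i1) :
    (Fintype.card V : ℝ) ^ 2 * ∑ y : ι → V, g (y i0) (y i1) =
      Fintype.card (ι → V) * ∑ v, ∑ v', g v v' := by
  have h1 : ∑ y : ι → V, ∑ v, ∑ v', g (y i0 + v) (y i1 + v') =
      Fintype.card (ι → V) * ∑ v, ∑ v', g v v' := by
    have : ∀ y : ι → V, ∑ v, ∑ v', g (y i0 + v) (y i1 + v') = ∑ v, ∑ v', g v v' := by
      intro y
      refine Fintype.sum_equiv (Equiv.addLeft (y i0)) _ _ fun v => ?_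
      exact Fintype.sum_equiv (Equiv.addLeft (y i1)) _ _ fun v' => rfl
    simp [this]
  rw [← h1, sum_comm]
  have h2 : ∀ v : V, ∑ y : ι → V, ∑ v', g (y i0 + v) (y i1 + v') =
      Fintype.card V * ∑ y : ι → V, g (y i0) (y i1) := by
    intro v
    rw [sum_comm]
    have : ∀ v' : V, ∑ y : ι → V, g (y i0 + v) (y i1 + v') = ∑ y : ι → V, g (y i0) (y i1) := by
      intro v'
      refine Fintype.sum_equiv (Equiv.addRight (Pi.single i0 v + Pi.single i1 v')) _ _ fun y => ?_
      simp [h, h.symm]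
    simp [this]
  simp [h2]; ring

end box
end NR


namespace NR
open Finset
set_option linter.unusedSectionVars false

structure LBx {d : ℕ} {Γ V : Type*} [AddCommGroup V] (dd : Γ → Γ → ℕ) (L c0 c1 : ℕ)
    (e : Fin d → Fin d → V) (Φ : (Fin d → V) → Fin d → ℤ → Γ) (Φ0 : (Fin d → V) → Γ) : Prop where
  b0 : ∀ y i, Φ y i 0 = Φ0 y
  b1 : ∀ y i t, dd (Φ y i t) (Φ y i (t + 1)) ≤ c0
  b2 : ∀ y y' i, y i = y' i → Φ y i L = Φ y' i L
  b3 : ∀ y y' i, (∀ l, l ≠ i → y l = y' l) → Φ y i (-(L : ℤ)) = Φ y' i (-(L : ℤ))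
  b3' : ∀ y i, Φ y i (-((c1 + 1 : ℕ) : ℤ)) = Φ (y + e i) i (-((c1 + 1 : ℕ) : ℤ))
  b4 : Function.Injective Φ0
  b5 : ∀ y i, c1 ≤ c0 * (dd (Φ0 y) (Φ0 (y + e i)) + 1)
  he : ∀ i l, l ≠ i → e i l = 0

structure LPar (A L c0 c1 q g h1 lL W b : ℕ) : Prop where
  hb : 2 ≤ b
  hq : 1 ≤ q
  hh1 : 2 * (c1 + 1) + 2 * (q * g) ≤ q * h1
  hc1 : c0 * (A * ((g + A * c0 + 4 * q) + h1 + 2 + 1) + 1) < c1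
  ht1 : c1 + 1 ≤ L
  hlL : L ≤ b ^ lL
  hW : 5 * L + q * (2 * g + A * c0 + lL + 4 * q) ≤ q * W

def GoodAt {d : ℕ} {Γ V : Type*} (ζ : Γ → Fin d → ℤ) (L q g : ℕ)
    (Φ : (Fin d → V) → Fin d → ℤ → Γ) (Φ0 : (Fin d → V) → Γ) (u : Fin d → Fin d → ℝ)
    (y : Fin d → V) : Prop :=
  ∀ i j (t : ℤ), |t| ≤ L →
    |(ζ (Φ y i t) j : ℝ) - ζ (Φ0 y) j - t * u i j| ≤ |(t : ℝ)| / q + g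

section LL
variable {d : ℕ} {Γ V : Type*} [AddCommGroup V] {b : ℕ} {ζ : Γ → Fin d → ℤ}
  {ξ : Γ → Fin d → ℝ} {dd : Γ → Γ → ℕ} {A L c0 c1 q g h1 lL W : ℕ}
  {e : Fin d → Fin d → V} {Φ : (Fin d → V) → Fin d → ℤ → Γ} {Φ0 : (Fin d → V) → Γ}
  {u : Fin d → Fin d → ℝ}

/-- F1 -/
lemma LL_F1 (G : GM b ζ ξ dd A) (B : LBx dd L c0 c1 e Φ Φ0) (P : LPar A L c0 c1 q g h1 lL W b)
    {y : Fin d → V} (hy : GoodAt ζ L q g Φ Φ0 u y) {i j : Fin d} (hs : u i j ≤ -4 / q) :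
    |ξ (Φ0 y) j - ξ (Φ y i L) j| ≤ (b : ℝ) ^ (ζ (Φ0 y) j + (g + A * c0 + 4 * q : ℕ)) := by
  have := path1 P.hb G P.hq (fun t => Φ y i (t : ℤ)) j (ζ (Φ0 y) j) (L := L) (c0 := c0) (g := g)
    (fun t _ => by have := B.b1 y i t; push_cast; exact this) (by
      intro t ht
      have h1 := hy i j (t : ℤ) (by rw [abs_of_nonneg (by positivity)]; exact_mod_cast ht.le)
      have hq : (0 : ℝ) < q := by exact_mod_cast P.hq
      have h2 := (abs_le.1 h1).2
      have h3 : |((t : ℤ) : ℝ)| = t := by simp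
      rw [h3] at h2
      have h4 : ((t / q : ℕ) : ℝ) ≤ t / q := Nat.cast_div_le
      have h5 : (t : ℝ) * u i j ≤ (t : ℝ) * (-4 / q) := mul_le_mul_of_nonneg_left hs (by positivity)
      have h6 : (t : ℝ) * (-4 / q) = -4 * (t / q) := by ring
      have h7 : (0 : ℝ) ≤ t / q := by positivity
      have h8 : (ζ (Φ y i t) j : ℝ) ≤ ((ζ (Φ0 y) j + g - ((t / q : ℕ) : ℤ) : ℤ) : ℝ) := by
        simp only [Int.cast_sub, Int.cast_add, Int.cast_natCast] at h2 ⊢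
        linarith
      exact Int.cast_le.1 h8)
  simpa [B.b0] using this

/-- F2 -/
lemma LL_F2 (G : GM b ζ ξ dd A) (B : LBx dd L c0 c1 e Φ Φ0) (P : LPar A L c0 c1 q g h1 lL W b)
    {y : Fin d → V} (hy : GoodAt ζ L q g Φ Φ0 u y) {i j : Fin d} (hs : ¬ u i j ≤ -4 / q) :
    |ξ (Φ0 y) j - ξ (Φ y i (-(L : ℤ))) j| ≤ (b : ℝ) ^ (ζ (Φ0 y) j + W) := by
  push Not at hs
  have hq : (0 : ℝ) < q := by exact_mod_cast P.hq
  have := path2 P.hb G (fun t => Φ y i (-(t : ℤ))) j (ζ (Φ0 y) j + g + (5 * L / q : ℕ)) (L := L) (c0 := c0)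
    (fun t _ => by
      have := B.b1 y i (-((t : ℤ) + 1)); push_cast
      rw [G.symm]
      have h : -((t : ℤ) + 1) + 1 = -t := by ring
      rwa [h] at this) (by
      intro t ht
      have h1 := hy i j (-(t : ℤ)) (by rw [abs_neg, abs_of_nonneg (by positivity)]; exact_mod_cast ht.le)
      have h2 := (abs_le.1 h1).2
      have h3 : |((-(t : ℤ) : ℤ) : ℝ)| = t := by simp
      rw [h3] at h2
      have h5 : (t : ℝ) * (-4 / q) ≤ (t : ℝ) * u i j := mul_le_mul_of_nonneg_left hs.le (by positivity)
      have h6 : (t : ℝ) * (-4 / q) = -4 * (t / q) := by ring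
      have h7 : (t : ℝ) / q ≤ L / q := by
        apply div_le_div_of_nonneg_right _ hq.le; exact_mod_cast ht.le
      have h8 : (ζ (Φ y i (-(t : ℤ))) j : ℝ) ≤ ζ (Φ0 y) j + g + 5 * (L / q) := by
        push_cast at h2 ⊢
        linarith
      have h9 : q * (ζ (Φ y i (-(t : ℤ))) j - ζ (Φ0 y) j - g) ≤ 5 * L := by
        have : (q : ℝ) * (ζ (Φ y i (-(t : ℤ))) j - ζ (Φ0 y) j - g) ≤ 5 * L := by
          have h10 : (ζ (Φ y i (-(t : ℤ))) j : ℝ) - ζ (Φ0 y) j - g ≤ 5 * (L / q) := by linarith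
          calc _ ≤ (q : ℝ) * (5 * (L / q)) := mul_le_mul_of_nonneg_left h10 hq.le
            _ = _ := by field_simp
        exact_mod_cast this
      have h11 : (ζ (Φ y i (-(t : ℤ))) j - ζ (Φ0 y) j - g) ≤ ((5 * L : ℤ)) / q := by
        rw [Int.le_ediv_iff_mul_le (by exact_mod_cast P.hq)]; linarith
      push_cast
      linarith)
  have h0 : Φ y i (-((0 : ℕ) : ℤ)) = Φ0 y := by simp [B.b0]
  simp only [h0] at this
  refine this.trans ?_
  have hb0 : (b : ℝ) ≠ 0 := by have := P.hb; exact_mod_cast (by omega : b ≠ 0)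
  have h2 : (L : ℝ) ≤ (b : ℝ) ^ (lL : ℤ) := by rw [zpow_natCast]; exact_mod_cast P.hlL
  calc _ ≤ (b : ℝ) ^ (lL : ℤ) * (b : ℝ) ^ (ζ (Φ0 y) j + ↑g + ↑(5 * L / q) + ↑(A * c0)) :=
        mul_le_mul_of_nonneg_right h2 (zpow_pos' P.hb _).le
    _ = (b : ℝ) ^ ((lL : ℤ) + (ζ (Φ0 y) j + ↑g + ↑(5 * L / q) + ↑(A * c0))) :=
        (zpow_add₀ hb0 _ _).symm
    _ ≤ _ := by
        apply zpow_mono P.hb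
        have h4 : q * (5 * L / q) ≤ 5 * L := Nat.mul_div_le _ _
        have h5 : q * (5 * L / q + (2 * g + A * c0 + lL + 4 * q)) ≤ q * W := by
          rw [mul_add]; have := P.hW; omega
        have h6 := Nat.le_of_mul_le_mul_left h5 P.hq
        have h7 : ((5 * L / q + (2 * g + A * c0 + lL + 4 * q) : ℕ) : ℤ) ≤ (W : ℤ) := by
          exact_mod_cast h6
        push_cast at h7 ⊢
        have hg : (0 : ℤ) ≤ g := by positivity
        have hq' : (0 : ℤ) ≤ q := by positivity
        linarith

lemma LPar.w1W (P : LPar A L c0 c1 q g h1 lL W b) : g + A * c0 + 4 * q ≤ W := by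
  have h5 : q * (2 * g + A * c0 + lL + 4 * q) ≤ q * W := by have := P.hW; omega
  have := Nat.le_of_mul_le_mul_left h5 P.hq
  omega

/-- heights agree at bounded error if there is a common point at time `-t`. -/
lemma LL_z {y y' : Fin d → V} (hy : GoodAt ζ L q g Φ Φ0 u y) (hy' : GoodAt ζ L q g Φ Φ0 u y')
    (hq : 1 ≤ q) {t h : ℕ} (htL : t ≤ L) (i : Fin d)
    (hc : Φ y i (-(t : ℤ)) = Φ y' i (-(t : ℤ)))
    (hh : 2 * t + 2 * (q * g) ≤ q * h) (j : Fin d) : |ζ (Φ0 y) j - ζ (Φ0 y') j| ≤ h := by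
  have hab : |-(t : ℤ)| ≤ L := by rw [abs_neg, abs_of_nonneg (by positivity)]; exact_mod_cast htL
  have h1 := hy i j (-(t : ℤ)) hab
  have h2 := hy' i j (-(t : ℤ)) hab
  rw [hc] at h1
  have h3 : |((-(t : ℤ) : ℤ) : ℝ)| = t := by simp
  rw [h3] at h1 h2
  have hq : (0 : ℝ) < q := by exact_mod_cast hq
  have h4 : |(ζ (Φ0 y) j : ℝ) - ζ (Φ0 y') j| ≤ 2 * ((t : ℝ) / q + g) := by
    rw [abs_le] at *; constructor <;> linarith
  have h5 : 2 * ((t : ℝ) / q + g) ≤ h := by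
    have : (2 * t + 2 * (q * g) : ℝ) ≤ q * h := by exact_mod_cast hh
    have h6 : 2 * ((t : ℝ) / q + g) = (2 * t + 2 * (q * g)) / q := by field_simp
    rw [h6, div_le_iff₀ hq]; linarith
  have h6 := h4.trans h5
  exact_mod_cast h6

lemma two_close {b : ℕ} (hb : 2 ≤ b) {x y E : ℝ} {z z' : ℤ} {h w : ℕ} (hz : |z - z'| ≤ h)
    (hx : |x - E| ≤ (b : ℝ) ^ (z + w)) (hy : |y - E| ≤ (b : ℝ) ^ (z' + w)) :
    |x - y| ≤ (b : ℝ) ^ (z + (h + w + 1 : ℕ)) := by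
  have h1 : |x - y| ≤ |x - E| + |y - E| := by
    rw [abs_sub_comm y E]; exact abs_sub_le _ _ _
  have h2 : (b : ℝ) ^ (z' + w) ≤ (b : ℝ) ^ (z + (h + w : ℕ)) := by
    apply zpow_mono hb; have := (abs_le.1 hz).1; push_cast; linarith
  have h3 : (b : ℝ) ^ (z + w) ≤ (b : ℝ) ^ (z + (h + w : ℕ)) := by
    apply zpow_mono hb; push_cast; linarith [(by positivity : (0:ℤ) ≤ h)]
  have h4 := two_zpow hb (z + (h + w : ℕ))
  have h5 : (z + (h + w : ℕ) + 1 : ℤ) = z + (h + w + 1 : ℕ) := by push_cast; ring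
  rw [h5] at h4
  linarith

lemma LL_hWz (P : LPar A L c0 c1 q g h1 lL W b) : 2 * L + 2 * (q * g) ≤ q * W := by
  have := P.hW
  have h : q * (2 * g + A * c0 + lL + 4 * q) = 2 * (q * g) + q * (A * c0 + lL + 4 * q) := by ring
  have h0 : 0 ≤ q * (A * c0 + lL + 4 * q) := Nat.zero_le _
  omega

/-- two good points agreeing off `i` -/
lemma LL_close (G : GM b ζ ξ dd A) (B : LBx dd L c0 c1 e Φ Φ0) (P : LPar A L c0 c1 q g h1 lL W b)
    {y y' : Fin d → V} (hy : GoodAt ζ L q g Φ Φ0 u y) (hy' : GoodAt ζ L q g Φ Φ0 u y')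
    {i : Fin d} (hag : ∀ l, l ≠ i → y l = y' l) {j : Fin d}
    (hj : ¬ u i j ≤ -4 / q ∨ ∃ l, l ≠ i ∧ u l j ≤ -4 / q) :
    |ξ (Φ0 y) j - ξ (Φ0 y') j| ≤ (b : ℝ) ^ (ζ (Φ0 y) j + (2 * W + 1 : ℕ)) := by
  have hz := LL_z hy hy' P.hq le_rfl i (B.b3 y y' i hag) (LL_hWz P) j
  have hw := P.w1W
  rcases hj with hj | ⟨l, hl, hj⟩
  · have h1 := LL_F2 G B P hy hj
    have h2 := LL_F2 G B P hy' hj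
    rw [← B.b3 y y' i hag] at h2
    have := two_close P.hb hz h1 h2
    convert this using 4; ring
  · have h1 := LL_F1 G B P hy hj
    have h2 := LL_F1 G B P hy' hj
    rw [← B.b2 y y' l (hag l hl)] at h2
    refine (two_close P.hb hz h1 h2).trans (zpow_mono P.hb ?_)
    have : ((g + A * c0 + 4 * q : ℕ) : ℤ) ≤ W := by exact_mod_cast hw
    push_cast at this ⊢
    linarith

lemma LL_close_dd (G : GM b ζ ξ dd A) (B : LBx dd L c0 c1 e Φ Φ0) (P : LPar A L c0 c1 q g h1 lL W b)
    {y y' : Fin d → V} (hy : GoodAt ζ L q g Φ Φ0 u y) (hy' : GoodAt ζ L q g Φ Φ0 u y')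
    {i : Fin d} (hag : ∀ l, l ≠ i → y l = y' l)
    (hj : ∀ j, |ξ (Φ0 y) j - ξ (Φ0 y') j| ≤ (b : ℝ) ^ (ζ (Φ0 y) j + (2 * W + 1 : ℕ))) :
    dd (Φ0 y) (Φ0 y') ≤ A * (2 * W + 2) := by
  refine G.m2 _ _ (2 * W + 1) (fun j => ?_) hj
  refine (LL_z hy hy' P.hq le_rfl i (B.b3 y y' i hag) (LL_hWz P) j).trans ?_
  push_cast; linarith [(by positivity : (0:ℤ) ≤ W)]

/-- z-lemma -/
lemma LL_zlem (G : GM b ζ ξ dd A) (B : LBx dd L c0 c1 e Φ Φ0) (P : LPar A L c0 c1 q g h1 lL W b)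
    {i j : Fin d} (hs : u i j ≤ -4 / q) (hother : ∀ j', j' ≠ j → ∃ l, l ≠ i ∧ u l j' ≤ -4 / q)
    {y y' : Fin d → V} (hyy : y i = y' i)
    (hy : GoodAt ζ L q g Φ Φ0 u y) (hye : GoodAt ζ L q g Φ Φ0 u (y + e i))
    (hy' : GoodAt ζ L q g Φ Φ0 u y') (hye' : GoodAt ζ L q g Φ Φ0 u (y' + e i)) :
    ζ (Φ0 y) j - ζ (Φ0 y') j ≤ (2 * (A * c0) * (c1 + 1) + 2 : ℕ) := by
  set w1 := g + A * c0 + 4 * q with hw1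
  set θ := w1 + h1 + 2 with hθ
  have hb := P.hb
  have hagr : ∀ (y : Fin d → V) l, l ≠ i → y l = (y + e i) l := fun y l hl => by
    simp [B.he i l hl]
  have hz := fun j => LL_z hy hye P.hq P.ht1 i (B.b3' y i) P.hh1 j
  have hz' := fun j => LL_z hy' hye' P.hq P.ht1 i (B.b3' y' i) P.hh1 j
  -- lower bound
  have hlow : (b : ℝ) ^ (ζ (Φ0 y) j + θ) < |ξ (Φ0 y) j - ξ (Φ0 (y + e i)) j| := by
    by_contra hcon
    push Not at hcon
    have : dd (Φ0 y) (Φ0 (y + e i)) ≤ A * (θ + 1) := by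
      refine G.m2 _ _ θ (fun j' => (hz j').trans ?_) (fun j' => ?_)
      · rw [hθ]; push_cast; linarith [(by positivity : (0:ℤ) ≤ w1)]
      · by_cases hjj : j' = j
        · subst hjj; exact hcon
        · obtain ⟨l, hl, hu⟩ := hother j' hjj
          have h1 := LL_F1 G B P hy hu
          have h2 := LL_F1 G B P hye hu
          rw [← B.b2 y _ l (hagr y l hl)] at h2
          refine (two_close hb (hz j') h1 h2).trans (zpow_mono hb ?_)
          rw [hθ, hw1]; push_cast; linarith
    have h5 := B.b5 y i
    have h6 := P.hc1
    have h7 : c0 * (dd (Φ0 y) (Φ0 (y + e i)) + 1) ≤ c0 * (A * (θ + 1) + 1) :=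
      Nat.mul_le_mul_left _ (by omega)
    rw [hθ, hw1] at h7
    omega
  -- upper bound
  have hup : |ξ (Φ0 y') j - ξ (Φ0 (y' + e i)) j| ≤
      (b : ℝ) ^ (ζ (Φ0 y') j + (2 * (A * c0) * (c1 + 1) : ℕ)) := by
    refine (G.m1x _ _ j).trans (zpow_mono hb ?_)
    have hd : ∀ (y : Fin d → V) (t : ℕ), dd (Φ0 y) (Φ y i (-(t : ℤ))) ≤ c0 * t := by
      intro y t
      induction t with
      | zero => simp [B.b0, G.self]
      | succ t ih =>
        have h1 := B.b1 y i (-((t + 1 : ℕ) : ℤ))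
        have h2 : (-((t + 1 : ℕ) : ℤ)) + 1 = -(t : ℤ) := by push_cast; ring
        rw [h2, G.symm] at h1
        have h3 := G.tri (Φ0 y) (Φ y i (-(t : ℤ))) (Φ y i (-((t + 1 : ℕ) : ℤ)))
        rw [mul_add]; omega
    have h1 := hd y' (c1 + 1)
    have h2 := hd (y' + e i) (c1 + 1)
    rw [← B.b3' y' i, G.symm] at h2
    have h3 := G.tri (Φ0 y') (Φ y' i (-((c1 + 1 : ℕ) : ℤ))) (Φ0 (y' + e i))
    have h4 : A * dd (Φ0 y') (Φ0 (y' + e i)) ≤ A * (2 * (c0 * (c1 + 1))) :=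
      Nat.mul_le_mul_left _ (by omega)
    have h5 : A * (2 * (c0 * (c1 + 1))) = 2 * (A * c0) * (c1 + 1) := by ring
    rw [h5] at h4
    have h6 : ((A * dd (Φ0 y') (Φ0 (y' + e i)) : ℕ) : ℤ) ≤ (2 * (A * c0) * (c1 + 1) : ℕ) := by
      exact_mod_cast h4
    linarith
  have f1 := LL_F1 G B P hy hs
  have f2 := LL_F1 G B P hye hs
  have f3 := LL_F1 G B P hy' hs
  have f4 := LL_F1 G B P hye' hs
  rw [← B.b2 y y' i hyy] at f3
  rw [← B.b2 (y + e i) (y' + e i) i (by simp [hyy])] at f4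
  set E := ξ (Φ y i L) j
  set E' := ξ (Φ (y + e i) i L) j
  set z := ζ (Φ0 y) j
  set z' := ζ (Φ0 y') j
  have m : ∀ (z1 z2 : ℤ), |z1 - z2| ≤ (h1 : ℤ) → (b : ℝ) ^ (z2 + w1) ≤ (b : ℝ) ^ (z1 + (h1 + w1 : ℕ)) := by
    intro z1 z2 h
    apply zpow_mono hb
    have := (abs_le.1 h).1; push_cast; linarith
  have m' : ∀ (z1 : ℤ), (b : ℝ) ^ (z1 + w1) ≤ (b : ℝ) ^ (z1 + (h1 + w1 : ℕ)) := by
    intro z1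
    apply zpow_mono hb; push_cast; linarith [(by positivity : (0:ℤ) ≤ h1)]
  have g1 := m _ _ (hz j)
  have g2 := m' z
  have g3 := m _ _ (hz' j)
  have g4 := m' z'
  have hE1 : |ξ (Φ0 y) j - ξ (Φ0 (y + e i)) j| ≤ |E - E'| + 2 * (b : ℝ) ^ (z + (h1 + w1 : ℕ)) := by
    have t1 := abs_le.1 (f1.trans g2)
    have t2 := abs_le.1 (f2.trans g1)
    have t3 := abs_le.1 (le_refl |E - E'|)
    rw [abs_le]; constructor <;> linarith
  have hE2 : |E - E'| ≤ |ξ (Φ0 y') j - ξ (Φ0 (y' + e i)) j| + 2 * (b : ℝ) ^ (z' + (h1 + w1 : ℕ)) := by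
    have t1 := abs_le.1 (f3.trans g4)
    have t2 := abs_le.1 (f4.trans g3)
    have t3 := abs_le.1 (le_refl |ξ (Φ0 y') j - ξ (Φ0 (y' + e i)) j|)
    rw [abs_le]; constructor <;> linarith
  set X := 2 * (A * c0) * (c1 + 1) with hX
  by_contra hcon
  push Not at hcon
  -- z ≥ z' + X + 3
  have k1 := two_zpow hb (z + (h1 + w1 : ℕ))
  have k2 := two_zpow hb (z + (h1 + w1 : ℕ) + 1)
  have k3 : z + (h1 + w1 : ℕ) + 1 + 1 = z + θ := by rw [hθ]; push_cast; ring
  rw [k3] at k2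
  have k4 := two_zpow hb (z' + (h1 + w1 : ℕ))
  have k5 : (b : ℝ) ^ (z' + X) ≤ (b : ℝ) ^ (z + (h1 + w1 : ℕ)) := by
    apply zpow_mono hb; push_cast at hcon ⊢
    have : (0 : ℤ) ≤ h1 + w1 := by positivity
    linarith
  have k6 : (b : ℝ) ^ (z' + (h1 + w1 : ℕ) + 1) ≤ (b : ℝ) ^ (z + (h1 + w1 : ℕ)) := by
    apply zpow_mono hb
    have : (0 : ℤ) ≤ X := by positivity
    push_cast at hcon ⊢
    linarith
  linarith

end LL
end NR


namespace NR
open Finset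
set_option linter.unusedSectionVars false

structure Lab {d : ℕ} {Γ Λ : Type*} (b : ℕ) (ζ : Γ → Fin d → ℤ) (ξ : Γ → Fin d → ℝ) (j : Fin d)
    (w2 w3 W Z : ℕ) (lab : Γ → Λ) (nb : Γ → Prop) : Prop where
  L1 : ∀ p q, ¬ nb p → |ζ p j - ζ q j| ≤ w2 → |ξ p j - ξ q j| ≤ (b : ℝ) ^ (ζ p j + w3) →
    lab p = lab q
  L2 : ∀ p q, lab p = lab q → |ζ p j - ζ q j| ≤ Z → |ξ p j - ξ q j| ≤ (b : ℝ) ^ (ζ p j + Z) →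
    |ξ p j - ξ q j| ≤ (b : ℝ) ^ (ζ p j + (2 * W + 1 : ℕ))

def optF {Λ0 Λ1 : Type*} (F : Λ0 → Λ1 → ℝ) : Option Λ0 → Option Λ1 → ℝ
  | some a, some c => F a c
  | _, _ => 0

open Classical in
def QLp {Λ0 Λ1 : Type*} (V : Type*) [Fintype V] (F : Λ0 → Λ1 → ℝ) (ν : ℕ) (ε : ℝ) : Prop :=
  ∀ (l0 : V → Option Λ0) (l1 : V → Option Λ1),
    (∀ a, (univ.filter fun v => l0 v = some a).card ≤ ν) →
    (∀ a, (univ.filter fun v => l1 v = some a).card ≤ ν) →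
    |∑ v, ∑ v', optF F (l0 v) (l1 v')| ≤ ε * (Fintype.card V : ℝ) ^ 2

section LL
variable {d : ℕ} {Γ V : Type*} [AddCommGroup V] [Fintype V] {b : ℕ} {ζ : Γ → Fin d → ℤ}
  {ξ : Γ → Fin d → ℝ} {dd : Γ → Γ → ℕ} {A L c0 c1 q g h1 lL W : ℕ}
  {e : Fin d → Fin d → V} {Φ : (Fin d → V) → Fin d → ℤ → Γ} {Φ0 : (Fin d → V) → Γ}
  {u : Fin d → Fin d → ℝ} {Λ Λ0 Λ1 : Type*}

open Classical in
lemma LL_seen (G : GM b ζ ξ dd A) (B : LBx dd L c0 c1 e Φ Φ0) (P : LPar A L c0 c1 q g h1 lL W b)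
    (hν : 4 * A ^ (A * (2 * W + 2)) < 3 * Fintype.card V)
    (hbad : 4 * (univ.filter fun y => ¬ GoodAt ζ L q g Φ Φ0 u y).card < Fintype.card (Fin d → V))
    (i : Fin d) : ∃ j, u i j ≤ -4 / q ∧ ∀ l, l ≠ i → ¬ u l j ≤ -4 / q := by
  by_contra hcon
  push Not at hcon
  have hcon' : ∀ j, ¬ u i j ≤ -4 / q ∨ ∃ l, l ≠ i ∧ u l j ≤ -4 / q := by
    intro j
    by_cases h : u i j ≤ -4 / q
    · right; exact hcon j h
    · left; exact h
  -- find w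
  obtain ⟨w, hw⟩ : ∃ w : Fin d → V,
      4 * (univ.filter fun v => ¬ GoodAt ζ L q g Φ Φ0 u (Function.update w i v)).card
        < Fintype.card V := by
    by_contra hno
    push Not at hno
    have h1 := sum_update_box (V := V)
      (fun y : Fin d → V => if ¬ GoodAt ζ L q g Φ Φ0 u y then (1 : ℝ) else 0) i
    simp only [sum_boole] at h1
    have h2 : ∑ y : Fin d → V, (Fintype.card V : ℝ) ≤ ∑ y : Fin d → V, 4 *
        ((univ.filter fun v => ¬ GoodAt ζ L q g Φ Φ0 u (Function.update y i v)).card : ℝ) :=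
      sum_le_sum fun y _ => by exact_mod_cast hno y
    rw [← mul_sum, h1] at h2
    simp only [sum_const, card_univ, nsmul_eq_mul] at h2
    have h3 : (4 * (univ.filter fun y => ¬ GoodAt ζ L q g Φ Φ0 u y).card : ℝ)
      < Fintype.card (Fin d → V) := by exact_mod_cast hbad
    have h4 : (0 : ℝ) < Fintype.card V := by
      have : 0 < Fintype.card V := Fintype.card_pos
      exact_mod_cast this
    nlinarith
  have hgood : 3 * Fintype.card V <
      4 * (univ.filter fun v => GoodAt ζ L q g Φ Φ0 u (Function.update w i v)).card := by
    have := card_filter_add_card_filter_not (s := (univ : Finset V))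
      (fun v => GoodAt ζ L q g Φ Φ0 u (Function.update w i v))
    rw [card_univ] at this
    omega
  obtain ⟨v0, hv0⟩ : (univ.filter fun v => GoodAt ζ L q g Φ Φ0 u (Function.update w i v)).Nonempty := by
    rw [← card_pos]; omega
  have hv0' := (mem_filter.1 hv0).2
  have h5 := G.growth (Φ0 (Function.update w i v0)) (A * (2 * W + 2))
    ((univ.filter fun v => GoodAt ζ L q g Φ Φ0 u (Function.update w i v)).image
      fun v => Φ0 (Function.update w i v)) (by
      intro p hp
      obtain ⟨v, hv, rfl⟩ := mem_image.1 hp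
      have hv' := (mem_filter.1 hv).2
      have hag : ∀ l, l ≠ i → Function.update w i v0 l = Function.update w i v l := by
        intro l hl; simp [hl]
      exact LL_close_dd G B P hv0' hv' hag (fun j => LL_close G B P hv0' hv' hag (hcon' j)))
  rw [card_image_of_injective] at h5
  · omega
  · intro v v' h
    have := B.b4 h
    simpa using congrFun this i

open Classical in
lemma LL_ref (G : GM b ζ ξ dd A) (B : LBx dd L c0 c1 e Φ Φ0) (P : LPar A L c0 c1 q g h1 lL W b)
    {i j : Fin d} (hs : u i j ≤ -4 / q) (hother : ∀ j', j' ≠ j → ∃ l, l ≠ i ∧ u l j' ≤ -4 / q)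
    {lab : Γ → Λ} {nb : Γ → Prop} {w2 w3 Z : ℕ} (hlab : Lab b ζ ξ j w2 w3 W Z lab nb)
    (hw2 : 2 * (A * c0) * (c1 + 1) + 2 ≤ w2) (hw3 : w2 + (g + A * c0 + 4 * q) + 1 ≤ w3)
    (hZ : 2 * (A * c0) * L ≤ Z) :
    ∃ l : V → Option Λ, (∀ a, (univ.filter fun v => l v = some a).card ≤ A ^ (A * (2 * W + 2))) ∧
      (univ.filter fun y : Fin d → V => l (y i) ≠ some (lab (Φ0 y))).card ≤
        4 * (univ.filter fun y => ¬ GoodAt ζ L q g Φ Φ0 u y).card +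
        (univ.filter fun y => nb (Φ0 y)).card := by
  have hb := P.hb
  let ℓ : (Fin d → V) → V → Option Λ := fun w v =>
    if GoodAt ζ L q g Φ Φ0 u (Function.update w i v) then some (lab (Φ0 (Function.update w i v)))
    else none
  obtain ⟨w, hw⟩ : ∃ w : Fin d → V,
      (univ.filter fun y : Fin d → V => ℓ w (y i) ≠ some (lab (Φ0 y))).card ≤
        4 * (univ.filter fun y => ¬ GoodAt ζ L q g Φ Φ0 u y).card +
        (univ.filter fun y => nb (Φ0 y)).card := by
    by_contra hno
    push Not at hno
    let bad : (Fin d → V) → ℝ := fun y => if ¬ GoodAt ζ L q g Φ Φ0 u y then 1 else 0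
    let nbf : (Fin d → V) → ℝ := fun y => if nb (Φ0 y) then 1 else 0
    have hpt : ∀ y w : Fin d → V, (if ℓ w (y i) ≠ some (lab (Φ0 y)) then (1 : ℝ) else 0) ≤
        bad y + bad (y + e i) + nbf y + bad (Function.update w i (y i)) +
          bad (Function.update w i (y i) + e i) := by
      intro y w
      have p0 : ∀ y, 0 ≤ bad y := fun y => by simp only [bad]; split_ifs <;> norm_num
      have p1 : 0 ≤ nbf y := by simp only [nbf]; split_ifs <;> norm_num
      have q1 := p0 y
      have q2 := p0 (y + e i)
      have q3 := p0 (Function.update w i (y i))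
      have q4 := p0 (Function.update w i (y i) + e i)
      by_cases k1 : GoodAt ζ L q g Φ Φ0 u y
      swap
      · have : bad y = 1 := by simp [bad, k1]
        split_ifs <;> linarith
      by_cases k2 : GoodAt ζ L q g Φ Φ0 u (y + e i)
      swap
      · have : bad (y + e i) = 1 := by simp [bad, k2]
        split_ifs <;> linarith
      by_cases k3 : GoodAt ζ L q g Φ Φ0 u (Function.update w i (y i))
      swap
      · have : bad (Function.update w i (y i)) = 1 := by simp [bad, k3]
        split_ifs <;> linarith
      by_cases k4 : GoodAt ζ L q g Φ Φ0 u (Function.update w i (y i) + e i)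
      swap
      · have : bad (Function.update w i (y i) + e i) = 1 := by simp [bad, k4]
        split_ifs <;> linarith
      by_cases k5 : nb (Φ0 y)
      · have : nbf y = 1 := by simp [nbf, k5]
        split_ifs <;> linarith
      have hyy : y i = Function.update w i (y i) i := by simp
      have hz : |ζ (Φ0 y) j - ζ (Φ0 (Function.update w i (y i))) j| ≤
          (2 * (A * c0) * (c1 + 1) + 2 : ℕ) := by
        rw [abs_le]
        constructor
        · have := LL_zlem G B P hs hother hyy.symm k3 k4 k1 k2; linarith
        · exact LL_zlem G B P hs hother hyy k1 k2 k3 k4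
      have hz2 : |ζ (Φ0 y) j - ζ (Φ0 (Function.update w i (y i))) j| ≤ w2 :=
        hz.trans (by exact_mod_cast hw2)
      have f1 := LL_F1 G B P k1 hs
      have f2 := LL_F1 G B P k3 hs
      rw [← B.b2 y _ i hyy] at f2
      have hx := two_close hb hz2 f1 f2
      have hl := hlab.L1 _ _ k5 hz2 (hx.trans (zpow_mono hb (by
        have : ((w2 + (g + A * c0 + 4 * q) + 1 : ℕ) : ℤ) ≤ w3 := by exact_mod_cast hw3
        linarith)))
      have : ℓ w (y i) = some (lab (Φ0 y)) := by simp only [ℓ, k3, if_true, hl]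
      rw [if_neg (by simpa using this)]
      linarith
    have h1 : ∑ y : Fin d → V, ∑ w : Fin d → V,
        (if ℓ w (y i) ≠ some (lab (Φ0 y)) then (1 : ℝ) else 0) ≤
        Fintype.card (Fin d → V) * (4 * ∑ y, bad y + ∑ y, nbf y) := by
      refine (sum_le_sum fun y _ => sum_le_sum fun w _ => hpt y w).trans ?_
      simp only [sum_add_distrib, sum_const, card_univ, nsmul_eq_mul, ← mul_sum]
      rw [sum_swap_box bad i, sum_swap_box (fun y => bad (y + e i)) i]
      have h2 : ∑ y : Fin d → V, bad (y + e i) = ∑ y, bad y :=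
        Fintype.sum_equiv (Equiv.addRight (e i)) _ _ fun y => rfl
      rw [h2]
      apply le_of_eq; ring
    rw [sum_comm] at h1
    simp only [sum_boole, bad, nbf] at h1
    have h3 : ∑ w : Fin d → V, ((4 * (univ.filter fun y => ¬ GoodAt ζ L q g Φ Φ0 u y).card +
        (univ.filter fun y => nb (Φ0 y)).card : ℕ) : ℝ) <
        ∑ w : Fin d → V, ((univ.filter fun y : Fin d → V => ℓ w (y i) ≠ some (lab (Φ0 y))).card : ℝ) := by
      apply sum_lt_sum_of_nonempty ⟨0, mem_univ _⟩
      intro w _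
      exact_mod_cast hno w
    simp only [sum_const, card_univ, nsmul_eq_mul] at h3
    push_cast at h3
    linarith
  refine ⟨ℓ w, fun a => ?_, hw⟩
  by_cases hne : (univ.filter fun v => ℓ w v = some a).Nonempty
  swap
  · rw [not_nonempty_iff_eq_empty] at hne; rw [hne]; simp
  obtain ⟨v0, hv0⟩ := hne
  have key : ∀ v, ℓ w v = some a → GoodAt ζ L q g Φ Φ0 u (Function.update w i v) ∧
      lab (Φ0 (Function.update w i v)) = a := by
    intro v hv
    simp only [ℓ] at hv
    split_ifs at hv with h
    exact ⟨h, by simpa using hv⟩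
  obtain ⟨g0, l0⟩ := key v0 (mem_filter.1 hv0).2
  have h5 := G.growth (Φ0 (Function.update w i v0)) (A * (2 * W + 2))
    ((univ.filter fun v => ℓ w v = some a).image
      fun v => Φ0 (Function.update w i v)) (by
      intro p hp
      obtain ⟨v, hv, rfl⟩ := mem_image.1 hp
      obtain ⟨gv, lv⟩ := key v (mem_filter.1 hv).2
      have hag : ∀ l, l ≠ i → Function.update w i v0 l = Function.update w i v l := by
        intro l hl; simp [hl]
      refine LL_close_dd G B P g0 gv hag (fun j' => ?_)
      by_cases hjj : j' = j
      · subst hjj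
        have hd : ∀ (y : Fin d → V) (t : ℕ), dd (Φ0 y) (Φ y i (-(t : ℤ))) ≤ c0 * t := by
          intro y t
          induction t with
          | zero => simp [B.b0, G.self]
          | succ t ih =>
            have h1 := B.b1 y i (-((t + 1 : ℕ) : ℤ))
            have h2 : (-((t + 1 : ℕ) : ℤ)) + 1 = -(t : ℤ) := by push_cast; ring
            rw [h2, G.symm] at h1
            have h3 := G.tri (Φ0 y) (Φ y i (-(t : ℤ))) (Φ y i (-((t + 1 : ℕ) : ℤ)))
            rw [mul_add]; omega
        have h1 := hd (Function.update w i v0) L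
        have h2 := hd (Function.update w i v) L
        rw [← B.b3 _ _ i hag, G.symm] at h2
        have h3 := G.tri (Φ0 (Function.update w i v0)) (Φ (Function.update w i v0) i (-(L : ℤ)))
          (Φ0 (Function.update w i v))
        have h4 : A * dd (Φ0 (Function.update w i v0)) (Φ0 (Function.update w i v)) ≤ Z := by
          refine le_trans (Nat.mul_le_mul_left A (by omega : _ ≤ 2 * (c0 * L))) (le_trans (le_of_eq ?_) hZ)
          ring
        have h4' : ((A * dd (Φ0 (Function.update w i v0)) (Φ0 (Function.update w i v)) : ℕ) : ℤ) ≤ Z := by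
          exact_mod_cast h4
        refine hlab.L2 _ _ (by rw [l0, lv]) ((G.m1z _ _ _).trans h4')
          ((G.m1x _ _ _).trans (zpow_mono hb (by linarith)))
      · exact LL_close G B P g0 gv hag (Or.inr (hother j' hjj)))
  rw [card_image_of_injective] at h5
  · exact h5
  · intro v v' h
    have := B.b4 h
    simpa using congrFun this i

open Classical in
theorem LL_main (G : GM b ζ ξ dd A) (B : LBx dd L c0 c1 e Φ Φ0) (P : LPar A L c0 c1 q g h1 lL W b)
    (hν : 4 * A ^ (A * (2 * W + 2)) < 3 * Fintype.card V)
    {j0 j1 : Fin d} (hj : j0 ≠ j1)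
    {lab0 : Γ → Λ0} {lab1 : Γ → Λ1} {nb0 nb1 : Γ → Prop} {w2 w3 Z : ℕ}
    (hlab0 : Lab b ζ ξ j0 w2 w3 W Z lab0 nb0) (hlab1 : Lab b ζ ξ j1 w2 w3 W Z lab1 nb1)
    (hw2 : 2 * (A * c0) * (c1 + 1) + 2 ≤ w2) (hw3 : w2 + (g + A * c0 + 4 * q) + 1 ≤ w3)
    (hZ : 2 * (A * c0) * L ≤ Z)
    {F : Λ0 → Λ1 → ℝ} (hF : ∀ x y, |F x y| ≤ 1) {ε : ℝ} (hε : 0 ≤ ε)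
    (hQ : QLp V F (A ^ (A * (2 * W + 2))) ε) :
    |∑ y : Fin d → V, F (lab0 (Φ0 y)) (lab1 (Φ0 y))| ≤
      20 * (univ.filter fun y => ¬ GoodAt ζ L q g Φ Φ0 u y).card +
      2 * (univ.filter fun y => nb0 (Φ0 y)).card + 2 * (univ.filter fun y => nb1 (Φ0 y)).card +
      ε * Fintype.card (Fin d → V) := by
  by_cases hbad : 4 * (univ.filter fun y => ¬ GoodAt ζ L q g Φ Φ0 u y).card < Fintype.card (Fin d → V)
  swap
  · push Not at hbad
    have h1 : |∑ y : Fin d → V, F (lab0 (Φ0 y)) (lab1 (Φ0 y))| ≤ Fintype.card (Fin d → V) := by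
      refine (abs_sum_le_sum_abs _ _).trans ((sum_le_sum fun y _ => hF _ _).trans ?_)
      simp
    have h2 : (Fintype.card (Fin d → V) : ℝ) ≤
      4 * (univ.filter fun y => ¬ GoodAt ζ L q g Φ Φ0 u y).card := by exact_mod_cast hbad
    have h3 : (0 : ℝ) ≤ ε * Fintype.card (Fin d → V) := by positivity
    have h4 : (0 : ℝ) ≤ (univ.filter fun y => nb0 (Φ0 y)).card := by positivity
    have h5 : (0 : ℝ) ≤ (univ.filter fun y => nb1 (Φ0 y)).card := by positivity
    have h6 : (0 : ℝ) ≤ (univ.filter fun y => ¬ GoodAt ζ L q g Φ Φ0 u y).card := by positivity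
    linarith
  choose σ hσ1 hσ2 using LL_seen G B P hν hbad
  have hinj : Function.Injective σ := by
    intro i i' h
    by_contra hne
    have := hσ2 i i' (Ne.symm hne)
    rw [h] at this
    exact this (hσ1 i')
  have hsurj : Function.Surjective σ := Finite.surjective_of_injective hinj
  obtain ⟨i0, hi0⟩ := hsurj j0
  obtain ⟨i1, hi1⟩ := hsurj j1
  have hii : i0 ≠ i1 := by rintro rfl; exact hj (hi0.symm.trans hi1)
  have hoth : ∀ i j', j' ≠ σ i → ∃ l, l ≠ i ∧ u l j' ≤ -4 / q := by
    intro i j' h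
    obtain ⟨l, rfl⟩ := hsurj j'
    exact ⟨l, fun h' => h (by rw [h']), hσ1 l⟩
  obtain ⟨l0, f0, m0⟩ := LL_ref G B P (hi0 ▸ hσ1 i0) (hi0 ▸ hoth i0) hlab0 hw2 hw3 hZ
  obtain ⟨l1, f1, m1⟩ := LL_ref G B P (hi1 ▸ hσ1 i1) (hi1 ▸ hoth i1) hlab1 hw2 hw3 hZ
  have hq := hQ l0 l1 f0 f1
  have hsum := sum_two_box (fun v v' => optF F (l0 v) (l1 v')) hii
  have hVpos : (0 : ℝ) < (Fintype.card V : ℝ) := by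
    have : 0 < Fintype.card V := Fintype.card_pos
    exact_mod_cast this
  have hmain : |∑ y : Fin d → V, optF F (l0 (y i0)) (l1 (y i1))| ≤ ε * Fintype.card (Fin d → V) := by
    have h1 : (Fintype.card V : ℝ) ^ 2 * |∑ y : Fin d → V, optF F (l0 (y i0)) (l1 (y i1))| =
        Fintype.card (Fin d → V) * |∑ v, ∑ v', optF F (l0 v) (l1 v')| := by
      have := congrArg abs hsum
      rw [abs_mul, abs_mul, abs_of_nonneg (by positivity : (0 : ℝ) ≤ (Fintype.card V : ℝ) ^ 2),
        abs_of_nonneg (by positivity : (0 : ℝ) ≤ (Fintype.card (Fin d → V) : ℝ))] at this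
      exact this
    have h2 : (Fintype.card V : ℝ) ^ 2 * |∑ y : Fin d → V, optF F (l0 (y i0)) (l1 (y i1))| ≤
        (Fintype.card V : ℝ) ^ 2 * (ε * Fintype.card (Fin d → V)) := by
      rw [h1]
      calc _ ≤ (Fintype.card (Fin d → V) : ℝ) * (ε * (Fintype.card V : ℝ) ^ 2) :=
            mul_le_mul_of_nonneg_left hq (by positivity)
        _ = _ := by ring
    exact le_of_mul_le_mul_left h2 (by positivity)
  have hopt : ∀ a c, |optF F a c| ≤ 1 := by
    intro a c
    rcases a with _ | a <;> rcases c with _ | c <;> simp [optF, hF]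
  have hdiff : |∑ y : Fin d → V, F (lab0 (Φ0 y)) (lab1 (Φ0 y)) -
      ∑ y : Fin d → V, optF F (l0 (y i0)) (l1 (y i1))| ≤
      2 * (univ.filter fun y : Fin d → V => l0 (y i0) ≠ some (lab0 (Φ0 y))).card +
      2 * (univ.filter fun y : Fin d → V => l1 (y i1) ≠ some (lab1 (Φ0 y))).card := by
    rw [← sum_sub_distrib]
    refine (abs_sum_le_sum_abs _ _).trans ?_
    have h1 : ∀ y : Fin d → V, |F (lab0 (Φ0 y)) (lab1 (Φ0 y)) - optF F (l0 (y i0)) (l1 (y i1))| ≤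
        2 * (if l0 (y i0) ≠ some (lab0 (Φ0 y)) then (1 : ℝ) else 0) +
        2 * (if l1 (y i1) ≠ some (lab1 (Φ0 y)) then (1 : ℝ) else 0) := by
      intro y
      have h2 : |F (lab0 (Φ0 y)) (lab1 (Φ0 y)) - optF F (l0 (y i0)) (l1 (y i1))| ≤ 2 := by
        have := abs_sub (F (lab0 (Φ0 y)) (lab1 (Φ0 y))) (optF F (l0 (y i0)) (l1 (y i1)))
        linarith [hF (lab0 (Φ0 y)) (lab1 (Φ0 y)), hopt (l0 (y i0)) (l1 (y i1))]
      by_cases k0 : l0 (y i0) = some (lab0 (Φ0 y))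
      · by_cases k1 : l1 (y i1) = some (lab1 (Φ0 y))
        · simp [k0, k1, optF]
        · rw [if_pos k1]
          split_ifs <;> linarith
      · rw [if_pos k0]
        split_ifs <;> linarith
    refine (sum_le_sum fun y _ => h1 y).trans ?_
    rw [sum_add_distrib, ← mul_sum, ← mul_sum, sum_boole, sum_boole]
  have m0' : ((univ.filter fun y : Fin d → V => l0 (y i0) ≠ some (lab0 (Φ0 y))).card : ℝ) ≤
      4 * (univ.filter fun y => ¬ GoodAt ζ L q g Φ Φ0 u y).card +
        (univ.filter fun y => nb0 (Φ0 y)).card := by exact_mod_cast m0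
  have m1' : ((univ.filter fun y : Fin d → V => l1 (y i1) ≠ some (lab1 (Φ0 y))).card : ℝ) ≤
      4 * (univ.filter fun y => ¬ GoodAt ζ L q g Φ Φ0 u y).card +
        (univ.filter fun y => nb1 (Φ0 y)).card := by exact_mod_cast m1
  have h6 : (0 : ℝ) ≤ (univ.filter fun y => ¬ GoodAt ζ L q g Φ Φ0 u y).card := by positivity
  have h7 := abs_sub_abs_le_abs_sub (∑ y : Fin d → V, F (lab0 (Φ0 y)) (lab1 (Φ0 y)))
    (∑ y : Fin d → V, optF F (l0 (y i0)) (l1 (y i1)))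
  linarith

end LL
end NR


namespace NR
open Finset
set_option linter.unusedSectionVars false

def bs (s : Bool) : ℝ := if s then 1 else -1

lemma bs_abs (s : Bool) : |bs s| = 1 := by cases s <;> simp [bs]

lemma bs_mul_self (s : Bool) : bs s * bs s = 1 := by cases s <;> simp [bs]

def FQ {α β : Type*} (Q : α → β → Bool) : α × Bool → β → ℝ := fun x c => bs x.2 * bs (Q x.1 c)

lemma FQ_abs {α β : Type*} (Q : α → β → Bool) (x : α × Bool) (c : β) : |FQ Q x c| = 1 := by
  simp [FQ, abs_mul, bs_abs]

lemma chernoff {κ : Type*} [Fintype κ] [DecidableEq κ] (c : κ → ℝ) (lam : ℝ) :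
    ∑ Q : κ → Bool, Real.exp (lam * ∑ k, c k * bs (Q k)) ≤
      2 ^ Fintype.card κ * Real.exp (lam ^ 2 * (∑ k, c k ^ 2) / 2) := by
  have h1 : ∀ Q : κ → Bool, Real.exp (lam * ∑ k, c k * bs (Q k)) =
      ∏ k, Real.exp (lam * (c k * bs (Q k))) := by
    intro Q; rw [mul_sum, Real.exp_sum]
  simp_rw [h1]
  have hp := Finset.sum_prod_piFinset (univ : Finset Bool)
    (fun (k : κ) (s : Bool) => Real.exp (lam * (c k * bs s)))
  rw [Fintype.piFinset_univ] at hp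
  rw [hp]
  have h2 : ∀ k, ∑ s : Bool, Real.exp (lam * (c k * bs s)) ≤ 2 * Real.exp (lam ^ 2 * (c k ^ 2) / 2) := by
    intro k
    have h3 := Real.cosh_le_exp_half_sq (lam * c k)
    rw [Real.cosh_eq] at h3
    have h4 : (lam * c k) ^ 2 / 2 = lam ^ 2 * (c k ^ 2) / 2 := by ring
    rw [h4] at h3
    simp only [Fintype.sum_bool, bs]
    simp
    linarith
  calc _ ≤ ∏ k, (2 * Real.exp (lam ^ 2 * (c k ^ 2) / 2)) :=
        prod_le_prod (fun k _ => by positivity) (fun k _ => h2 k)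
    _ = _ := by
        rw [prod_mul_distrib, ← Real.exp_sum, mul_sum, sum_div]; simp

lemma hoeff {κ : Type*} [Fintype κ] [DecidableEq κ] (c : κ → ℝ) (s t : ℝ) (hs : 0 < s) (ht : 0 < t)
    (hc : ∑ k, c k ^ 2 ≤ s) :
    ((univ.filter fun Q : κ → Bool => t < ∑ k, c k * bs (Q k)).card : ℝ) ≤
      2 ^ Fintype.card κ * Real.exp (-(t ^ 2 / (2 * s))) := by
  set lam := t / s with hl
  have hlp : 0 < lam := by positivity
  have h1 := chernoff c lam
  have h2 : ((univ.filter fun Q : κ → Bool => t < ∑ k, c k * bs (Q k)).card : ℝ) * Real.exp (lam * t) ≤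
      ∑ Q : κ → Bool, Real.exp (lam * ∑ k, c k * bs (Q k)) := by
    rw [← nsmul_eq_mul, ← sum_const]
    refine (sum_le_sum (fun Q hQ => ?_)).trans
      (sum_le_sum_of_subset_of_nonneg (filter_subset _ _) (fun _ _ _ => (Real.exp_pos _).le))
    apply Real.exp_le_exp.2
    exact mul_le_mul_of_nonneg_left (mem_filter.1 hQ).2.le hlp.le
  have h3 : Real.exp (lam ^ 2 * (∑ k, c k ^ 2) / 2) ≤ Real.exp (lam ^ 2 * s / 2) := by
    apply Real.exp_le_exp.2
    have := mul_le_mul_of_nonneg_left hc (sq_nonneg lam)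
    linarith
  have h4 : lam ^ 2 * s / 2 = -(t ^ 2 / (2 * s)) + lam * t := by rw [hl]; field_simp; ring
  rw [h4, Real.exp_add] at h3
  have h5 : (0 : ℝ) < 2 ^ Fintype.card κ := by positivity
  have h6 := Real.exp_pos (lam * t)
  have h7 : ((univ.filter fun Q : κ → Bool => t < ∑ k, c k * bs (Q k)).card : ℝ) * Real.exp (lam * t) ≤
      (2 ^ Fintype.card κ * Real.exp (-(t ^ 2 / (2 * s)))) * Real.exp (lam * t) := by
    calc _ ≤ _ := h2.trans h1
      _ ≤ 2 ^ Fintype.card κ * (Real.exp (-(t ^ 2 / (2 * s))) * Real.exp (lam * t)) :=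
        mul_le_mul_of_nonneg_left h3 h5.le
      _ = _ := by ring
  exact le_of_mul_le_mul_right h7 h6

section
variable {α β V : Type*} [Fintype α] [Fintype β] [Fintype V]

open Classical in
noncomputable def xco (l0 : V → Option (α × Bool)) (a : α) : ℝ :=
  ∑ v, ((if l0 v = some (a, true) then (1 : ℝ) else 0) - (if l0 v = some (a, false) then 1 else 0))

open Classical in
noncomputable def nco (l1 : V → Option β) (c : β) : ℝ := ∑ v, (if l1 v = some c then (1 : ℝ) else 0)

open Classical in
lemma opt_expand (Q : α → β → Bool) (l0 : V → Option (α × Bool)) (l1 : V → Option β) :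
    ∑ v, ∑ v', optF (FQ Q) (l0 v) (l1 v') =
      ∑ k : α × β, (xco l0 k.1 * nco l1 k.2) * bs (Q k.1 k.2) := by
  rw [Fintype.sum_prod_type]
  have h : ∀ v v', optF (FQ Q) (l0 v) (l1 v') = ∑ a, ∑ c,
      (((if l0 v = some (a, true) then (1 : ℝ) else 0) - (if l0 v = some (a, false) then 1 else 0)) *
        (if l1 v' = some c then (1 : ℝ) else 0)) * bs (Q a c) := by
    intro v v'
    rcases l1 v' with _ | c
    · cases l0 v <;> simp [optF]
    · rcases l0 v with _ | ⟨a, s⟩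
      · simp [optF]
      · have : ∀ a', ∑ c', (((if some (a, s) = some (a', true) then (1 : ℝ) else 0) -
            (if some (a, s) = some (a', false) then 1 else 0)) *
            (if some c = some c' then (1 : ℝ) else 0)) * bs (Q a' c') =
            if a = a' then bs s * bs (Q a' c) else 0 := by
          intro a'
          rw [Finset.sum_eq_single c]
          · by_cases h : a = a'
            · cases s <;> simp [h, bs]
            · simp [h]
          · intro c' _ hc; simp [Ne.symm hc]
          · simp
        simp_rw [this]
        simp [optF, FQ]
  simp_rw [h, xco, nco]
  simp_rw [Finset.sum_mul_sum, sum_mul]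
  have e1 : ∀ v : V, ∑ v' : V, ∑ a, ∑ c,
      (((if l0 v = some (a, true) then (1 : ℝ) else 0) - (if l0 v = some (a, false) then 1 else 0)) *
        (if l1 v' = some c then (1 : ℝ) else 0)) * bs (Q a c) = ∑ a, ∑ c, ∑ v' : V,
      (((if l0 v = some (a, true) then (1 : ℝ) else 0) - (if l0 v = some (a, false) then 1 else 0)) *
        (if l1 v' = some c then (1 : ℝ) else 0)) * bs (Q a c) := by
    intro v
    rw [sum_comm]
    refine sum_congr rfl fun a _ => ?_
    rw [sum_comm]
  simp_rw [e1]
  rw [sum_comm]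
  refine sum_congr rfl fun a _ => ?_
  rw [sum_comm]

open Classical in
lemma nco_sq (l1 : V → Option β) (ν : ℕ)
    (h : ∀ a, (univ.filter fun v => l1 v = some a).card ≤ ν) :
    ∑ c, nco l1 c ^ 2 ≤ ν * Fintype.card V := by
  have h1 : ∀ c, nco l1 c ^ 2 ≤ ν * nco l1 c := by
    intro c
    have : nco l1 c ≤ ν := by simp only [nco, sum_boole]; exact_mod_cast h c
    have h0 : 0 ≤ nco l1 c := by simp only [nco, sum_boole]; positivity
    nlinarith
  refine (sum_le_sum fun c _ => h1 c).trans ?_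
  rw [← mul_sum]
  refine mul_le_mul_of_nonneg_left ?_ (by positivity)
  simp only [nco]
  rw [sum_comm]
  have : ∀ v : V, ∑ c, (if l1 v = some c then (1 : ℝ) else 0) ≤ 1 := by
    intro v
    rcases l1 v with _ | c <;> simp
  refine (sum_le_sum fun v _ => this v).trans ?_
  simp

open Classical in
lemma xco_sq (l0 : V → Option (α × Bool)) (ν : ℕ)
    (h : ∀ a, (univ.filter fun v => l0 v = some a).card ≤ ν) :
    ∑ a, xco l0 a ^ 2 ≤ 2 * (ν * Fintype.card V) := by
  have h0 := nco_sq l0 ν (fun a => by convert h a)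
  rw [Fintype.sum_prod_type] at h0
  have h1 : ∀ a, xco l0 a ^ 2 ≤ 2 * ∑ s : Bool, nco l0 (a, s) ^ 2 := by
    intro a
    have : xco l0 a = nco l0 (a, true) - nco l0 (a, false) := by
      simp only [xco, nco, sum_sub_distrib]
      congr! 3
    rw [this, Fintype.sum_bool]
    nlinarith [sq_nonneg (nco l0 (a, true) + nco l0 (a, false))]
  refine (sum_le_sum fun c _ => h1 c).trans ?_
  rw [← mul_sum]
  linarith

open Classical in
theorem QL (ν : ℕ) (hν : 1 ≤ ν) (ε : ℝ) (hε : 0 < ε) (hV : 0 < Fintype.card V)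
    (hbig : 2 * ((2 * Fintype.card α + 1 : ℝ) ^ Fintype.card V * (Fintype.card β + 1 : ℝ) ^ Fintype.card V) <
      Real.exp (ε ^ 2 * (Fintype.card V : ℝ) ^ 2 / (4 * ν ^ 2))) :
    ∃ Q : α → β → Bool, QLp V (FQ Q) ν ε := by
  by_contra hno
  push Not at hno
  have hVr : (0 : ℝ) < Fintype.card V := by exact_mod_cast hV
  have hνr : (0 : ℝ) < ν := by exact_mod_cast hν
  set t : ℝ := ε * (Fintype.card V : ℝ) ^ 2 with ht
  set s : ℝ := 2 * ν ^ 2 * (Fintype.card V : ℝ) ^ 2 with hs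
  have ht0 : 0 < t := by positivity
  have hs0 : 0 < s := by positivity
  let Idx := (V → Option (α × Bool)) × (V → Option β) × Bool
  let co : Idx → α × β → ℝ := fun x k => bs x.2.2 * (xco x.1 k.1 * nco x.2.1 k.2)
  let ok : Idx → Prop := fun x => (∀ a, (univ.filter fun v => x.1 v = some a).card ≤ ν) ∧
    (∀ a, (univ.filter fun v => x.2.1 v = some a).card ≤ ν)
  let bd : Idx → Finset (α × β → Bool) := fun x =>
    univ.filter fun Q : α × β → Bool => t < ∑ k, co x k * bs (Q k)
  have hcov : (univ : Finset (α × β → Bool)) ⊆ (univ.filter ok).biUnion bd := by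
    intro Q _
    have h1 := hno (fun a c => Q (a, c))
    simp only [QLp] at h1
    push Not at h1
    obtain ⟨l0, l1, h2, h3, h4⟩ := h1
    rw [opt_expand] at h4
    rw [mem_biUnion]
    rcases lt_abs.1 h4 with h5 | h5
    · refine ⟨(l0, l1, true), mem_filter.2 ⟨mem_univ _, fun a => by convert h2 a, fun a => by convert h3 a⟩, mem_filter.2 ⟨mem_univ _, ?_⟩⟩
      simpa [co, bs] using h5
    · refine ⟨(l0, l1, false), mem_filter.2 ⟨mem_univ _, fun a => by convert h2 a, fun a => by convert h3 a⟩, mem_filter.2 ⟨mem_univ _, ?_⟩⟩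
      rw [← sum_neg_distrib] at h5
      refine h5.trans_le (le_of_eq (sum_congr rfl fun k _ => ?_))
      simp only [co]; rw [show bs false = -1 by simp [bs]]; ring
  have hbd : ∀ x ∈ univ.filter ok, ((bd x).card : ℝ) ≤
      2 ^ Fintype.card (α × β) * Real.exp (-(t ^ 2 / (2 * s))) := by
    intro x hx
    obtain ⟨_, o1, o2⟩ := mem_filter.1 hx
    apply hoeff _ _ _ hs0 ht0
    have h1 : ∀ k : α × β, co x k ^ 2 = xco x.1 k.1 ^ 2 * nco x.2.1 k.2 ^ 2 := by
      intro k
      simp only [co, mul_pow]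
      rw [pow_two (bs _), bs_mul_self, one_mul]
    simp_rw [h1]
    rw [Fintype.sum_prod_type]
    simp only
    rw [← Finset.sum_mul_sum]
    have h2 := xco_sq x.1 ν o1
    have h3 := nco_sq x.2.1 ν o2
    calc _ ≤ (2 * (ν * Fintype.card V : ℝ)) * (ν * Fintype.card V) :=
          mul_le_mul h2 h3 (sum_nonneg fun _ _ => sq_nonneg _) (by positivity)
      _ = s := by rw [hs]; ring
  have h1 : (2 : ℝ) ^ Fintype.card (α × β) ≤
      Fintype.card Idx * (2 ^ Fintype.card (α × β) * Real.exp (-(t ^ 2 / (2 * s)))) := by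
    have e1 : ((univ : Finset (α × β → Bool)).card : ℝ) = (2 : ℝ) ^ Fintype.card (α × β) := by
      rw [card_univ, Fintype.card_fun]; simp
    rw [← e1]
    calc ((univ : Finset (α × β → Bool)).card : ℝ) ≤ ((univ.filter ok).biUnion bd).card := by
          exact_mod_cast card_le_card hcov
      _ ≤ ∑ x ∈ univ.filter ok, ((bd x).card : ℝ) := by exact_mod_cast card_biUnion_le
      _ ≤ ∑ x ∈ univ.filter ok, 2 ^ Fintype.card (α × β) * Real.exp (-(t ^ 2 / (2 * s))) :=
          sum_le_sum hbd
      _ = (univ.filter ok).card * (2 ^ Fintype.card (α × β) * Real.exp (-(t ^ 2 / (2 * s)))) := by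
          rw [sum_const, nsmul_eq_mul]
      _ ≤ _ := by
          rw [e1]
          apply mul_le_mul_of_nonneg_right _ (by positivity)
          exact_mod_cast card_le_univ _
  have h2 : (Fintype.card Idx : ℝ) = 2 * ((2 * Fintype.card α + 1 : ℝ) ^ Fintype.card V *
      (Fintype.card β + 1 : ℝ) ^ Fintype.card V) := by
    simp only [Idx, Fintype.card_prod, Fintype.card_fun, Fintype.card_option, Fintype.card_bool]
    push_cast; ring
  have h3 : t ^ 2 / (2 * s) = ε ^ 2 * (Fintype.card V : ℝ) ^ 2 / (4 * ν ^ 2) := by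
    rw [ht, hs]; field_simp; ring
  rw [h3, Real.exp_neg, h2] at h1
  have h4 : (0 : ℝ) < 2 ^ Fintype.card (α × β) := by positivity
  set E := Real.exp (ε ^ 2 * (Fintype.card V : ℝ) ^ 2 / (4 * ν ^ 2)) with hE
  have hE0 : 0 < E := Real.exp_pos _
  set N := 2 * ((2 * Fintype.card α + 1 : ℝ) ^ Fintype.card V *
      (Fintype.card β + 1 : ℝ) ^ Fintype.card V)
  have h5 : N * E⁻¹ < 1 := by
    rw [← div_eq_mul_inv, div_lt_one hE0]; exact hbig
  nlinarith

end
end NR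


namespace NR
open Finset
set_option linter.unusedSectionVars false

/-! product-set averaging -/
lemma pi_avg {ι V : Type*} [Fintype ι] [DecidableEq ι] [DecidableEq V] (s : ι → Finset V)
    (f : (ι → V) → ℝ) (j : ι) :
    ∑ i ∈ Fintype.piFinset s, ∑ x ∈ s j, f (Function.update i j x) =
      (s j).card * ∑ i ∈ Fintype.piFinset s, f i := by
  have h1 : ∑ i ∈ Fintype.piFinset s, ∑ x ∈ s j, f (Function.update i j x) =
      ∑ i ∈ Fintype.piFinset s, ∑ x ∈ s j, f i := by
    rw [← sum_product', ← sum_product' (f := fun i _ => f i)]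
    refine sum_nbij' (fun p => (Function.update p.1 j p.2, p.1 j))
      (fun p => (Function.update p.1 j p.2, p.1 j)) ?_ ?_ ?_ ?_ ?_
    · rintro ⟨i, x⟩ h
      simp only [mem_product, Fintype.mem_piFinset] at h ⊢
      refine ⟨fun l => ?_, h.1 j⟩
      by_cases hl : l = j
      · subst hl; simpa using h.2
      · simpa [hl] using h.1 l
    · rintro ⟨i, x⟩ h
      simp only [mem_product, Fintype.mem_piFinset] at h ⊢
      refine ⟨fun l => ?_, h.1 j⟩
      by_cases hl : l = j
      · subst hl; simpa using h.2
      · simpa [hl] using h.1 l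
    · rintro ⟨i, x⟩ h; simp
    · rintro ⟨i, x⟩ h; simp
    · rintro ⟨i, x⟩ h; simp
  rw [h1]; simp [mul_sum]

open Classical in
lemma pi_frac {ι V : Type*} [Fintype ι] [DecidableEq ι] [DecidableEq V] (s : ι → Finset V)
    (p : (ι → V) → Prop) (j : ι) (c : ℝ)
    (h : ∀ i ∈ Fintype.piFinset s, (((s j).filter fun x => p (Function.update i j x)).card : ℝ) ≤
      c * (s j).card) :
    (((Fintype.piFinset s).filter p).card : ℝ) ≤ c * (Fintype.piFinset s).card := by
  by_cases hs : (s j).card = 0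
  · have : Fintype.piFinset s = ∅ := by
      rw [Finset.card_eq_zero] at hs
      exact Fintype.piFinset_eq_empty.2 ⟨j, hs⟩
    rw [this]; simp
  have h1 := pi_avg s (fun i => if p i then (1 : ℝ) else 0) j
  simp only [sum_boole] at h1
  have h2 := sum_le_sum h
  rw [h1] at h2
  simp only [sum_const, nsmul_eq_mul] at h2
  have h3 : (0 : ℝ) < (s j).card := by exact_mod_cast Nat.pos_of_ne_zero hs
  have h4 : ((s j).card : ℝ) * ((Fintype.piFinset s).filter p).card ≤
      ((s j).card : ℝ) * (c * (Fintype.piFinset s).card) := by linarith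
  exact le_of_mul_le_mul_left h4 h3

/-- near-boundary residues -/
def nearB (E B x : ℤ) : Prop := x % E < B ∨ E - B ≤ x % E

/-- counting near boundary residues under an affine map `x ↦ s x + c`, `s = ±1`. -/
lemma count_near (E B lo : ℤ) (m : ℕ) (hE : 0 < E) (hB : 0 ≤ B) (s c : ℤ) (hs : s = 1 ∨ s = -1)
    [DecidablePred fun x => nearB E B (s * x + c)] :
    (((Ico lo (lo + E * m)).filter fun x => nearB E B (s * x + c)).card : ℝ) * E ≤
      2 * B * (Ico lo (lo + E * m)).card := by
  have hcard : ((Ico lo (lo + E * m)).card : ℝ) = E * m := by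
    rw [Int.card_Ico]
    have h0 : 0 ≤ E * m := by positivity
    have h : ((lo + E * m - lo).toNat : ℤ) = E * m := by
      rw [add_sub_cancel_left]; exact Int.toNat_of_nonneg h0
    have : (((lo + E * m - lo).toNat : ℤ) : ℝ) = ((E * m : ℤ) : ℝ) := by rw [h]
    push_cast at this ⊢
    exact_mod_cast this
  rw [hcard]
  have key : ((Ico lo (lo + E * m)).filter fun x => nearB E B (s * x + c)).card ≤
      (2 * B).toNat * (range m).card := by
    refine Finset.card_le_mul_card_image_of_maps_to (f := fun x => ((x - lo) / E).toNat) ?_ _ ?_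
    · intro x hx
      simp only [mem_filter, mem_Ico] at hx
      obtain ⟨⟨h1, h2⟩, _⟩ := hx
      have h3 : (x - lo) / E < m := by
        rw [Int.ediv_lt_iff_lt_mul hE]; linarith
      have h4 : 0 ≤ (x - lo) / E := Int.ediv_nonneg (by linarith) hE.le
      simp only [mem_range]; omega
    · intro k _
      have : (2 * B).toNat = (Ico 0 B ∪ Ico (E - B) E : Finset ℤ).card ∨
          (Ico 0 B ∪ Ico (E - B) E : Finset ℤ).card ≤ (2 * B).toNat := by
        right
        refine (card_union_le _ _).trans ?_
        simp only [Int.card_Ico]; omega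
      have h5 : (Ico 0 B ∪ Ico (E - B) E : Finset ℤ).card ≤ (2 * B).toNat := by
        rcases this with h | h <;> omega
      refine le_trans ?_ h5
      apply card_le_card_of_injOn (fun x => (s * x + c) % E)
      · intro x hx
        simp only [coe_filter, mem_filter, mem_Ico, Set.mem_setOf_eq] at hx
        have h6 := Int.emod_nonneg (s * x + c) hE.ne'
        have h7 := Int.emod_lt_of_pos (s * x + c) hE
        simp only [coe_union, coe_Ico, Set.mem_union, Set.mem_Ico]
        rcases hx.1.2 with h | h
        · left; exact ⟨h6, h⟩
        · right; exact ⟨h, h7⟩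
      · intro x hx y hy hxy
        simp only [coe_filter, mem_filter, mem_Ico, Set.mem_setOf_eq] at hx hy
        have d1 : (x - lo) / E = (y - lo) / E := by
          have e1 : 0 ≤ (x - lo) / E := Int.ediv_nonneg (by linarith) hE.le
          have e2 : 0 ≤ (y - lo) / E := Int.ediv_nonneg (by linarith) hE.le
          omega
        have d2 : E ∣ (s * x + c) - (s * y + c) := Int.ModEq.dvd (show (s * y + c) ≡ (s * x + c) [ZMOD E] from hxy.symm)
        have d3 : E ∣ x - y := by
          rcases hs with rfl | rfl
          · have e : (1 * x + c) - (1 * y + c) = x - y := by ring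
            rwa [e] at d2
          · have e : (-1 * x + c) - (-1 * y + c) = -(x - y) := by ring
            rwa [e, dvd_neg] at d2
        obtain ⟨z, hz⟩ := d3
        have d4 : (x - lo) / E = (y - lo) / E + z := by
          have : x - lo = (y - lo) + E * z := by linarith
          rw [this, Int.add_mul_ediv_left _ _ hE.ne']
        have : z = 0 := by linarith
        subst this
        linarith
  rw [card_range] at key
  have k2 : (((Ico lo (lo + E * m)).filter fun x => nearB E B (s * x + c)).card : ℤ) ≤ 2 * B * m := by
    have h0 : ((2 * B).toNat : ℤ) = 2 * B := Int.toNat_of_nonneg (by linarith)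
    have : (((Ico lo (lo + E * m)).filter fun x => nearB E B (s * x + c)).card : ℤ) ≤ ((2 * B).toNat * m : ℕ) := by
      exact_mod_cast key
    push_cast at this
    rwa [h0] at this
  have k3 : (((Ico lo (lo + E * m)).filter fun x => nearB E B (s * x + c)).card : ℝ) ≤ 2 * B * m := by
    exact_mod_cast k2
  have hE' : (0 : ℝ) < E := by exact_mod_cast hE
  calc _ ≤ (2 * B * m : ℝ) * E := mul_le_mul_of_nonneg_right k3 hE'.le
    _ = _ := by ring

/-- moments -/
lemma moments {ι : Type*} (I : Finset ι) (N : ℕ) (h : ℕ → ι → ℝ) (θ : ℕ → ι → ι)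
    (hpm : ∀ k < N, ∀ i ∈ I, h k i * h k i = 1)
    (hθ : ∀ k < N, ∀ i ∈ I, θ k i ∈ I) (hinv : ∀ k < N, ∀ i ∈ I, θ k (θ k i) = i)
    (hflip : ∀ k < N, ∀ i ∈ I, h k (θ k i) = - h k i)
    (hpres : ∀ k < N, ∀ k' < N, k' ≠ k → ∀ i ∈ I, h k' (θ k i) = h k' i) :
    ∀ n ≤ N, (∑ i ∈ I, (∑ k ∈ range n, h k i) ^ 2 = n * I.card) ∧
      (∑ i ∈ I, (∑ k ∈ range n, h k i) ^ 4 ≤ 3 * (n : ℝ) ^ 2 * I.card) := by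
  intro n
  induction n with
  | zero => intro _; simp
  | succ n ih =>
    intro hn
    obtain ⟨i1, i2⟩ := ih (by omega)
    set S : ι → ℝ := fun i => ∑ k ∈ range n, h k i with hS
    have hSθ : ∀ i ∈ I, S (θ n i) = S i := by
      intro i hi
      refine sum_congr rfl fun k hk => ?_
      have := mem_range.1 hk
      exact hpres n (by omega) k (by omega) (by omega) i hi
    have hz : ∀ p : ℝ → ℝ, ∑ i ∈ I, p (S i) * h n i = 0 := by
      intro p
      have e : ∑ i ∈ I, p (S i) * h n i = ∑ i ∈ I, -(p (S i) * h n i) := by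
        refine sum_nbij' (θ n) (θ n) (hθ n (by omega)) (hθ n (by omega)) (hinv n (by omega))
          (hinv n (by omega)) ?_
        intro i hi
        rw [hSθ i hi, hflip n (by omega) i hi]; ring
      rw [sum_neg_distrib] at e; linarith
    have hsq : ∀ i ∈ I, h n i ^ 2 = 1 := fun i hi => by rw [pow_two]; exact hpm n (by omega) i hi
    constructor
    · have : ∀ i ∈ I, (∑ k ∈ range (n + 1), h k i) ^ 2 = S i ^ 2 + 2 * (S i * h n i) + 1 := by
        intro i hi
        rw [sum_range_succ]
        have := hsq i hi
        change (S i + h n i) ^ 2 = _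
        nlinarith
      rw [sum_congr rfl this, sum_add_distrib, sum_add_distrib, ← mul_sum, hz (fun x => x), i1]
      simp; ring
    · have : ∀ i ∈ I, (∑ k ∈ range (n + 1), h k i) ^ 4 =
          S i ^ 4 + (4 * S i ^ 3 + 4 * S i) * h n i + 6 * S i ^ 2 + 1 := by
        intro i hi
        rw [sum_range_succ]
        have h2 := hsq i hi
        have h3 : h n i ^ 3 = h n i := by rw [pow_succ, h2, one_mul]
        have h4 : h n i ^ 4 = 1 := by rw [show 4 = 2 * 2 by norm_num, pow_mul, h2, one_pow]
        change (S i + h n i) ^ 4 = _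
        have : (S i + h n i) ^ 4 = S i ^ 4 + 4 * S i ^ 3 * h n i + 6 * S i ^ 2 * h n i ^ 2 +
          4 * S i * h n i ^ 3 + h n i ^ 4 := by ring
        rw [this, h2, h3, h4]; ring
      rw [sum_congr rfl this, sum_add_distrib, sum_add_distrib, sum_add_distrib,
        hz (fun x => 4 * x ^ 3 + 4 * x), ← mul_sum, i1]
      simp
      have : (0 : ℝ) ≤ I.card := by positivity
      nlinarith

lemma l1_lower {ι : Type*} (I : Finset ι) (S : ι → ℝ) (R : ℝ) (hR : 0 < R)
    (h2 : ∑ i ∈ I, S i ^ 2 = R ^ 2 * I.card) (h4 : ∑ i ∈ I, S i ^ 4 ≤ 3 * (R ^ 2) ^ 2 * I.card) :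
    R / 4 * I.card ≤ ∑ i ∈ I, |S i| := by
  have h : ∀ i ∈ I, S i ^ 2 / R - S i ^ 4 / (4 * R ^ 3) ≤ |S i| := by
    intro i _
    have h1 : S i ^ 2 = |S i| ^ 2 := (sq_abs _).symm
    have h1' : S i ^ 4 = |S i| ^ 4 := by
      rw [show 4 = 2 * 2 by norm_num, pow_mul, h1, ← pow_mul]
    rw [h1, h1']
    set x := |S i| / R with hx
    have hx0 : 0 ≤ x := by positivity
    have e1 : |S i| = R * x := by rw [hx]; field_simp
    rw [e1]
    have e2 : (R * x) ^ 2 / R - (R * x) ^ 4 / (4 * R ^ 3) = R * (x ^ 2 - x ^ 4 / 4) := by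
      field_simp
    rw [e2]
    apply mul_le_mul_of_nonneg_left _ hR.le
    have : 0 ≤ 1 - x + x ^ 3 / 4 := by nlinarith [sq_nonneg (x - 1), sq_nonneg (x - 2), mul_nonneg hx0 (sq_nonneg (x - 1)), mul_nonneg hx0 (sq_nonneg (x-2))]
    nlinarith
  have h5 := sum_le_sum h
  rw [sum_sub_distrib, ← sum_div, ← sum_div, h2] at h5
  have h6 : (∑ i ∈ I, S i ^ 4) / (4 * R ^ 3) ≤ 3 * (R ^ 2) ^ 2 * I.card / (4 * R ^ 3) :=
    div_le_div_of_nonneg_right h4 (by positivity)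
  have h7 : R ^ 2 * (I.card : ℝ) / R - 3 * (R ^ 2) ^ 2 * I.card / (4 * R ^ 3) = R / 4 * I.card := by
    field_simp; ring
  linarith

end NR


namespace NR
open Finset
set_option linter.unusedSectionVars false

/-- slope -/
noncomputable def slp (F : ℤ → ℝ) (s : ℕ) (x : ℤ) : ℝ := (F (x + s) - F x) / s

/-- averaged slope -/
noncomputable def ust (F : ℤ → ℝ) (T : ℕ) (x : ℤ) : ℝ := (∑ a ∈ range T, slp F T (x - a)) / T

lemma shift_nat (f : ℤ → ℝ) (B : ℝ) (h0 : ∀ x, 0 ≤ f x) (hB : ∀ x, f x ≤ B) (H : ℕ) (a : ℕ) :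
    ∀ c : ℤ, |∑ x ∈ range H, f (x + (c + a)) - ∑ x ∈ range H, f (x + c)| ≤ B * a := by
  induction a with
  | zero => intro c; simp
  | succ a ih =>
    intro c
    have h1 : ∑ x ∈ range H, f ((x : ℤ) + (c + (a + 1 : ℕ))) - ∑ x ∈ range H, f ((x : ℤ) + (c + a)) =
        f (H + (c + a)) - f (c + a) := by
      have := Finset.sum_range_sub (fun x : ℕ => f ((x : ℤ) + (c + a))) H
      rw [← sum_sub_distrib]
      simp only [Nat.cast_zero, zero_add] at this
      rw [← this]
      refine sum_congr rfl fun x _ => ?_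
      congr 2; push_cast; ring
    have h2 : |f (H + (c + a)) - f (c + a)| ≤ B := by
      rw [abs_le]; constructor <;> linarith [h0 (H + (c + a)), h0 (c + a), hB (H + (c + a)), hB (c + a)]
    have h3 := ih c
    rw [abs_le] at *
    push_cast at *
    constructor <;> linarith

lemma shift_int (f : ℤ → ℝ) (B : ℝ) (h0 : ∀ x, 0 ≤ f x) (hB : ∀ x, f x ≤ B) (H : ℕ) (a : ℤ) :
    |∑ x ∈ range H, f (x + a) - ∑ x ∈ range H, f x| ≤ B * |(a : ℝ)| := by
  obtain ⟨k, rfl | rfl⟩ := a.eq_nat_or_neg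
  · have := shift_nat f B h0 hB H k 0
    simpa using this
  · have := shift_nat f B h0 hB H k (-k)
    simp only [neg_add_cancel, add_zero] at this
    rw [abs_sub_comm]; simpa using this

lemma lip_int (F : ℤ → ℝ) (a0 : ℝ) (hF : ∀ x, |F (x + 1) - F x| ≤ a0) (x : ℤ) (k : ℕ) :
    |F (x + k) - F x| ≤ a0 * k := by
  induction k with
  | zero => simp
  | succ k ih =>
    have := hF (x + k)
    rw [abs_le] at *
    push_cast
    rw [← add_assoc]
    constructor <;> linarith

lemma lip_int' (F : ℤ → ℝ) (a0 : ℝ) (hF : ∀ x, |F (x + 1) - F x| ≤ a0) (x y : ℤ) :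
    |F x - F y| ≤ a0 * |((x - y : ℤ) : ℝ)| := by
  obtain ⟨k, h | h⟩ := (x - y).eq_nat_or_neg
  · have : x = y + k := by linarith
    subst this
    have := lip_int F a0 hF y k
    simpa using this
  · have : y = x + k := by linarith
    subst this
    have := lip_int F a0 hF x k
    rw [abs_sub_comm]; simpa using this

lemma slp_abs (F : ℤ → ℝ) (a0 : ℝ) (h0 : 0 ≤ a0) (hF : ∀ x, |F (x + 1) - F x| ≤ a0) (s : ℕ) (x : ℤ) :
    |slp F s x| ≤ a0 := by
  unfold slp
  rcases Nat.eq_zero_or_pos s with rfl | hs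
  · simpa using h0
  have : (0 : ℝ) < s := by exact_mod_cast hs
  rw [abs_div, abs_of_pos this, div_le_iff₀ this]
  exact lip_int F a0 hF x s

lemma slp_sq (F : ℤ → ℝ) (a0 : ℝ) (h0 : 0 ≤ a0) (hF : ∀ x, |F (x + 1) - F x| ≤ a0) (s : ℕ) (x : ℤ) :
    slp F s x ^ 2 ≤ a0 ^ 2 := by
  rw [← sq_abs]; exact pow_le_pow_left₀ (abs_nonneg _) (slp_abs F a0 h0 hF s x) 2

lemma slp_mono (F : ℤ → ℝ) (a0 : ℝ) (h0 : 0 ≤ a0) (hF : ∀ x, |F (x + 1) - F x| ≤ a0)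
    (ρ v H : ℕ) (hρ : 0 < ρ) (hv : 0 < v) :
    ∑ x ∈ range H, slp F (v * ρ) x ^ 2 ≤ ∑ x ∈ range H, slp F ρ x ^ 2 + a0 ^ 2 * (v * ρ : ℕ) := by
  have hv' : (0 : ℝ) < v := by exact_mod_cast hv
  have hρ' : (0 : ℝ) < ρ := by exact_mod_cast hρ
  have e1 : ∀ x : ℤ, slp F (v * ρ) x = (∑ c ∈ range v, slp F ρ (x + (c * ρ : ℕ))) / v := by
    intro x
    unfold slp
    rw [← sum_div]
    have := Finset.sum_range_sub (fun c : ℕ => F (x + (c * ρ : ℕ))) v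
    simp only [Nat.zero_mul, Nat.cast_zero, add_zero] at this
    rw [← this, div_div, mul_comm (ρ : ℝ), Nat.cast_mul]
    congr 1
    refine sum_congr rfl fun c _ => ?_
    congr 2; push_cast; ring
  have e2 : ∀ x : ℤ, v * slp F (v * ρ) x ^ 2 ≤ ∑ c ∈ range v, slp F ρ (x + (c * ρ : ℕ)) ^ 2 := by
    intro x
    have := sq_sum_le_card_mul_sum_sq (s := range v) (f := fun c => slp F ρ (x + (c * ρ : ℕ)))
    rw [card_range] at this
    rw [e1, div_pow]
    have h : (v : ℝ) * ((∑ c ∈ range v, slp F ρ (x + (c * ρ : ℕ))) ^ 2 / v ^ 2) =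
      (∑ c ∈ range v, slp F ρ (x + (c * ρ : ℕ))) ^ 2 / v := by field_simp
    rw [h, div_le_iff₀ hv']; linarith
  have e3 : v * ∑ x ∈ range H, slp F (v * ρ) x ^ 2 ≤
      ∑ c ∈ range v, ∑ x ∈ range H, slp F ρ (x + (c * ρ : ℕ)) ^ 2 := by
    rw [sum_comm, mul_sum]; exact sum_le_sum fun x _ => e2 x
  have e4 : ∀ c ∈ range v, ∑ x ∈ range H, slp F ρ (x + (c * ρ : ℕ)) ^ 2 ≤
      ∑ x ∈ range H, slp F ρ x ^ 2 + a0 ^ 2 * (v * ρ : ℕ) := by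
    intro c hc
    have := shift_int (fun x => slp F ρ x ^ 2) (a0 ^ 2) (fun _ => sq_nonneg _)
      (slp_sq F a0 h0 hF ρ) H (c * ρ : ℕ)
    have h2 : |(((c * ρ : ℕ) : ℤ) : ℝ)| ≤ (v * ρ : ℕ) := by
      rw [Int.cast_natCast, abs_of_nonneg (by positivity)]
      exact_mod_cast Nat.mul_le_mul_right _ (mem_range.1 hc).le
    have h3 := mul_le_mul_of_nonneg_left h2 (sq_nonneg a0)
    have := (abs_le.1 this).2
    linarith
  have e5 := e3.trans (sum_le_sum e4)
  rw [sum_const, card_range, nsmul_eq_mul] at e5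
  exact le_of_mul_le_mul_left e5 hv'

lemma slp_avg (F : ℤ → ℝ) (a0 : ℝ) (h0 : 0 ≤ a0) (hF : ∀ x, |F (x + 1) - F x| ≤ a0)
    (s T : ℕ) (hs : 0 < s) (hT : 0 < T) (δ : ℤ) (hδ : δ = 0 ∨ δ = -s) (x : ℤ) :
    |∑ a ∈ range T, slp F s (x + a + δ) - T * slp F T x| ≤ 2 * a0 * s := by
  have hs' : (0 : ℝ) < s := by exact_mod_cast hs
  have hT' : (0 : ℝ) < T := by exact_mod_cast hT
  have e1 : ∑ a ∈ range T, slp F s (x + a + δ) =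
      (∑ c ∈ range s, (F (x + T + (c + δ)) - F (x + (c + δ)))) / s := by
    unfold slp
    rw [← sum_div]
    congr 1
    have g1 := Finset.sum_range_add (fun a : ℕ => F (x + δ + a)) s T
    have g2 := Finset.sum_range_add (fun a : ℕ => F (x + δ + a)) T s
    rw [add_comm T s, g1] at g2
    rw [sum_sub_distrib, sum_sub_distrib]
    have h1 : ∑ a ∈ range T, F (x + a + δ + s) = ∑ a ∈ range T, F (x + δ + (s + a : ℕ)) :=
      sum_congr rfl fun a _ => by congr 1; push_cast; ring
    have h2 : ∑ a ∈ range T, F (x + a + δ) = ∑ a ∈ range T, F (x + δ + a) :=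
      sum_congr rfl fun a _ => by congr 1; ring
    have h3 : ∑ c ∈ range s, F (x + T + (c + δ)) = ∑ c ∈ range s, F (x + δ + (T + c : ℕ)) :=
      sum_congr rfl fun a _ => by congr 1; push_cast; ring
    have h4 : ∑ c ∈ range s, F (x + (c + δ)) = ∑ c ∈ range s, F (x + δ + c) :=
      sum_congr rfl fun a _ => by congr 1; ring
    rw [h1, h2, h3, h4]; linarith
  have e2 : (T : ℝ) * slp F T x = (∑ c ∈ range s, (F (x + T) - F x)) / s := by
    unfold slp; rw [sum_const, card_range, nsmul_eq_mul]; field_simp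
  rw [e1, e2, ← sub_div, ← sum_sub_distrib, abs_div, abs_of_pos hs', div_le_iff₀ hs']
  refine (abs_sum_le_sum_abs _ _).trans ?_
  have : ∀ c ∈ range s, |F (x + T + (c + δ)) - F (x + (c + δ)) - (F (x + T) - F x)| ≤ 2 * a0 * s := by
    intro c hc
    have hc' := mem_range.1 hc
    have habs : |((c + δ : ℤ) : ℝ)| ≤ s := by
      have : |(c + δ : ℤ)| ≤ s := by rw [abs_le]; omega
      exact_mod_cast this
    have g1 := lip_int' F a0 hF (x + T + (c + δ)) (x + T)
    have g2 := lip_int' F a0 hF (x + (c + δ)) x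
    rw [add_sub_cancel_left] at g1 g2
    have g3 := mul_le_mul_of_nonneg_left habs h0
    have g4 := g1.trans g3
    have g5 := g2.trans g3
    rw [abs_le] at g4 g5 ⊢
    constructor <;> linarith
  refine (sum_le_sum this).trans ?_
  rw [sum_const, card_range, nsmul_eq_mul]; linarith

theorem D1 (F : ℤ → ℝ) (a0 : ℝ) (h0 : 0 ≤ a0) (hF : ∀ x, |F (x + 1) - F x| ≤ a0)
    (ρ v s T H : ℕ) (hρ : 0 < ρ) (hv : 0 < v) (hsv : s = v * ρ) (hsT : s ≤ T)
    (δ : ℤ) (hδ : δ = 0 ∨ δ = -s) :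
    ∑ x ∈ range H, (slp F s (x + δ) - ust F T x) ^ 2 ≤
      ∑ x ∈ range H, slp F ρ x ^ 2 - ∑ x ∈ range H, slp F T x ^ 2 + 7 * a0 ^ 2 * T +
        4 * a0 ^ 2 * s * H / T := by
  have hs : 0 < s := by rw [hsv]; positivity
  have hT : 0 < T := by omega
  have hs' : (0 : ℝ) < s := by exact_mod_cast hs
  have hT' : (0 : ℝ) < T := by exact_mod_cast hT
  have hsT' : (s : ℝ) ≤ T := by exact_mod_cast hsT
  have ha2 : 0 ≤ a0 ^ 2 := sq_nonneg _
  -- Jensen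
  have j1 : ∀ x : ℤ, T * (slp F s (x + δ) - ust F T x) ^ 2 ≤
      ∑ a ∈ range T, (slp F s (x + δ) - slp F T (x - a)) ^ 2 := by
    intro x
    have := sq_sum_le_card_mul_sum_sq (s := range T) (f := fun a => slp F s (x + δ) - slp F T (x - a))
    rw [card_range, sum_sub_distrib, sum_const, card_range, nsmul_eq_mul] at this
    have e : T * slp F s (x + δ) - ∑ a ∈ range T, slp F T (x - a) =
        T * (slp F s (x + δ) - ust F T x) := by
      unfold ust; field_simp
    rw [e, mul_pow] at this
    have h : (T : ℝ) * (T * (slp F s (x + δ) - ust F T x) ^ 2) ≤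
       T * ∑ a ∈ range T, (slp F s (x + δ) - slp F T (x - a)) ^ 2 := by
      calc _ = (T : ℝ) ^ 2 * (slp F s (x + δ) - ust F T x) ^ 2 := by ring
        _ ≤ _ := this
    exact le_of_mul_le_mul_left h hT'
  have j2 : T * ∑ x ∈ range H, (slp F s (x + δ) - ust F T x) ^ 2 ≤
      ∑ a ∈ range T, ∑ x ∈ range H, (slp F s (x + δ) - slp F T (x - a)) ^ 2 := by
    rw [sum_comm, mul_sum]; exact sum_le_sum fun x _ => j1 x
  have j3 : ∀ a ∈ range T, ∑ x ∈ range H, (slp F s (x + δ) - slp F T (x - a)) ^ 2 ≤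
      ∑ x ∈ range H, (slp F s (x + a + δ) - slp F T x) ^ 2 + 4 * a0 ^ 2 * T := by
    intro a ha
    have ha' := mem_range.1 ha
    have := shift_int (fun x => (slp F s (x + δ) - slp F T (x - a)) ^ 2) (4 * a0 ^ 2)
      (fun _ => sq_nonneg _) (fun x => by
        have h1 := slp_abs F a0 h0 hF s (x + δ)
        have h2 := slp_abs F a0 h0 hF T (x - a)
        have h3 : |slp F s (x + δ) - slp F T (x - a)| ≤ 2 * a0 := by
          rw [abs_le] at *; constructor <;> linarith
        rw [← sq_abs]
        calc _ ≤ (2 * a0) ^ 2 := pow_le_pow_left₀ (abs_nonneg _) h3 2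
          _ = _ := by ring) H a
    simp only [add_sub_cancel_right] at this
    have h4 : (4 * a0 ^ 2) * |((a : ℤ) : ℝ)| ≤ 4 * a0 ^ 2 * T := by
      apply mul_le_mul_of_nonneg_left _ (by positivity)
      rw [Int.cast_natCast, abs_of_nonneg (by positivity)]
      exact_mod_cast ha'.le
    have := (abs_le.1 this).1
    linarith
  have j4 : ∀ x : ℤ, ∑ a ∈ range T, (slp F s (x + a + δ) - slp F T x) ^ 2 ≤
      ∑ a ∈ range T, slp F s (x + a + δ) ^ 2 - T * slp F T x ^ 2 + 4 * a0 ^ 2 * s := by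
    intro x
    have e : ∑ a ∈ range T, (slp F s (x + a + δ) - slp F T x) ^ 2 =
      ∑ a ∈ range T, slp F s (x + a + δ) ^ 2 - 2 * slp F T x * ∑ a ∈ range T, slp F s (x + a + δ)
        + T * slp F T x ^ 2 := by
      rw [mul_sum, ← sum_sub_distrib]
      have : (T : ℝ) * slp F T x ^ 2 = ∑ a ∈ range T, slp F T x ^ 2 := by simp
      rw [this, ← sum_add_distrib]
      refine sum_congr rfl fun a _ => by ring
    have h1 := slp_avg F a0 h0 hF s T hs hT δ hδ x
    have h2 := slp_abs F a0 h0 hF T x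
    set E := ∑ a ∈ range T, slp F s (x + a + δ) - T * slp F T x with hE
    have h3 : |slp F T x * E| ≤ a0 * (2 * a0 * s) := by
      rw [abs_mul]; exact mul_le_mul h2 h1 (abs_nonneg _) h0
    have h4 := (abs_le.1 h3).1
    have h5 : ∑ a ∈ range T, slp F s (x + a + δ) = E + T * slp F T x := by rw [hE]; ring
    rw [e, h5]
    nlinarith
  have j5 : ∀ a ∈ range T, ∑ x ∈ range H, slp F s (x + a + δ) ^ 2 ≤
      ∑ x ∈ range H, slp F s x ^ 2 + a0 ^ 2 * T := by
    intro a ha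
    have ha' := mem_range.1 ha
    have := shift_int (fun x => slp F s x ^ 2) (a0 ^ 2) (fun _ => sq_nonneg _)
      (slp_sq F a0 h0 hF s) H (a + δ)
    have h2 : |((a + δ : ℤ) : ℝ)| ≤ T := by
      have : |(a + δ : ℤ)| ≤ T := by rw [abs_le]; omega
      exact_mod_cast this
    have h3 := mul_le_mul_of_nonneg_left h2 ha2
    have := (abs_le.1 this).2
    simp only [← add_assoc] at this h3
    linarith
  have j6 := slp_mono F a0 h0 hF ρ v H hρ hv
  rw [← hsv] at j6
  have k1 := j2.trans (sum_le_sum j3)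
  rw [sum_add_distrib, sum_const, card_range, nsmul_eq_mul, sum_comm] at k1
  have k2 := sum_le_sum (s := range H) fun x _ => j4 (x : ℤ)
  have k3 := sum_le_sum j5
  rw [sum_add_distrib, sum_const, sum_const, card_range, nsmul_eq_mul, nsmul_eq_mul, sum_comm] at k3
  rw [sum_add_distrib, sum_sub_distrib, sum_const, card_range, nsmul_eq_mul, ← mul_sum] at k2
  set X := ∑ x ∈ range H, (slp F s (x + δ) - ust F T x) ^ 2
  set Sρ := ∑ x ∈ range H, slp F ρ x ^ 2
  set Ss := ∑ x ∈ range H, slp F s x ^ 2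
  set ST := ∑ x ∈ range H, slp F T x ^ 2
  have k4 : T * X ≤ T * (Sρ - ST + 7 * a0 ^ 2 * T) + H * (4 * a0 ^ 2 * s) := by
    have : (T : ℝ) * Ss ≤ T * (Sρ + a0 ^ 2 * T) := by
      apply mul_le_mul_of_nonneg_left _ hT'.le
      have := mul_le_mul_of_nonneg_left hsT' ha2
      linarith
    nlinarith [mul_nonneg ha2 (mul_pos hT' hT').le]
  have k5 : X ≤ (T * (Sρ - ST + 7 * a0 ^ 2 * T) + H * (4 * a0 ^ 2 * s)) / T := by
    rw [le_div_iff₀ hT']; linarith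
  refine k5.trans (le_of_eq ?_)
  field_simp

end NR


namespace NR
open Finset
set_option linter.unusedSectionVars false

/-- scale set -/
def SS (m Q₀ ρ T : ℕ) : Finset ℕ :=
  insert T ((range (m + 1) ×ˢ Ico Q₀ (2 * Q₀)).image fun p => 2 ^ p.1 * p.2 * ρ)

lemma SS_card (m Q₀ ρ T : ℕ) : (SS m Q₀ ρ T).card ≤ (m + 1) * Q₀ + 1 := by
  unfold SS
  refine (card_insert_le _ _).trans ?_
  have := card_image_le (s := range (m + 1) ×ˢ Ico Q₀ (2 * Q₀)) (f := fun p => 2 ^ p.1 * p.2 * ρ)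
  rw [card_product, card_range, Nat.card_Ico] at this
  have e : 2 * Q₀ - Q₀ = Q₀ := by omega
  rw [e] at this
  omega

/-- offsets: `0` or `-s` -/
def off (σ : Bool) (s : ℕ) : ℤ := if σ then 0 else -(s : ℤ)

lemma good1 (F : ℤ → ℝ) (a0 u η : ℝ) (q Q₀ ρ m L T : ℕ) (h0 : 0 ≤ a0)
    (hF : ∀ x, |F (x + 1) - F x| ≤ a0) (hu : |u| ≤ a0) (hρ : 0 < ρ) (hQ : 0 < Q₀) 
    (hL : L < 2 ^ (m + 1) * Q₀ * ρ) (hη0 : 0 ≤ η) (hη : η + 2 * a0 / Q₀ ≤ 1 / q) (g : ℝ) (hg : 2 * a0 * Q₀ * ρ ≤ g)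
    (hs : ∀ s ∈ SS m Q₀ ρ T, |slp F s 0 - u| ≤ η) (t : ℕ) (ht : t ≤ L) :
    |F t - F 0 - t * u| ≤ t / q + g := by
  have lip : ∀ k s : ℕ, |F ((s : ℤ) + k) - F s - k * u| ≤ 2 * a0 * k := by
    intro k s
    have h1 := lip_int F a0 hF s k
    have h2 : |(k : ℝ) * u| ≤ a0 * k := by
      rw [abs_mul, abs_of_nonneg (by positivity : (0 : ℝ) ≤ k)]
      nlinarith [(Nat.cast_nonneg k : (0 : ℝ) ≤ k)]
    rw [abs_le] at *
    constructor <;> linarith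
  have hg0 : 0 ≤ g := le_trans (by positivity) hg
  have hQ' : (0 : ℝ) < Q₀ := by exact_mod_cast hQ
  by_cases hsm : t < Q₀ * ρ
  · have h := lip t 0
    simp only [Nat.cast_zero, zero_add] at h
    have h2 : (t : ℝ) ≤ Q₀ * ρ := by exact_mod_cast hsm.le
    have h3 : 2 * a0 * t ≤ g := by
      refine le_trans ?_ hg
      have := mul_le_mul_of_nonneg_left h2 (by positivity : 0 ≤ 2 * a0)
      linarith
    have : (0 : ℝ) ≤ t / q := by positivity
    linarith
  · push Not at hsm
    have hvQ : Q₀ ≤ t / ρ := (Nat.le_div_iff_mul_le hρ).2 hsm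
    have hw : t / ρ / Q₀ ≠ 0 := by
      have := (Nat.le_div_iff_mul_le hQ).2 (by omega : 1 * Q₀ ≤ t / ρ); omega
    obtain ⟨v', hv'⟩ : ∃ v', v' = t / ρ := ⟨_, rfl⟩
    obtain ⟨m', hm'⟩ : ∃ m', m' = Nat.log 2 (v' / Q₀) := ⟨_, rfl⟩
    rw [← hv'] at hw hvQ
    have p1 : 2 ^ m' ≤ v' / Q₀ := by rw [hm']; exact Nat.pow_log_le_self 2 hw
    have p2 : v' / Q₀ < 2 ^ (m' + 1) := by rw [hm']; exact Nat.lt_pow_succ_log_self (by norm_num) _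
    have p3 : 2 ^ m' * Q₀ ≤ v' := (Nat.le_div_iff_mul_le hQ).1 p1
    have p4 : v' < 2 ^ (m' + 1) * Q₀ := (Nat.div_lt_iff_lt_mul hQ).1 p2
    have h2m : 0 < 2 ^ m' := by positivity
    obtain ⟨v, hv⟩ : ∃ v, v = v' / 2 ^ m' := ⟨_, rfl⟩
    have v1 : Q₀ ≤ v := by rw [hv]; exact (Nat.le_div_iff_mul_le h2m).2 (by linarith)
    have v2 : v < 2 * Q₀ := by rw [hv]; exact (Nat.div_lt_iff_lt_mul h2m).2 (by rw [pow_succ] at p4; linarith)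
    have v3 : 2 ^ m' * v ≤ v' := by rw [hv]; exact Nat.mul_div_le _ _
    have v4 : v' < 2 ^ m' * v + 2 ^ m' := by
      rw [hv]; have := Nat.lt_mul_div_succ v' h2m; rwa [mul_add, mul_one] at this
    have t1 : v' * ρ ≤ t := by rw [hv']; exact Nat.div_mul_le_self _ _
    have t2 : t < v' * ρ + ρ := by
      rw [hv']; have := Nat.lt_mul_div_succ t hρ; nlinarith
    have hmm : m' < m + 1 := by
      have : 2 ^ m' * (Q₀ * ρ) < 2 ^ (m + 1) * (Q₀ * ρ) := by
        calc 2 ^ m' * (Q₀ * ρ) = 2 ^ m' * Q₀ * ρ := by ring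
          _ ≤ v' * ρ := Nat.mul_le_mul_right _ p3
          _ < _ := by rw [← mul_assoc]; omega
      have := lt_of_mul_lt_mul_right this (Nat.zero_le _)
      exact (Nat.pow_lt_pow_iff_right (by norm_num)).1 this
    obtain ⟨s, hsd⟩ : ∃ s, s = 2 ^ m' * v * ρ := ⟨_, rfl⟩
    have hsS : s ∈ SS m Q₀ ρ T := by
      unfold SS
      refine mem_insert_of_mem (mem_image.2 ⟨(m', v), ?_, hsd.symm⟩)
      simp only [mem_product, mem_range, mem_Ico]; omega
    have s1 : s ≤ t := by
      rw [hsd]; exact (Nat.mul_le_mul_right _ v3).trans t1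
    have s2 : t - s ≤ 2 ^ m' * ρ := by
      have : (v' + 1) * ρ ≤ (2 ^ m' * v + 2 ^ m') * ρ := Nat.mul_le_mul_right _ v4
      have e1 : (v' + 1) * ρ = v' * ρ + ρ := by ring
      have e2 : (2 ^ m' * v + 2 ^ m') * ρ = s + 2 ^ m' * ρ := by rw [hsd]; ring
      omega
    have s3 : (t - s) * Q₀ ≤ t := by
      calc (t - s) * Q₀ ≤ 2 ^ m' * ρ * Q₀ := Nat.mul_le_mul_right _ s2
        _ = 2 ^ m' * Q₀ * ρ := by ring
        _ ≤ v' * ρ := Nat.mul_le_mul_right _ p3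
        _ ≤ t := t1
    have s0 : 0 < s := by rw [hsd]; have : 0 < v := by omega
                          positivity
    have hs0 : (0 : ℝ) < s := by exact_mod_cast s0
    have a1 := hs s hsS
    have a2 : |F s - F 0 - s * u| ≤ η * s := by
      unfold slp at a1
      rw [zero_add] at a1
      have e : F s - F 0 - s * u = ((F s - F 0) / s - u) * s := by field_simp
      rw [e, abs_mul, abs_of_pos hs0]
      exact mul_le_mul_of_nonneg_right a1 hs0.le
    have a3 := lip (t - s) s
    have e3 : ((s : ℤ) + ((t - s : ℕ) : ℤ)) = t := by omega
    rw [e3] at a3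
    have s3' : (((t - s : ℕ) : ℝ)) ≤ t / Q₀ := by
      rw [le_div_iff₀ hQ']; exact_mod_cast s3
    have ets : ((t - s : ℕ) : ℝ) = t - s := by push_cast [s1]; ring
    have s1' : (s : ℝ) ≤ t := by exact_mod_cast s1
    have a4 : 2 * a0 * ((t - s : ℕ) : ℝ) ≤ 2 * a0 / Q₀ * t := by
      calc _ ≤ 2 * a0 * (t / Q₀) := mul_le_mul_of_nonneg_left s3' (by positivity)
        _ = _ := by ring
    have a5 : η * s ≤ η * t := mul_le_mul_of_nonneg_left s1' hη0
    have a6 : (η + 2 * a0 / Q₀) * t ≤ 1 / q * t := mul_le_mul_of_nonneg_right hη (by positivity)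
    have a7 : (1 : ℝ) / q * t = t / q := by ring
    rw [ets] at a3
    have : |F t - F 0 - t * u| ≤ η * s + 2 * a0 * ((t - s : ℕ) : ℝ) := by
      rw [ets]
      rw [abs_le] at *
      constructor <;> linarith
    linarith

/-- two-sided version -/
lemma good2 (F : ℤ → ℝ) (a0 u η : ℝ) (q Q₀ ρ m L T : ℕ) (h0 : 0 ≤ a0)
    (hF : ∀ x, |F (x + 1) - F x| ≤ a0) (hu : |u| ≤ a0) (hρ : 0 < ρ) (hQ : 0 < Q₀) 
    (hL : L < 2 ^ (m + 1) * Q₀ * ρ) (hη0 : 0 ≤ η) (hη : η + 2 * a0 / Q₀ ≤ 1 / q) (g : ℝ) (hg : 2 * a0 * Q₀ * ρ ≤ g)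
    (hs : ∀ s ∈ SS m Q₀ ρ T, ∀ σ, |slp F s (off σ s) - u| ≤ η) (t : ℤ) (ht : |t| ≤ L) :
    |F t - F 0 - t * u| ≤ |(t : ℝ)| / q + g := by
  obtain ⟨k, rfl | rfl⟩ := t.eq_nat_or_neg
  · have := good1 F a0 u η q Q₀ ρ m L T h0 hF hu hρ hQ hL hη0 hη g hg
      (fun s h => by simpa [off] using hs s h true) k (by simpa using ht)
    simpa using this
  · have := good1 (fun x => F (-x)) a0 (-u) η q Q₀ ρ m L T h0 (fun x => by
        have := hF (-(x + 1))
        rw [abs_sub_comm]; convert this using 3; congr 1; ring) (by rwa [abs_neg]) hρ hQ hL hη0 hη g hg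
      (fun s h => by
        have := hs s h false
        simp only [off, slp, Bool.false_eq_true, if_false, neg_add_cancel, zero_add, neg_zero] at this ⊢
        rw [← abs_neg]; convert this using 2; ring) k (by simpa using ht)
    simp only [Int.cast_neg, Int.cast_natCast, abs_neg, neg_zero] at this ⊢
    rw [abs_of_nonneg (by positivity : (0 : ℝ) ≤ k)]
    convert this using 2; ring

section box
variable {d : ℕ} {Γ V : Type*} [AddCommGroup V] [Fintype V] [DecidableEq V]

/-- total deviation -/
noncomputable def dev (𝒮 : Finset ℕ) (F : Fin d → Fin d → ℤ → ℝ) (u : Fin d → Fin d → ℝ) : ℝ :=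
  ∑ i, ∑ j, ∑ s ∈ 𝒮, ∑ σ : Bool, (slp (F i j) s (off σ s) - u i j) ^ 2

lemma l2_box (F : (Fin d → V) → Fin d → Fin d → ℤ → ℝ) (us : (Fin d → V) → Fin d → Fin d → ℝ)
    (a0 : ℝ) (h0 : 0 ≤ a0) (hF : ∀ y i j x, |F y i j (x + 1) - F y i j x| ≤ a0)
    (L T : ℕ) (hLT : L ≤ T) (hT : 0 < T)
    (c2 : ∀ y y' i j, y i = y' i → F y i j T = F y' i j T)
    (c2L : ∀ y y' i j, y i = y' i → F y i j L = F y' i j L)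
    (c3 : ∀ y y' i j, (∀ l, l ≠ i → y l = y' l) → F y i j (-(T : ℤ)) = F y' i j (-(T : ℤ)))
    (c3L : ∀ y y' i j, (∀ l, l ≠ i → y l = y' l) → F y i j (-(L : ℤ)) = F y' i j (-(L : ℤ)))
    (𝒮 : Finset ℕ) (hT𝒮 : T ∈ 𝒮) :
    ∑ y, ∑ y', ∑ i, ∑ j, (us y i j - us y' i j) ^ 2 ≤
      12 * Fintype.card (Fin d → V) * ∑ y, dev 𝒮 (F y) (us y) +
      12 * d ^ 2 * (2 * a0 * L / T) ^ 2 * (Fintype.card (Fin d → V)) ^ 2 := by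
  have hT' : (0 : ℝ) < T := by exact_mod_cast hT
  set N : ℝ := ((Fintype.card (Fin d → V) : ℕ) : ℝ) with hN
  set η0 : ℝ := 2 * a0 * L / T with hη0
  set Dp : (Fin d → V) → Fin d → Fin d → ℝ := fun y i j => (slp (F y i j) T 0 - us y i j) ^ 2 with hDp
  set Dm : (Fin d → V) → Fin d → Fin d → ℝ := fun y i j => (slp (F y i j) T (-(T : ℤ)) - us y i j) ^ 2 with hDm
  have hdev : ∀ y, ∑ i, ∑ j, (Dp y i j + Dm y i j) ≤ dev 𝒮 (F y) (us y) := by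
    intro y
    unfold dev
    refine sum_le_sum fun i _ => sum_le_sum fun j _ => ?_
    have := single_le_sum (f := fun s => ∑ σ : Bool, (slp (F y i j) s (off σ s) - us y i j) ^ 2)
      (fun s _ => sum_nonneg fun σ _ => sq_nonneg _) hT𝒮
    refine le_trans (le_of_eq ?_) this
    simp [hDp, hDm, off]
  have p1 : ∀ y z i j, y i = z i → |slp (F y i j) T 0 - slp (F z i j) T 0| ≤ η0 := by
    intro y z i j h
    unfold slp
    rw [zero_add, c2 y z i j h, ← sub_div, abs_div, abs_of_pos hT', hη0]
    apply div_le_div_of_nonneg_right _ hT'.le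
    have g1 := lip_int (F y i j) a0 (hF y i j) 0 L
    have g2 := lip_int (F z i j) a0 (hF z i j) 0 L
    rw [zero_add] at g1 g2
    rw [c2L y z i j h] at g1
    rw [abs_le] at *; constructor <;> linarith
  have p2 : ∀ y z i j, (∀ l, l ≠ i → y l = z l) →
      |slp (F y i j) T (-(T : ℤ)) - slp (F z i j) T (-(T : ℤ))| ≤ η0 := by
    intro y z i j h
    unfold slp
    rw [neg_add_cancel, c3 y z i j h, ← sub_div, abs_div, abs_of_pos hT', hη0]
    apply div_le_div_of_nonneg_right _ hT'.le
    have g1 := lip_int (F y i j) a0 (hF y i j) (-L) L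
    have g2 := lip_int (F z i j) a0 (hF z i j) (-L) L
    rw [neg_add_cancel] at g1 g2
    rw [c3L y z i j h] at g1
    rw [abs_le] at *; constructor <;> linarith
  have key : ∀ y y' i j, (us y i j - us y' i j) ^ 2 ≤
      6 * (Dp y i j + Dp (Function.update y' i (y i)) i j + Dm (Function.update y' i (y i)) i j + Dm y' i j)
        + 12 * η0 ^ 2 := by
    intro y y' i j
    set z := Function.update y' i (y i) with hz
    have g1 := p1 y z i j (by simp [hz])
    have g2 := p2 z y' i j (by intro l hl; simp [hz, hl])
    have g1' : (slp (F y i j) T 0 - slp (F z i j) T 0) ^ 2 ≤ η0 ^ 2 := by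
      rw [← sq_abs]; exact pow_le_pow_left₀ (abs_nonneg _) g1 2
    have g2' : (slp (F z i j) T (-(T : ℤ)) - slp (F y' i j) T (-(T : ℤ))) ^ 2 ≤ η0 ^ 2 := by
      rw [← sq_abs]; exact pow_le_pow_left₀ (abs_nonneg _) g2 2
    simp only [hDp, hDm]
    have six : ∀ a b c e f g : ℝ, (a + b + c + e + f + g) ^ 2 ≤
        6 * (a ^ 2 + b ^ 2 + c ^ 2 + e ^ 2 + f ^ 2 + g ^ 2) := by
      intro a b c e f g
      nlinarith [sq_nonneg (a - b), sq_nonneg (a - c), sq_nonneg (a - e), sq_nonneg (a - f), sq_nonneg (a - g),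
        sq_nonneg (b - c), sq_nonneg (b - e), sq_nonneg (b - f), sq_nonneg (b - g), sq_nonneg (c - e),
        sq_nonneg (c - f), sq_nonneg (c - g), sq_nonneg (e - f), sq_nonneg (e - g), sq_nonneg (f - g)]
    have := six (us y i j - slp (F y i j) T 0) (slp (F y i j) T 0 - slp (F z i j) T 0)
      (slp (F z i j) T 0 - us z i j) (us z i j - slp (F z i j) T (-(T : ℤ)))
      (slp (F z i j) T (-(T : ℤ)) - slp (F y' i j) T (-(T : ℤ))) (slp (F y' i j) T (-(T : ℤ)) - us y' i j)
    have e : us y i j - us y' i j = (us y i j - slp (F y i j) T 0) + (slp (F y i j) T 0 - slp (F z i j) T 0) +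
      (slp (F z i j) T 0 - us z i j) + (us z i j - slp (F z i j) T (-(T : ℤ))) +
      (slp (F z i j) T (-(T : ℤ)) - slp (F y' i j) T (-(T : ℤ))) + (slp (F y' i j) T (-(T : ℤ)) - us y' i j) := by ring
    rw [e]
    refine this.trans ?_
    rw [sub_sq_comm (us y i j), sub_sq_comm (us z i j)]
    linarith
  have k1 : ∑ y, ∑ y', ∑ i, ∑ j, (us y i j - us y' i j) ^ 2 =
      ∑ i, ∑ j, ∑ y, ∑ y', (us y i j - us y' i j) ^ 2 := by
    calc _ = ∑ y, ∑ i, ∑ j, ∑ y', (us y i j - us y' i j) ^ 2 := by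
          refine sum_congr rfl fun y _ => ?_
          rw [sum_comm]; refine sum_congr rfl fun i _ => ?_
          rw [sum_comm]
      _ = _ := by
          rw [sum_comm]; refine sum_congr rfl fun i _ => ?_
          rw [sum_comm]
  have k2 : ∀ i j, ∑ y, ∑ y', (us y i j - us y' i j) ^ 2 ≤
      12 * N * ∑ y, (Dp y i j + Dm y i j) + 12 * η0 ^ 2 * N ^ 2 := by
    intro i j
    refine (sum_le_sum fun y _ => sum_le_sum fun y' _ => key y y' i j).trans (le_of_eq ?_)
    have s1 := sum_swap_box (V := V) (fun z : Fin d → V => Dp z i j + Dm z i j) i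
    have e : ∀ y y' : Fin d → V, 6 * (Dp y i j + Dp (Function.update y' i (y i)) i j + Dm (Function.update y' i (y i)) i j + Dm y' i j)
        + 12 * η0 ^ 2 = 6 * Dp y i j + 6 * (Dp (Function.update y' i (y i)) i j + Dm (Function.update y' i (y i)) i j)
          + 6 * Dm y' i j + 12 * η0 ^ 2 := by intros; ring
    simp only [e, sum_add_distrib, ← mul_sum, sum_const, card_univ, nsmul_eq_mul]
    simp only [sum_add_distrib] at s1
    rw [← mul_add, s1, ← hN]
    ring
  rw [k1]
  refine (sum_le_sum fun i _ => sum_le_sum fun j _ => k2 i j).trans ?_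
  have k3 := sum_le_sum (s := univ) fun y _ => hdev y
  have k4 : ∑ i, ∑ j, ∑ y, (Dp y i j + Dm y i j) = ∑ y, ∑ i, ∑ j, (Dp y i j + Dm y i j) := by
    rw [sum_comm]
    calc _ = ∑ j, ∑ y, ∑ i, (Dp y i j + Dm y i j) := by
          refine sum_congr rfl fun i _ => ?_
          rw [sum_comm]
      _ = ∑ y, ∑ j, ∑ i, (Dp y i j + Dm y i j) := sum_comm
      _ = _ := by refine sum_congr rfl fun i _ => ?_
                  rw [sum_comm]
  simp only [sum_add_distrib (f := fun i => 12 * N * _), ← mul_sum, sum_const, card_univ, nsmul_eq_mul, Fintype.card_fin]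
  rw [k4]
  have hN0 : 0 ≤ N := by positivity
  have := mul_le_mul_of_nonneg_left k3 (by positivity : 0 ≤ 12 * N)
  nlinarith

open Classical in
theorem box_step (ζ : Γ → Fin d → ℤ) (Φ : (Fin d → V) → Fin d → ℤ → Γ) (Φ0 : (Fin d → V) → Γ)
    (us : (Fin d → V) → Fin d → Fin d → ℝ) [Nonempty V]
    (a0 : ℝ) (h0 : 0 ≤ a0) (hF : ∀ y i j x, |(ζ (Φ y i (x + 1)) j : ℝ) - ζ (Φ y i x) j| ≤ a0)
    (hus : ∀ y i j, |us y i j| ≤ a0)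
    (hΦ0 : ∀ y i, Φ y i 0 = Φ0 y)
    (L T : ℕ) (hLT : L ≤ T) (hT : 0 < T)
    (c2 : ∀ y y' i, ∀ t : ℤ, L ≤ t → y i = y' i → Φ y i t = Φ y' i t)
    (c3 : ∀ y y' i, ∀ t : ℤ, t ≤ -L → (∀ l, l ≠ i → y l = y' l) → Φ y i t = Φ y' i t)
    (q Q₀ ρ m g : ℕ) (hρ : 0 < ρ) (hQ : 0 < Q₀) (hL : L < 2 ^ (m + 1) * Q₀ * ρ) (η : ℝ) (hη0 : 0 ≤ η)
    (hη : η + 2 * a0 / Q₀ ≤ 1 / q) (hg : 2 * a0 * Q₀ * ρ ≤ g) :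
    ∃ u : Fin d → Fin d → ℝ,
      ((univ.filter fun y => ¬ GoodAt ζ L q g Φ Φ0 u y).card : ℝ) * η ^ 2 ≤
        (SS m Q₀ ρ T).card * (50 * ∑ y, dev (SS m Q₀ ρ T) (fun i j x => (ζ (Φ y i x) j : ℝ)) (us y) +
          48 * d ^ 2 * (2 * a0 * L / T) ^ 2 * Fintype.card (Fin d → V)) := by
  set 𝒮 := SS m Q₀ ρ T with h𝒮
  set F : (Fin d → V) → Fin d → Fin d → ℤ → ℝ := fun y i j x => (ζ (Φ y i x) j : ℝ) with hFd
  have hT𝒮 : T ∈ 𝒮 := mem_insert_self _ _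
  set N : ℝ := ((Fintype.card (Fin d → V) : ℕ) : ℝ) with hN
  have hN0 : 0 < N := by rw [hN]; exact_mod_cast Fintype.card_pos
  have hLT' : (L : ℤ) ≤ T := by exact_mod_cast hLT
  have l2 := l2_box F us a0 h0 hF L T hLT hT
    (fun y y' i j h => by simp only [hFd]; rw [c2 y y' i T hLT' h])
    (fun y y' i j h => by simp only [hFd]; rw [c2 y y' i L le_rfl h])
    (fun y y' i j h => by simp only [hFd]; rw [c3 y y' i (-T) (by omega) h])
    (fun y y' i j h => by simp only [hFd]; rw [c3 y y' i (-L) le_rfl h]) 𝒮 hT𝒮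
  set vv : ℝ := ∑ y, dev 𝒮 (F y) (us y) with hvv
  set η0 : ℝ := 2 * a0 * L / T with hη0d
  have hv0 : 0 ≤ vv := sum_nonneg fun y _ => sum_nonneg fun i _ => sum_nonneg fun j _ =>
    sum_nonneg fun s _ => sum_nonneg fun σ _ => sq_nonneg _
  rw [sum_comm] at l2
  obtain ⟨y', hy'⟩ : ∃ y', ∑ y, ∑ i, ∑ j, (us y i j - us y' i j) ^ 2 ≤ 12 * vv + 12 * d ^ 2 * η0 ^ 2 * N := by
    by_contra hno
    push Not at hno
    have := sum_lt_sum_of_nonempty (s := (univ : Finset (Fin d → V))) univ_nonempty (fun y' _ => hno y')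
    rw [sum_const, card_univ, nsmul_eq_mul, ← hN] at this
    nlinarith
  refine ⟨us y', ?_⟩
  have c1 : (1 : ℝ) ≤ 𝒮.card := by exact_mod_cast card_pos.2 ⟨T, hT𝒮⟩
  have hbad : ∀ y, ¬ GoodAt ζ L q g Φ Φ0 (us y') y → η ^ 2 ≤
      2 * dev 𝒮 (F y) (us y) + 4 * 𝒮.card * ∑ i, ∑ j, (us y i j - us y' i j) ^ 2 := by
    intro y hy
    have h1 : ∃ i j, ∃ s ∈ 𝒮, ∃ σ, η < |slp (F y i j) s (off σ s) - us y' i j| := by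
      by_contra hno
      push Not at hno
      apply hy
      intro i j t ht
      have := good2 (F y i j) a0 (us y' i j) η q Q₀ ρ m L T h0 (hF y i j) (hus y' i j) hρ hQ hL hη0 hη g hg
        (hno i j) t ht
      simp only [hFd] at this
      rwa [hΦ0] at this
    obtain ⟨i, j, s, hs, σ, h2⟩ := h1
    have h3 : η ^ 2 ≤ (slp (F y i j) s (off σ s) - us y' i j) ^ 2 := by
      rw [← sq_abs (slp _ _ _ - _)]; exact pow_le_pow_left₀ hη0 h2.le 2
    have h4 : (slp (F y i j) s (off σ s) - us y' i j) ^ 2 ≤ dev 𝒮 (F y) (us y') := by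
      unfold dev
      refine le_trans ?_ (single_le_sum (f := fun i => ∑ j, ∑ s ∈ 𝒮, ∑ σ : Bool, (slp (F y i j) s (off σ s) - us y' i j) ^ 2) (fun i _ => sum_nonneg fun j _ =>
        sum_nonneg fun s _ => sum_nonneg fun σ _ => sq_nonneg _) (mem_univ i))
      refine le_trans ?_ (single_le_sum (f := fun j => ∑ s ∈ 𝒮, ∑ σ : Bool, (slp (F y i j) s (off σ s) - us y' i j) ^ 2) (fun j _ =>
        sum_nonneg fun s _ => sum_nonneg fun σ _ => sq_nonneg _) (mem_univ j))
      refine le_trans ?_ (single_le_sum (f := fun s => ∑ σ : Bool, (slp (F y i j) s (off σ s) - us y' i j) ^ 2)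
        (fun s _ => sum_nonneg fun σ _ => sq_nonneg _) hs)
      exact single_le_sum (f := fun σ => (slp (F y i j) s (off σ s) - us y' i j) ^ 2)
        (fun σ _ => sq_nonneg _) (mem_univ σ)
    have h5 : dev 𝒮 (F y) (us y') ≤
        2 * dev 𝒮 (F y) (us y) + 4 * 𝒮.card * ∑ i, ∑ j, (us y i j - us y' i j) ^ 2 := by
      have : dev 𝒮 (F y) (us y') ≤ ∑ i, ∑ j, ∑ s ∈ 𝒮, ∑ σ : Bool,
          (2 * (slp (F y i j) s (off σ s) - us y i j) ^ 2 + 2 * (us y i j - us y' i j) ^ 2) := by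
        unfold dev
        refine sum_le_sum fun i _ => sum_le_sum fun j _ => sum_le_sum fun s _ => sum_le_sum fun σ _ => ?_
        nlinarith [sq_nonneg ((slp (F y i j) s (off σ s) - us y i j) - (us y i j - us y' i j))]
      refine this.trans (le_of_eq ?_)
      simp only [sum_add_distrib, ← mul_sum, sum_const, card_univ, nsmul_eq_mul, Fintype.card_bool, dev]
      push_cast
      ring
    linarith
  have hsum : ((univ.filter fun y => ¬ GoodAt ζ L q g Φ Φ0 (us y') y).card : ℝ) * η ^ 2 ≤
      ∑ y, (2 * dev 𝒮 (F y) (us y) + 4 * 𝒮.card * ∑ i, ∑ j, (us y i j - us y' i j) ^ 2) := by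
    rw [← nsmul_eq_mul, ← sum_const]
    refine (sum_le_sum fun y hy => hbad y (mem_filter.1 hy).2).trans ?_
    refine sum_le_sum_of_subset_of_nonneg (filter_subset _ _) fun y _ _ => ?_
    have : 0 ≤ dev 𝒮 (F y) (us y) := sum_nonneg fun i _ => sum_nonneg fun j _ =>
      sum_nonneg fun s _ => sum_nonneg fun σ _ => sq_nonneg _
    have : 0 ≤ ∑ i, ∑ j, (us y i j - us y' i j) ^ 2 := sum_nonneg fun i _ => sum_nonneg fun j _ => sq_nonneg _
    positivity
  rw [sum_add_distrib, ← mul_sum, ← mul_sum, ← hvv] at hsum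
  refine hsum.trans ?_
  have := mul_le_mul_of_nonneg_left hy' (by positivity : (0 : ℝ) ≤ 4 * 𝒮.card)
  nlinarith

end box
end NR


namespace NR
open Finset
set_option linter.unusedSectionVars false
set_option linter.unusedVariables false

def Zc {d : ℕ} (κ : Fin d → ℤ) (l : Fin d) : ℤ := (∑ k, κ k) - d * κ l

lemma Zc_sum {d : ℕ} (κ : Fin d → ℤ) : ∑ l, Zc κ l = 0 := by
  unfold Zc
  rw [sum_sub_distrib, ← mul_sum]; simp

lemma Zc_add {d : ℕ} (κ : Fin d → ℤ) (i l : Fin d) (t : ℤ) :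
    Zc (κ + Pi.single i t) l = Zc κ l + t - (if l = i then d * t else 0) := by
  unfold Zc
  simp only [Pi.add_apply, sum_add_distrib, Finset.sum_pi_single', mem_univ, if_true]
  split_ifs with h
  · subst h; simp; ring
  · simp [h]; ring

section dig
variable {W₀ : ℕ} (b B₀ : ℕ)

/-- integer with the visible digits -/
def dig (x : Fin W₀ → ZMod 2) (z : ℤ) : ℕ :=
  ∑ w : Fin W₀, if z ≤ (w : ℤ) - B₀ then (x w).val * b ^ ((w : ℤ) - B₀ - z).toNat else 0

def bitAt (x : Fin W₀ → ZMod 2) (z : ℤ) : ℕ :=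
  ∑ w : Fin W₀, if z = (w : ℤ) - B₀ then (x w).val else 0

lemma bitAt_le (x : Fin W₀ → ZMod 2) (z : ℤ) : bitAt B₀ x z ≤ 1 := by
  unfold bitAt
  by_cases h : ∃ w : Fin W₀, z = (w : ℤ) - B₀
  · obtain ⟨w, hw⟩ := h
    rw [sum_eq_single w]
    · rw [if_pos hw]; have := ZMod.val_lt (x w); omega
    · intro w' _ hne
      rw [if_neg]
      intro h'
      apply hne
      ext; omega
    · simp
  · rw [sum_eq_zero]
    · norm_num
    · intro w _; rw [if_neg]; exact fun h' => h ⟨w, h'⟩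

lemma bitAt_eq (x : Fin W₀ → ZMod 2) (w : Fin W₀) : bitAt B₀ x ((w : ℤ) - B₀) = (x w).val := by
  unfold bitAt
  rw [sum_eq_single w]
  · simp
  · intro w' _ hne
    rw [if_neg]
    intro h'
    apply hne
    ext; omega
  · simp

lemma dig_succ (x : Fin W₀ → ZMod 2) (z : ℤ) :
    dig b B₀ x z = bitAt B₀ x z + b * dig b B₀ x (z + 1) := by
  unfold dig bitAt
  rw [mul_sum, ← sum_add_distrib]
  refine sum_congr rfl fun w _ => ?_
  rcases lt_trichotomy z ((w : ℤ) - B₀) with h | h | h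
  · rw [if_pos h.le, if_neg h.ne, if_pos (by omega : z + 1 ≤ (w : ℤ) - B₀)]
    have : ((w : ℤ) - B₀ - z).toNat = ((w : ℤ) - B₀ - (z + 1)).toNat + 1 := by omega
    rw [this, pow_succ]; ring
  · rw [if_pos h.le, if_pos h, if_neg (by omega : ¬ z + 1 ≤ (w : ℤ) - B₀)]
    have : ((w : ℤ) - B₀ - z).toNat = 0 := by omega
    rw [this]; simp
  · rw [if_neg (by omega), if_neg (by omega), if_neg (by omega)]; simp

lemma dig_congr (x x' : Fin W₀ → ZMod 2) (z : ℤ) (h : ∀ w : Fin W₀, z ≤ (w : ℤ) - B₀ → x w = x' w) :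
    dig b B₀ x z = dig b B₀ x' z := by
  unfold dig
  refine sum_congr rfl fun w _ => ?_
  split_ifs with hw
  · rw [h w hw]
  · rfl

lemma dig_inj (hb : 2 ≤ b) (x x' : Fin W₀ → ZMod 2) (k : ℕ) : ∀ (z : ℤ), dig b B₀ x z = dig b B₀ x' z →
    ∀ w : Fin W₀, (w : ℤ) - B₀ = z + k → x w = x' w := by
  induction k with
  | zero =>
    intro z h w hw
    rw [dig_succ, dig_succ b B₀ x'] at h
    have h1 := bitAt_le B₀ x z
    have h2 := bitAt_le B₀ x' z
    have h3 : bitAt B₀ x z = bitAt B₀ x' z := by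
      have := congrArg (· % b) h
      simp only [Nat.add_mul_mod_self_left] at this
      rwa [Nat.mod_eq_of_lt (by omega), Nat.mod_eq_of_lt (by omega)] at this
    have hz : z = (w : ℤ) - B₀ := by simp at hw; omega
    rw [hz, bitAt_eq, bitAt_eq] at h3
    exact ZMod.val_injective 2 h3
  | succ k ih =>
    intro z h w hw
    rw [dig_succ, dig_succ b B₀ x'] at h
    have h1 := bitAt_le B₀ x z
    have h2 := bitAt_le B₀ x' z
    have h3 : bitAt B₀ x z = bitAt B₀ x' z := by
      have := congrArg (· % b) h
      simp only [Nat.add_mul_mod_self_left] at this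
      rwa [Nat.mod_eq_of_lt (by omega), Nat.mod_eq_of_lt (by omega)] at this
    rw [h3] at h
    have h4 : dig b B₀ x (z + 1) = dig b B₀ x' (z + 1) :=
      Nat.eq_of_mul_eq_mul_left (by omega) (Nat.add_left_cancel h)
    exact ih (z + 1) h4 w (by push_cast at hw; omega)

lemma dig_flip (x x' : Fin W₀ → ZMod 2) (z : ℤ) (c : ℕ) (w : Fin W₀) (hw : (w : ℤ) - B₀ = z + c)
    (hne : x w ≠ x' w) (heq : ∀ w', w' ≠ w → x w' = x' w') :
    (b : ℤ) ^ c ≤ |(dig b B₀ x z : ℤ) - dig b B₀ x' z| := by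
  have e : (dig b B₀ x z : ℤ) - dig b B₀ x' z = (((x w).val : ℤ) - (x' w).val) * (b : ℤ) ^ c := by
    unfold dig
    push_cast
    rw [← sum_sub_distrib, sum_eq_single w]
    · rw [if_pos (by omega), if_pos (by omega)]
      have : ((w : ℤ) - B₀ - z).toNat = c := by omega
      rw [this]; ring
    · intro w' _ h
      rw [heq w' h]; simp
    · simp
  rw [e, abs_mul, abs_of_nonneg (by positivity : (0 : ℤ) ≤ (b : ℤ) ^ c)]
  have : 1 ≤ |((x w).val : ℤ) - (x' w).val| := by
    apply Int.one_le_abs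
    intro h
    exact hne (ZMod.val_injective 2 (by omega))
  have h0 : (0 : ℤ) ≤ (b : ℤ) ^ c := by positivity
  nlinarith

noncomputable def trc (x : Fin W₀ → ZMod 2) (z : ℤ) : ℝ := dig b B₀ x z * (b : ℝ) ^ z

lemma trc_step (hb : 2 ≤ b) (x : Fin W₀ → ZMod 2) (z : ℤ) :
    trc b B₀ x (z + 1) ≤ trc b B₀ x z ∧ trc b B₀ x z ≤ trc b B₀ x (z + 1) + (b : ℝ) ^ z := by
  have h2 : (0 : ℝ) < b := by exact_mod_cast (by omega : 0 < b)
  have e : trc b B₀ x z = bitAt B₀ x z * (b : ℝ) ^ z + trc b B₀ x (z + 1) := by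
    unfold trc
    rw [dig_succ, zpow_add_one₀ h2.ne']; push_cast; ring
  have h1 : (bitAt B₀ x z : ℝ) ≤ 1 := by exact_mod_cast bitAt_le B₀ x z
  have h3 := zpow_pos' hb z
  have h4 : (0 : ℝ) ≤ bitAt B₀ x z := by positivity
  constructor <;> nlinarith

lemma trc_close (hb : 2 ≤ b) (x : Fin W₀ → ZMod 2) (k : ℕ) (z : ℤ) :
    trc b B₀ x (z + k) ≤ trc b B₀ x z ∧ trc b B₀ x z ≤ trc b B₀ x (z + k) + (b : ℝ) ^ (z + k) := by
  induction k with
  | zero => have := zpow_pos' hb z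
            constructor <;> simp <;> linarith
  | succ k ih =>
    have h1 := trc_step b B₀ hb x (z + k)
    have h2 := two_zpow hb (z + k)
    push_cast
    rw [← add_assoc]
    constructor <;> linarith [h1.1, h1.2, ih.1, ih.2]

lemma trc_close' (hb : 2 ≤ b) (x : Fin W₀ → ZMod 2) (z z' : ℤ) (k : ℕ) (h : |z - z'| ≤ k) :
    |trc b B₀ x z - trc b B₀ x z'| ≤ (b : ℝ) ^ (z + k) := by
  rw [abs_le] at h
  rcases le_total z z' with hz | hz
  · obtain ⟨m, rfl⟩ := Int.le.dest hz
    have := trc_close b B₀ hb x m z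
    have h2 := zpow_mono hb (by omega : z + m ≤ z + k)
    rw [abs_le]; constructor <;> linarith [this.1, this.2]
  · obtain ⟨m, rfl⟩ := Int.le.dest hz
    have := trc_close b B₀ hb x m z'
    have h2 := zpow_mono hb (by omega : z' + m ≤ z' + m + k)
    rw [abs_le]; constructor <;> linarith [this.1, this.2]

end dig

section dom
variable {d : ℕ} {Γ : Type*} [Group Γ] {b : ℕ} {ζ : Γ → Fin d → ℤ}
  {ξ : Γ → Fin d → ℝ} {dd : Γ → Γ → ℕ} {A : ℕ} {W₀ : ℕ} (B₀ : ℕ)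
  (pt : (Fin d → ℤ) → (Fin d → ℤ) → Γ)

/-- `pt` picks a point in each tile -/
def IsPt (b : ℕ) (ζ : Γ → Fin d → ℤ) (ξ : Γ → Fin d → ℝ) (pt : (Fin d → ℤ) → (Fin d → ℤ) → Γ) : Prop :=
  ∀ t i, ∑ j, t j = 0 → ζ (pt t i) = t ∧ ∀ j, ⌊ξ (pt t i) j / (b : ℝ) ^ (t j)⌋ = i j

variable (b) in
def lam (X : Fin d → Fin W₀ → ZMod 2) (κ : Fin d → ℤ) : Γ :=
  pt (Zc κ) (fun l => (dig b B₀ (X l) (Zc κ l) : ℤ))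

variable {pt}

lemma lam_ζ (hpt : IsPt b ζ ξ pt) (X : Fin d → Fin W₀ → ZMod 2) (κ : Fin d → ℤ) :
    ζ (lam b B₀ pt X κ) = Zc κ := (hpt _ _ (Zc_sum κ)).1

lemma lam_fl (hpt : IsPt b ζ ξ pt) (X : Fin d → Fin W₀ → ZMod 2) (κ : Fin d → ℤ) (j : Fin d) :
    ⌊ξ (lam b B₀ pt X κ) j / (b : ℝ) ^ (Zc κ j)⌋ = dig b B₀ (X j) (Zc κ j) :=
  (hpt _ _ (Zc_sum κ)).2 j

lemma lam_ξ (hb : 2 ≤ b) (hpt : IsPt b ζ ξ pt) (X : Fin d → Fin W₀ → ZMod 2) (κ : Fin d → ℤ) (j : Fin d) :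
    trc b B₀ (X j) (Zc κ j) ≤ ξ (lam b B₀ pt X κ) j ∧
    ξ (lam b B₀ pt X κ) j ≤ trc b B₀ (X j) (Zc κ j) + (b : ℝ) ^ (Zc κ j) := by
  have h := lam_fl B₀ hpt X κ j
  have hp := zpow_pos' hb (Zc κ j)
  rw [Int.floor_eq_iff] at h
  obtain ⟨h1, h2⟩ := h
  rw [le_div_iff₀ hp] at h1
  rw [div_lt_iff₀ hp] at h2
  unfold trc
  push_cast at h1 h2
  constructor <;> nlinarith

lemma lam_close (G : GM b ζ ξ dd A) (hb : 2 ≤ b) (hd : 1 ≤ d) (hpt : IsPt b ζ ξ pt) (X : Fin d → Fin W₀ → ZMod 2)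
    (κ : Fin d → ℤ) (i : Fin d) :
    dd (lam b B₀ pt X κ) (lam b B₀ pt X (κ + Pi.single i 1)) ≤ A * (d + 3) := by
  have hz : ∀ j, |Zc κ j - Zc (κ + Pi.single i 1) j| ≤ d := by
    intro j
    rw [Zc_add, abs_le]
    split_ifs <;> constructor <;> push_cast <;> omega
  have := G.m2 (lam b B₀ pt X κ) (lam b B₀ pt X (κ + Pi.single i 1)) (d + 2)
    (fun j => by rw [lam_ζ B₀ hpt, lam_ζ B₀ hpt]; exact (hz j).trans (by push_cast; omega)) (fun j => by
      rw [lam_ζ B₀ hpt]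
      have h1 := lam_ξ B₀ hb hpt X κ j
      have h2 := lam_ξ B₀ hb hpt X (κ + Pi.single i 1) j
      have h3 := trc_close' b B₀ hb (X j) _ _ d (hz j)
      have h4 := zpow_mono hb (by omega : Zc κ j ≤ Zc κ j + d)
      have h5 := zpow_mono hb (by have := (abs_le.1 (hz j)).1; omega : Zc (κ + Pi.single i 1) j ≤ Zc κ j + d)
      have h6 := two_zpow hb (Zc κ j + d)
      have h7 := two_zpow hb (Zc κ j + d + 1)
      have e : Zc κ j + ((d + 2 : ℕ) : ℤ) = Zc κ j + d + 1 + 1 := by push_cast; ring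
      rw [e]
      have h8 := zpow_pos' hb (Zc κ j + d)
      rw [abs_le] at *
      constructor <;> linarith [h1.1, h1.2, h2.1, h2.2, h3.1, h3.2])
  exact this

lemma lam_congr (X X' : Fin d → Fin W₀ → ZMod 2) (κ : Fin d → ℤ)
    (h : ∀ l (w : Fin W₀), Zc κ l ≤ (w : ℤ) - B₀ → X l w = X' l w) :
    lam b B₀ pt X κ = lam b B₀ pt X' κ := by
  unfold lam
  congr 1
  funext l
  rw [dig_congr b B₀ (X l) (X' l) (Zc κ l) (h l)]

/-- window embedding -/
def iota {L : ℕ} (κ : Fin d → ℤ) (y : Fin d → Fin L → ZMod 2) : Fin d → Fin W₀ → ZMod 2 :=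
  fun l w => if h : Zc κ l ≤ (w : ℤ) - B₀ ∧ ((w : ℤ) - B₀ - Zc κ l).toNat < L then
    y l ⟨((w : ℤ) - B₀ - Zc κ l).toNat, h.2⟩ else 0

lemma iota_add {L : ℕ} (κ : Fin d → ℤ) (y y' : Fin d → Fin L → ZMod 2) :
    (iota B₀ κ (y + y') : Fin d → Fin W₀ → ZMod 2) = iota B₀ κ y + iota B₀ κ y' := by
  funext l w
  simp only [iota, Pi.add_apply]
  split_ifs <;> simp

/-- flip direction -/
def efl {L : ℕ} (c1 : ℕ) (hc : c1 < L) (i : Fin d) : Fin d → Fin L → ZMod 2 :=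
  Pi.single i (Pi.single ⟨c1, hc⟩ 1)

def PhB {L : ℕ} (b : ℕ) (pt : (Fin d → ℤ) → (Fin d → ℤ) → Γ) (ψ : Γ → Γ) (γ : Γ) (X : Fin d → Fin W₀ → ZMod 2) (κ : Fin d → ℤ)
    (y : Fin d → Fin L → ZMod 2) (i : Fin d) (t : ℤ) : Γ :=
  ψ (γ * lam b B₀ pt (X + iota B₀ κ y) (κ + Pi.single i t))

lemma PhB_c2 {L : ℕ} (ψ : Γ → Γ) (γ : Γ) (X : Fin d → Fin W₀ → ZMod 2) (κ : Fin d → ℤ)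
    (y y' : Fin d → Fin L → ZMod 2) (i : Fin d) (t : ℤ) (ht : L ≤ t) (h : y i = y' i) :
    PhB B₀ b pt ψ γ X κ y i t = PhB B₀ b pt ψ γ X κ y' i t := by
  unfold PhB
  rw [lam_congr B₀ (X + iota B₀ κ y) (X + iota B₀ κ y')]
  intro l w hw
  simp only [Pi.add_apply]
  congr 1
  by_cases hl : l = i
  · subst hl; simp only [iota, h]
  · rw [Zc_add, if_neg hl] at hw
    simp only [iota]
    rw [dif_neg (by omega), dif_neg (by omega)]

lemma PhB_c3 {L : ℕ} (hd : 2 ≤ d) (ψ : Γ → Γ) (γ : Γ) (X : Fin d → Fin W₀ → ZMod 2) (κ : Fin d → ℤ)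
    (y y' : Fin d → Fin L → ZMod 2) (i : Fin d) (t : ℤ) (ht : t ≤ 0)
    (h : ∀ l, l ≠ i → y l = y' l) (h2 : ∀ w : Fin L, -t ≤ w → y i w = y' i w):
    PhB B₀ b pt ψ γ X κ y i t = PhB B₀ b pt ψ γ X κ y' i t := by
  unfold PhB
  rw [lam_congr B₀ (X + iota B₀ κ y) (X + iota B₀ κ y')]
  intro l w hw
  simp only [Pi.add_apply]
  congr 1
  by_cases hl : l = i
  · subst hl
    rw [Zc_add, if_pos rfl] at hw
    have h3 : Zc κ l - t ≤ (w : ℤ) - B₀ := by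
      have : (2 : ℤ) ≤ d := by exact_mod_cast hd
      nlinarith
    simp only [iota]
    split_ifs with hh
    · apply h2; simp only; omega
    · rfl
  · simp only [iota, h l hl]

theorem PhB_LBx (G : GM b ζ ξ dd A) (hb : 2 ≤ b) (hd : 2 ≤ d) (hpt : IsPt b ζ ξ pt)
    (hinv : ∀ g p q, dd (g * p) (g * q) = dd p q) {L K c0 c1 : ℕ} (ψ : Γ → Γ) (hψ : Function.Injective ψ)
    (hK1 : ∀ p q, dd (ψ p) (ψ q) ≤ K * dd p q) (hK2 : ∀ p q, dd p q ≤ K * dd (ψ p) (ψ q))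
    (hc0 : K * (A * (d + 3)) ≤ c0) (hc01 : 1 ≤ c0)
    (hc : c1 < L) (γ : Γ) (X : Fin d → Fin W₀ → ZMod 2) (κ : Fin d → ℤ)
    (hκ : ∀ l, -(B₀ : ℤ) ≤ Zc κ l ∧ Zc κ l + L ≤ (W₀ : ℤ) - B₀) :
    LBx dd L c0 c1 (efl c1 hc) (PhB B₀ b pt ψ γ X κ)
      (fun y => ψ (γ * lam b B₀ pt (X + iota B₀ κ y) κ)) where
  b0 y i := by simp [PhB]
  b1 y i t := by
    unfold PhB
    refine (hK1 _ _).trans ?_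
    rw [hinv]
    have := lam_close B₀ G hb (by omega) hpt (X + iota B₀ κ y) (κ + Pi.single i t) i
    rw [add_assoc, ← Pi.single_add] at this
    exact (Nat.mul_le_mul_left K this).trans hc0
  b2 y y' i h := PhB_c2 B₀ ψ γ X κ y y' i L le_rfl h
  b3 y y' i h := PhB_c3 B₀ hd ψ γ X κ y y' i (-L) (by omega) h (fun w hw => by
    have := w.2; simp at hw; omega)
  b3' y i := PhB_c3 B₀ hd ψ γ X κ _ _ i _ (by omega) (fun l hl => by simp [efl, hl]) (fun w hw => by
    have : w ≠ ⟨c1, hc⟩ := by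
      intro h; rw [h] at hw; push_cast at hw; omega
    simp [efl, this])
  b4 := by
    intro y y' h
    have h1 := mul_left_cancel (hψ h)
    funext l w
    have h2 : dig b B₀ ((X + iota B₀ κ y : Fin d → Fin W₀ → ZMod 2) l) (Zc κ l) = dig b B₀ ((X + iota B₀ κ y' : Fin d → Fin W₀ → ZMod 2) l) (Zc κ l) := by
      have e1 := lam_fl B₀ hpt (X + iota B₀ κ y) κ l
      have e2 := lam_fl B₀ hpt (X + iota B₀ κ y') κ l
      rw [h1, e2] at e1
      exact_mod_cast e1.symm
    obtain ⟨k1, k2⟩ := hκ l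
    have hw := w.2
    obtain ⟨w', hw'⟩ : ∃ w' : Fin W₀, (w' : ℤ) - B₀ = Zc κ l + (w : ℕ) :=
      ⟨⟨(Zc κ l + w + B₀).toNat, by omega⟩, by simp only; omega⟩
    have h3 := dig_inj b B₀ hb _ _ w _ h2 w' hw'
    simp only [Pi.add_apply, iota] at h3
    have h4 := add_left_cancel h3
    have e : ((w' : ℤ) - B₀ - Zc κ l).toNat = w := by omega
    rw [dif_pos (by omega), dif_pos (by omega)] at h4
    simpa only [e] using h4
  b5 y i := by
    set p := lam b B₀ pt (X + iota B₀ κ y) κ with hp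
    set p' := lam b B₀ pt (X + iota B₀ κ (y + efl c1 hc i)) κ with hp'
    obtain ⟨k1, k2⟩ := hκ i
    obtain ⟨w', hw'⟩ : ∃ w' : Fin W₀, (w' : ℤ) - B₀ = Zc κ i + c1 :=
      ⟨⟨(Zc κ i + c1 + B₀).toNat, by omega⟩, by simp only; omega⟩
    have h1 := dig_flip b B₀ ((X + iota B₀ κ y : Fin d → Fin W₀ → ZMod 2) i) ((X + iota B₀ κ (y + efl c1 hc i) : Fin d → Fin W₀ → ZMod 2) i) (Zc κ i) c1 w' hw'
      (by
        rw [iota_add, ← add_assoc]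
        simp only [Pi.add_apply]
        rw [Ne, left_eq_add]
        simp only [iota]
        rw [dif_pos (by omega)]
        have e : ((w' : ℤ) - B₀ - Zc κ i).toNat = c1 := by omega
        simp only [e, efl, Pi.single_eq_same]
        exact one_ne_zero)
      (by
        intro w hne
        rw [iota_add, ← add_assoc]
        simp only [Pi.add_apply]
        rw [left_eq_add]
        simp only [iota]
        split_ifs with hh
        · have e : (⟨((w : ℤ) - B₀ - Zc κ i).toNat, hh.2⟩ : Fin L) ≠ ⟨c1, hc⟩ := by
            intro h
            rw [Fin.mk.injEq] at h
            apply hne; ext; omega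
          simp [efl, e]
        · rfl)
    have e1 := lam_fl B₀ hpt (X + iota B₀ κ y) κ i
    have e2 := lam_fl B₀ hpt (X + iota B₀ κ (y + efl c1 hc i)) κ i
    rw [← e1, ← e2, ← hp, ← hp'] at h1
    have hz := zpow_pos' hb (Zc κ i)
    have h2 : ((b : ℝ) ^ c1 - 1) * (b : ℝ) ^ (Zc κ i) ≤ |ξ p i - ξ p' i| := by
      set α := ξ p i / (b : ℝ) ^ (Zc κ i) with hα
      set β := ξ p' i / (b : ℝ) ^ (Zc κ i) with hβ
      have h3 : (b : ℝ) ^ c1 ≤ |((⌊α⌋ : ℤ) : ℝ) - ⌊β⌋| := by exact_mod_cast h1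
      have f1 := Int.floor_le α
      have f2 := Int.lt_floor_add_one α
      have f3 := Int.floor_le β
      have f4 := Int.lt_floor_add_one β
      have h4 : (b : ℝ) ^ c1 - 1 ≤ |α - β| := by
        rcases le_abs.1 h3 with h | h
        · exact le_trans (by linarith) (le_abs_self _)
        · exact le_trans (by linarith) (neg_le_abs _)
      have e : ξ p i - ξ p' i = (α - β) * (b : ℝ) ^ (Zc κ i) := by
        rw [hα, hβ]; field_simp
      rw [e, abs_mul, abs_of_pos hz]
      exact mul_le_mul_of_nonneg_right h4 hz.le
    have h3 := h2.trans (G.m1x p p' i)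
    rw [hp, lam_ζ B₀ hpt, ← hp] at h3
    have h4 : c1 ≤ A * dd p p' + 1 := by
      by_contra hno
      push Not at hno
      have hb0 : (b : ℝ) ≠ 0 := by have : (0 : ℝ) < b := by exact_mod_cast (by omega : 0 < b)
                                   exact this.ne'
      rw [zpow_add₀ hb0, mul_comm] at h3
      have h5 := le_of_mul_le_mul_left h3 hz
      rw [zpow_natCast] at h5
      have h6 : b ^ (A * dd p p' + 2) ≤ b ^ c1 := Nat.pow_le_pow_right (by omega) (by omega)
      have h7 : 1 ≤ b ^ (A * dd p p') := Nat.one_le_pow _ _ (by omega)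
      have h8 : b ^ c1 ≤ b ^ (A * dd p p') + 1 := by
        have : (b : ℝ) ^ c1 ≤ (b : ℝ) ^ (A * dd p p') + 1 := by linarith
        exact_mod_cast this
      rw [pow_add] at h6
      have h9 : 4 ≤ b ^ 2 := by nlinarith
      have h10 : b ^ (A * dd p p') * 4 ≤ b ^ (A * dd p p') * b ^ 2 := Nat.mul_le_mul_left _ h9
      omega
    have h5 : dd p p' ≤ K * dd (ψ (γ * p)) (ψ (γ * p')) := by
      have := hK2 (γ * p) (γ * p'); rwa [hinv] at this
    set D := dd (ψ (γ * p)) (ψ (γ * p')) with hD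
    have h6 : A * dd p p' ≤ c0 * D := by
      calc A * dd p p' ≤ A * (K * D) := Nat.mul_le_mul_left _ h5
        _ = K * A * 1 * D := by ring
        _ ≤ K * A * (d + 3) * D := by gcongr; omega
        _ ≤ c0 * D := by rw [mul_assoc K]; exact Nat.mul_le_mul_right _ hc0
    show c1 ≤ c0 * (D + 1)
    rw [mul_add]; omega
  he i l hl := by simp [efl, hl]

end dom
end NR


namespace NR
open Finset
set_option linter.unusedSectionVars false
set_option linter.unusedVariables false

def ex (P r : ℕ) (t : ℤ) : ℕ := (P + r - t % P).toNat
def cl (b P r : ℕ) (t x : ℤ) : ℤ := x / (b : ℤ) ^ (ex P r t)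
def lab1 (b P r M : ℕ) (t x : ℤ) : ZMod M × ZMod M := (((t / P : ℤ) : ZMod M), (cl b P r t x : ZMod M))
def lab0 (b P r M : ℕ) (t x : ℤ) : (ZMod M × ZMod M) × Bool :=
  ((((t / P : ℤ) : ZMod M), ((cl b P r t x / 2 : ℤ) : ZMod M)), decide (cl b P r t x % 2 = 0))
def nbc (b P r w : ℕ) (B : ℤ) (t x : ℤ) : Prop := nearB P w t ∨ nearB ((b : ℤ) ^ (ex P r t)) B x
noncomputable def ix {d : ℕ} {Γ : Type*} (b : ℕ) (ζ : Γ → Fin d → ℤ) (ξ : Γ → Fin d → ℝ) (p : Γ) (j : Fin d) : ℤ :=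
  ⌊ξ p j / (b : ℝ) ^ (ζ p j)⌋

lemma ex_cast {P : ℕ} (hP : 0 < P) (r : ℕ) (t : ℤ) : (ex P r t : ℤ) = P + r - t % P := by
  unfold ex
  have := Int.emod_lt_of_pos t (by exact_mod_cast hP : (0 : ℤ) < P)
  omega

lemma ex_gt {P : ℕ} (hP : 0 < P) (r : ℕ) (t : ℤ) : r + 1 ≤ ex P r t := by
  have := Int.emod_lt_of_pos t (by exact_mod_cast hP : (0 : ℤ) < P)
  have := ex_cast hP r t
  omega

lemma ex_le {P : ℕ} (hP : 0 < P) (r : ℕ) (t : ℤ) : ex P r t ≤ P + r := by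
  have := Int.emod_nonneg t (by exact_mod_cast hP.ne' : (P : ℤ) ≠ 0)
  have := ex_cast hP r t
  omega

lemma ex_lvl {P : ℕ} (hP : 0 < P) (r : ℕ) (t : ℤ) : t + ex P r t = P * (t / P) + P + r := by
  rw [ex_cast hP]
  have := Int.mul_ediv_add_emod t P
  linarith

lemma floor_lvl {b : ℕ} (hb : 2 ≤ b) (x : ℝ) (t : ℤ) (e : ℕ) :
    ⌊x / (b : ℝ) ^ t⌋ / (b : ℤ) ^ e = ⌊x / (b : ℝ) ^ (t + e)⌋ := by
  have hb0 : (b : ℝ) ≠ 0 := by have : (0 : ℝ) < b := by exact_mod_cast (by omega : 0 < b)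
                               exact this.ne'
  have := Int.floor_div_natCast (x / (b : ℝ) ^ t) (b ^ e)
  push_cast at this
  rw [← this, div_div, zpow_add₀ hb0, zpow_natCast]

/-- if `x` is far from the boundary mod `E` then a perturbation keeps the cell -/
lemma cell_stable {b : ℕ} (hb : 2 ≤ b) (x x' : ℝ) (t : ℤ) (e w : ℕ) 
    (hn : ¬ nearB ((b : ℤ) ^ e) ((b : ℤ) ^ w + 1) ⌊x / (b : ℝ) ^ t⌋)
    (hx : |x - x'| ≤ (b : ℝ) ^ (t + w)) :
    ⌊x' / (b : ℝ) ^ (t + e)⌋ = ⌊x / (b : ℝ) ^ (t + e)⌋ := by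
  have hb1 : (0 : ℝ) < b := by exact_mod_cast (by omega : 0 < b)
  have hb0 := hb1.ne'
  have hz := zpow_pos' hb t
  unfold nearB at hn
  push Not at hn
  obtain ⟨n1, n2⟩ := hn
  rw [← floor_lvl hb x t e]
  set η := x / (b : ℝ) ^ t with hη
  set X := ⌊η⌋ with hX
  set E : ℤ := (b : ℤ) ^ e with hE
  have dm := Int.mul_ediv_add_emod X E
  set c := X / E with hc
  have q1 : E * c + ((b : ℤ) ^ w + 1) ≤ X := by linarith
  have q2 : X + 1 ≤ E * c + E - ((b : ℤ) ^ w + 1) := by linarith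
  have q1' : (E : ℝ) * c + ((b : ℝ) ^ w + 1) ≤ X := by exact_mod_cast q1
  have q2' : (X : ℝ) + 1 ≤ E * c + E - ((b : ℝ) ^ w + 1) := by exact_mod_cast q2
  have f1 := Int.floor_le η
  have f2 := Int.lt_floor_add_one η
  rw [← hX] at f1 f2
  have hd : |η - x' / (b : ℝ) ^ t| ≤ (b : ℝ) ^ w := by
    rw [hη, ← sub_div, abs_div, abs_of_pos hz, div_le_iff₀ hz]
    rw [zpow_add₀ hb0, zpow_natCast] at hx; linarith
  rw [abs_le] at hd
  have hE0 : (0 : ℝ) < E := by rw [hE]; push_cast; positivity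
  have e1 : x' / (b : ℝ) ^ (t + e) = x' / (b : ℝ) ^ t / E := by
    rw [div_div, zpow_add₀ hb0, zpow_natCast, hE]; push_cast; rfl
  rw [Int.floor_eq_iff, e1, le_div_iff₀ hE0, div_lt_iff₀ hE0]
  constructor <;> nlinarith

lemma div_stable {P : ℕ} (hP : 0 < P) {w : ℕ} {t t' : ℤ} (hn : ¬ nearB P w t) (h : |t - t'| ≤ w) :
    t' / P = t / P := by
  have hP' : (0 : ℤ) < P := by exact_mod_cast hP
  unfold nearB at hn
  push Not at hn
  have := Int.mul_ediv_add_emod t P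
  rw [abs_le] at h
  rw [Int.ediv_eq_iff_of_pos hP']
  constructor <;> nlinarith

section lab
variable {d : ℕ} {Γ : Type*} {b : ℕ} {ζ : Γ → Fin d → ℤ} {ξ : Γ → Fin d → ℝ}

lemma cl_ix (hb : 2 ≤ b) {P : ℕ} (hP : 0 < P) (r : ℕ) (p : Γ) (j : Fin d) :
    cl b P r (ζ p j) (ix b ζ ξ p j) = ⌊ξ p j / (b : ℝ) ^ (P * (ζ p j / P) + P + r)⌋ := by
  unfold cl ix
  rw [floor_lvl hb, ex_lvl hP]

lemma core1 (hb : 2 ≤ b) {P : ℕ} (hP : 0 < P) (r w2 w3 : ℕ) (j : Fin d) (p q : Γ)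
    (hn : ¬ nbc b P r w2 ((b : ℤ) ^ w3 + 1) (ζ p j) (ix b ζ ξ p j))
    (h1 : |ζ p j - ζ q j| ≤ w2) (h2 : |ξ p j - ξ q j| ≤ (b : ℝ) ^ (ζ p j + w3)) :
    ζ q j / P = ζ p j / P ∧
      cl b P r (ζ q j) (ix b ζ ξ q j) = cl b P r (ζ p j) (ix b ζ ξ p j) := by
  unfold nbc at hn
  push Not at hn
  have e1 := div_stable hP hn.1 h1
  refine ⟨e1, ?_⟩
  rw [cl_ix hb hP, cl_ix hb hP, e1, ← ex_lvl hP]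
  exact cell_stable hb _ _ _ _ w3 hn.2 h2

lemma core2 (hb : 2 ≤ b) {P : ℕ} (hP : 0 < P) (r Z μ : ℕ) (hμ : Z + 2 ≤ μ) (j : Fin d) (p q : Γ)
    (h1 : |ζ p j - ζ q j| ≤ Z) (h2 : |ξ p j - ξ q j| ≤ (b : ℝ) ^ (ζ p j + Z))
    (e1 : ((ζ p j / P : ℤ) : ZMod (b ^ μ)) = ((ζ q j / P : ℤ) : ZMod (b ^ μ)))
    (e2 : ((cl b P r (ζ p j) (ix b ζ ξ p j) : ℤ) : ZMod (b ^ μ)) =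
      ((cl b P r (ζ q j) (ix b ζ ξ q j) : ℤ) : ZMod (b ^ μ))) :
    |ξ p j - ξ q j| ≤ (b : ℝ) ^ (ζ p j + (P + r : ℕ)) := by
  have hP' : (0 : ℤ) < P := by exact_mod_cast hP
  have hb1 : (0 : ℝ) < b := by exact_mod_cast (by omega : 0 < b)
  have hM : (Z : ℤ) + 1 < (b ^ μ : ℕ) ∧ (b : ℤ) ^ Z + 1 < (b ^ μ : ℕ) := by
    have h3 : b ^ (Z + 2) ≤ b ^ μ := Nat.pow_le_pow_right (by omega) hμ
    have h4 : Z < b ^ Z := Nat.lt_pow_self (by omega)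
    have h5 : b ^ (Z + 2) = b ^ Z * b ^ 2 := pow_add _ _ _
    have h6 : 4 ≤ b ^ 2 := by nlinarith
    have h7 : b ^ Z * 4 ≤ b ^ Z * b ^ 2 := Nat.mul_le_mul_left _ h6
    constructor
    · have : Z + 1 < b ^ μ := by omega
      exact_mod_cast this
    · have : b ^ Z + 1 < b ^ μ := by omega
      exact_mod_cast this
  have uniq : ∀ x y : ℤ, ((x : ℤ) : ZMod (b ^ μ)) = y → |x - y| < (b ^ μ : ℕ) → x = y := by
    intro x y h hlt
    have h3 := (ZMod.intCast_eq_intCast_iff_dvd_sub _ _ _).1 h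
    rw [abs_sub_comm] at hlt
    have := Int.eq_zero_of_abs_lt_dvd h3 hlt
    linarith
  have a1 : ζ p j / P = ζ q j / P := by
    apply uniq _ _ e1
    refine lt_of_le_of_lt ?_ hM.1
    have g1 := Int.mul_ediv_add_emod (ζ p j) P
    have g2 := Int.mul_ediv_add_emod (ζ q j) P
    have g3 := Int.emod_nonneg (ζ p j) hP'.ne'
    have g4 := Int.emod_nonneg (ζ q j) hP'.ne'
    have g5 := Int.emod_lt_of_pos (ζ p j) hP'
    have g6 := Int.emod_lt_of_pos (ζ q j) hP'
    have hP1 : (1 : ℤ) ≤ P := hP'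
    rw [abs_le] at *
    constructor
    · by_contra hno
      push Not at hno
      have : (ζ p j / P - ζ q j / P) ≤ -(Z + 2) := by omega
      have : P * (ζ p j / P - ζ q j / P) ≤ P * (-(Z + 2)) := mul_le_mul_of_nonneg_left this hP'.le
      nlinarith
    · by_contra hno
      push Not at hno
      have : (Z + 2) ≤ (ζ p j / P - ζ q j / P) := by omega
      have : P * (Z + 2) ≤ P * (ζ p j / P - ζ q j / P) := mul_le_mul_of_nonneg_left this hP'.le
      nlinarith
  rw [cl_ix hb hP, cl_ix hb hP, ← a1, ← ex_lvl hP] at e2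
  set lv := ζ p j + (ex P r (ζ p j) : ℤ) with hlv
  have hz := zpow_pos' hb lv
  have hcl : |ξ p j / (b : ℝ) ^ lv - ξ q j / (b : ℝ) ^ lv| ≤ (b : ℝ) ^ Z := by
    rw [← sub_div, abs_div, abs_of_pos hz, div_le_iff₀ hz]
    refine h2.trans ?_
    rw [← zpow_natCast, ← zpow_add₀ hb1.ne']
    apply zpow_mono hb; omega
  have f1 := Int.floor_le (ξ p j / (b : ℝ) ^ lv)
  have f2 := Int.lt_floor_add_one (ξ p j / (b : ℝ) ^ lv)
  have f3 := Int.floor_le (ξ q j / (b : ℝ) ^ lv)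
  have f4 := Int.lt_floor_add_one (ξ q j / (b : ℝ) ^ lv)
  have a2 := uniq _ _ e2 (by
    refine lt_of_le_of_lt ?_ hM.2
    have : |(⌊ξ p j / (b : ℝ) ^ lv⌋ : ℝ) - ⌊ξ q j / (b : ℝ) ^ lv⌋| ≤ (b : ℝ) ^ Z + 1 := by
      rw [abs_le] at *; constructor <;> linarith
    exact_mod_cast this)
  rw [a2] at f1 f2
  have h3 : |ξ p j / (b : ℝ) ^ lv - ξ q j / (b : ℝ) ^ lv| ≤ 1 := by
    rw [abs_le]; constructor <;> linarith
  rw [← sub_div, abs_div, abs_of_pos hz, div_le_iff₀ hz, one_mul] at h3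
  refine h3.trans (zpow_mono hb ?_)
  have := ex_le hP r (ζ p j)
  push_cast
  omega

lemma Lab1 (hb : 2 ≤ b) {P : ℕ} (hP : 0 < P) (r w2 w3 Z μ W : ℕ) (hμ : Z + 2 ≤ μ)
    (hW : P + r ≤ 2 * W + 1) (j : Fin d) :
    Lab b ζ ξ j w2 w3 W Z (fun p => lab1 b P r (b ^ μ) (ζ p j) (ix b ζ ξ p j))
      (fun p => nbc b P r w2 ((b : ℤ) ^ w3 + 1) (ζ p j) (ix b ζ ξ p j)) where
  L1 p q hn h1 h2 := by
    obtain ⟨e1, e2⟩ := core1 hb hP r w2 w3 j p q hn h1 h2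
    simp only [lab1, e1, e2]
  L2 p q h h1 h2 := by
    simp only [lab1, Prod.mk.injEq] at h
    exact (core2 hb hP r Z μ hμ j p q h1 h2 h.1 h.2).trans (zpow_mono hb (by push_cast at *; omega))

lemma Lab0 (hb : 2 ≤ b) {P : ℕ} (hP : 0 < P) (r w2 w3 Z μ W : ℕ) (hμ : Z + 2 ≤ μ)
    (hW : P + r ≤ 2 * W + 1) (j : Fin d) :
    Lab b ζ ξ j w2 w3 W Z (fun p => lab0 b P r (b ^ μ) (ζ p j) (ix b ζ ξ p j))
      (fun p => nbc b P r w2 ((b : ℤ) ^ w3 + 1) (ζ p j) (ix b ζ ξ p j)) where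
  L1 p q hn h1 h2 := by
    obtain ⟨e1, e2⟩ := core1 hb hP r w2 w3 j p q hn h1 h2
    simp only [lab0, e1, e2]
  L2 p q h h1 h2 := by
    simp only [lab0, Prod.mk.injEq] at h
    refine (core2 hb hP r Z μ hμ j p q h1 h2 h.1.1 ?_).trans (zpow_mono hb (by push_cast at *; omega))
    obtain ⟨⟨_, h3⟩, h4⟩ := h
    have h5 : ∀ c : ℤ, c = 2 * (c / 2) + if c % 2 = 0 then 0 else 1 := by intro c; split_ifs <;> omega
    rw [h5 (cl b P r (ζ p j) _), h5 (cl b P r (ζ q j) _)]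
    have h6 : (cl b P r (ζ p j) (ix b ζ ξ p j) % 2 = 0) ↔ (cl b P r (ζ q j) (ix b ζ ξ q j) % 2 = 0) := by
      simpa using h4
    simp only [h6, Int.cast_add, Int.cast_mul, h3]

end lab
end NR


namespace NR
open Finset
set_option linter.unusedSectionVars false
set_option linter.unusedVariables false

/-! flips -/
def fl (E x : ℤ) : ℤ := if (x / E) % 2 = 0 then x + E else x - E

lemma fl_div {E : ℤ} (hE : 0 < E) (x : ℤ) : fl E x / E = if (x / E) % 2 = 0 then x / E + 1 else x / E - 1 := by
  unfold fl
  split_ifs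
  · rw [Int.add_ediv_of_dvd_right (dvd_refl _), Int.ediv_self hE.ne']
  · rw [Int.sub_ediv_of_dvd _ (dvd_refl _), Int.ediv_self hE.ne']

lemma fl_fl {E : ℤ} (hE : 0 < E) (x : ℤ) : fl E (fl E x) = x := by
  have h := fl_div hE x
  rw [fl, h]
  unfold fl
  split_ifs <;> omega

lemma fl_div2 {E : ℤ} (hE : 0 < E) (x : ℤ) : fl E x / E / 2 = x / E / 2 := by
  rw [fl_div hE]; split_ifs <;> omega

lemma fl_par {E : ℤ} (hE : 0 < E) (x : ℤ) : (fl E x / E % 2 = 0) ↔ ¬ (x / E % 2 = 0) := by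
  rw [fl_div hE]; split_ifs <;> omega

lemma fl_high {E c : ℤ} (hE : 0 < E) (x : ℤ) : fl E x / (E * (2 * c)) = x / (E * (2 * c)) := by
  rw [← Int.ediv_ediv_of_nonneg hE.le, ← Int.ediv_ediv_of_nonneg hE.le, ← Int.ediv_ediv_of_nonneg (by norm_num),
    ← Int.ediv_ediv_of_nonneg (by norm_num), fl_div2 hE]

lemma fl_low {E' M c : ℤ} (hE : 0 < E') (x : ℤ) :
    ∃ z : ℤ, fl (E' * (2 * (M * c))) x / E' = x / E' + 2 * (M * z) := by
  unfold fl
  split_ifs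
  · refine ⟨c, ?_⟩
    rw [Int.add_ediv_of_dvd_right (Dvd.intro _ rfl), Int.mul_ediv_cancel_left _ hE.ne']
  · refine ⟨-c, ?_⟩
    rw [Int.sub_ediv_of_dvd _ (Dvd.intro _ rfl), Int.mul_ediv_cancel_left _ hE.ne']; ring

structure Sc (b N : ℕ) (P r μ : ℕ → ℕ) : Prop where
  ev : Even b
  hb : 2 ≤ b
  hP : ∀ k, 0 < P k
  hr : ∀ k' k, k' < k → k < N → P k' + r k' + μ k' + 1 ≤ r k

lemma pow_even_split {b : ℕ} (ev : Even b) {e e' μ : ℕ} (h : e' + μ + 1 ≤ e) :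
    ∃ c : ℤ, (b : ℤ) ^ e = (b : ℤ) ^ e' * (2 * ((b ^ μ : ℕ) * c)) := by
  obtain ⟨b', hb'⟩ := ev
  obtain ⟨f, rfl⟩ := Nat.exists_eq_add_of_le h
  refine ⟨b' * (b : ℤ) ^ f, ?_⟩
  have : (b : ℤ) = 2 * b' := by rw [hb']; push_cast; ring
  rw [pow_add, pow_add, pow_add, pow_one]
  push_cast
  nth_rw 3 [this]
  ring

section
variable {n : ℕ} {b N : ℕ} {P r μ : ℕ → ℕ}

abbrev LabT (b μ : ℕ) := ZMod (b ^ μ) × ZMod (b ^ μ)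

noncomputable def tH (b : ℕ) (P r μ : ℕ → ℕ) (Q : ∀ k, LabT b (μ k) → LabT b (μ k) → Bool) (k : ℕ)
    (t i : Fin (n + 1) → ℤ) : ℝ :=
  FQ (Q k) (lab0 b (P k) (r k) (b ^ μ k) (t 0) (i 0))
    (lab1 b (P k) (r k) (b ^ μ k) (t (Fin.last n)) (i (Fin.last n)))

def flp (b : ℕ) (P r : ℕ → ℕ) (t : Fin (n + 1) → ℤ) (k : ℕ) (i : Fin (n + 1) → ℤ) : Fin (n + 1) → ℤ :=
  Function.update i 0 (fl ((b : ℤ) ^ ex (P k) (r k) (t 0)) (i 0))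

variable (Q : ∀ k, LabT b (μ k) → LabT b (μ k) → Bool)

lemma last_ne (hn : 1 ≤ n) : (Fin.last n : Fin (n + 1)) ≠ 0 := by
  intro h; have := congrArg Fin.val h; simp at this; omega

lemma lab0_flip (S : Sc b N P r μ) (k : ℕ) (t x : ℤ) :
    lab0 b (P k) (r k) (b ^ μ k) t (fl ((b : ℤ) ^ ex (P k) (r k) t) x) =
      ((lab0 b (P k) (r k) (b ^ μ k) t x).1, !(lab0 b (P k) (r k) (b ^ μ k) t x).2) := by
  have hb : (0 : ℤ) < (b : ℤ) ^ ex (P k) (r k) t := by have := S.hb; positivity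
  unfold lab0 cl
  rw [fl_div2 hb]
  have := fl_par hb x
  simp only [Prod.mk.injEq, true_and]
  by_cases h : x / (b : ℤ) ^ ex (P k) (r k) t % 2 = 0
  · rw [decide_eq_true h, decide_eq_false (fun h' => this.1 h' h)]; rfl
  · rw [decide_eq_false h, decide_eq_true (this.2 h)]; rfl

lemma lab0_pres (S : Sc b N P r μ) (k k' : ℕ) (hk : k < N) (hk' : k' < N) (h : k' ≠ k) (t x : ℤ) :
    lab0 b (P k') (r k') (b ^ μ k') t (fl ((b : ℤ) ^ ex (P k) (r k) t) x) =
      lab0 b (P k') (r k') (b ^ μ k') t x := by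
  have hb0 := S.hb
  have hb : ∀ e : ℕ, (0 : ℤ) < (b : ℤ) ^ e := by intro e; positivity
  have g1 := ex_gt (S.hP k) (r k) t
  have g2 := ex_le (S.hP k) (r k) t
  have g1' := ex_gt (S.hP k') (r k') t
  have g2' := ex_le (S.hP k') (r k') t
  rcases lt_or_gt_of_ne h with h1 | h1
  · have := S.hr k' k h1 hk
    obtain ⟨c, hc⟩ := pow_even_split S.ev (e := ex (P k) (r k) t) (e' := ex (P k') (r k') t) (μ := μ k') (by omega)
    obtain ⟨z, hz⟩ := fl_low (M := (b ^ μ k' : ℕ)) (c := c) (hb (ex (P k') (r k') t)) x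
    unfold lab0 cl
    rw [hc, hz]
    have e1 : (x / (b : ℤ) ^ ex (P k') (r k') t + 2 * (((b ^ μ k' : ℕ) : ℤ) * z)) / 2 =
      x / (b : ℤ) ^ ex (P k') (r k') t / 2 + ((b ^ μ k' : ℕ) : ℤ) * z := by omega
    have e2 : (x / (b : ℤ) ^ ex (P k') (r k') t + 2 * (((b ^ μ k' : ℕ) : ℤ) * z)) % 2 =
      x / (b : ℤ) ^ ex (P k') (r k') t % 2 := by omega
    rw [e1, e2]
    rw [Int.cast_add, Int.cast_mul, Int.cast_natCast, ZMod.natCast_self, zero_mul, add_zero]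
  · have := S.hr k k' h1 hk'
    obtain ⟨c, hc⟩ := pow_even_split S.ev (e := ex (P k') (r k') t) (e' := ex (P k) (r k) t) (μ := μ k) (by omega)
    unfold lab0 cl
    rw [hc, fl_high (hb _)]

lemma bs_not (x : Bool) : bs (!x) = - bs x := by cases x <;> simp [bs]

lemma tH_sq (k : ℕ) (t i : Fin (n + 1) → ℤ) : tH b P r μ Q k t i * tH b P r μ Q k t i = 1 := by
  unfold tH FQ
  rw [mul_mul_mul_comm, bs_mul_self, bs_mul_self, one_mul]

lemma tH_abs (k : ℕ) (t i : Fin (n + 1) → ℤ) : |tH b P r μ Q k t i| ≤ 1 := by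
  unfold tH; exact (FQ_abs _ _ _).le

lemma tH_flip (hn : 1 ≤ n) (S : Sc b N P r μ) (k : ℕ) (t i : Fin (n + 1) → ℤ) :
    tH b P r μ Q k t (flp b P r t k i) = - tH b P r μ Q k t i := by
  unfold tH flp
  rw [Function.update_self, Function.update_of_ne (last_ne hn), lab0_flip S]
  unfold FQ
  simp only [bs_not]; ring

lemma tH_pres (hn : 1 ≤ n) (S : Sc b N P r μ) (k k' : ℕ) (hk : k < N) (hk' : k' < N) (h : k' ≠ k)
    (t i : Fin (n + 1) → ℤ) :
    tH b P r μ Q k' t (flp b P r t k i) = tH b P r μ Q k' t i := by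
  unfold tH flp
  rw [Function.update_self, Function.update_of_ne (last_ne hn), lab0_pres S k k' hk hk' h]

abbrev Tl (n : ℕ) := Σ _ : (Fin n → ℤ), (Fin (n + 1) → ℤ)

def ht (h : Fin n → ℤ) : Fin (n + 1) → ℤ := Fin.snoc h (- ∑ k, h k)

@[simp] lemma ht_cast (h : Fin n → ℤ) (k : Fin n) : ht h k.castSucc = h k := by simp [ht]
@[simp] lemma ht_last (h : Fin n → ℤ) : ht h (Fin.last n) = - ∑ k, h k := by simp [ht]
lemma ht_sum (h : Fin n → ℤ) : ∑ j, ht h j = 0 := by rw [Fin.sum_univ_castSucc]; simp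

def Eb (b : ℕ) (c : ℕ) (t : ℤ) : ℤ := (b : ℤ) ^ (c - t).toNat
def lo (b c : ℕ) (h : Fin n → ℤ) (j : Fin (n + 1)) : ℤ := if j = 0 then Eb b c (ht h j) else 0
noncomputable def Ib (b c : ℕ) (h : Fin n → ℤ) : Finset (Fin (n + 1) → ℤ) :=
  Fintype.piFinset fun j => Ico (lo b c h j) (lo b c h j + Eb b c (ht h j))
noncomputable def Hb (n : ℕ) (H : ℕ) : Finset (Fin n → ℤ) := Fintype.piFinset fun _ => Ico (0 : ℤ) H
noncomputable def TB (n b H c : ℕ) : Finset (Tl n) := (Hb n H).sigma fun h => Ib b c h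

lemma Hb_le {H : ℕ} {h : Fin n → ℤ} (hh : h ∈ Hb n H) (j : Fin (n + 1)) : ht h j ≤ H := by
  unfold Hb at hh
  simp only [Fintype.mem_piFinset, mem_Ico] at hh
  induction j using Fin.lastCases with
  | last => 
    have : 0 ≤ ∑ k, h k := sum_nonneg fun k _ => (hh k).1
    simp; omega
  | cast k => simpa using (hh k).2.le

lemma Ib_card (hb : 2 ≤ b) {H c : ℕ} (hc : H ≤ c) {h : Fin n → ℤ} (hh : h ∈ Hb n H) :
    (Ib b c h).card = b ^ ((n + 1) * c) := by
  unfold Ib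
  rw [Fintype.card_piFinset]
  simp only [Int.card_Ico, add_sub_cancel_left]
  have : ∀ j, (Eb b c (ht h j)).toNat = b ^ (c - ht h j).toNat := by
    intro j; unfold Eb; exact_mod_cast Int.toNat_natCast _
  simp only [this]
  rw [prod_pow_eq_pow_sum]
  congr 1
  have : ((∑ j, (c - ht h j).toNat : ℕ) : ℤ) = (((n + 1) * c : ℕ) : ℤ) := by
    have : ∀ j, (((c - ht h j).toNat : ℕ) : ℤ) = c - ht h j := by
      intro j; have := Hb_le hh j; omega
    rw [Nat.cast_sum]
    simp only [this, sum_sub_distrib, ht_sum]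
    simp
  exact_mod_cast this

lemma Eb_pos (hb : 2 ≤ b) (c : ℕ) (t : ℤ) : 0 < Eb b c t := by unfold Eb; positivity

lemma TB_card (hb : 2 ≤ b) {H c : ℕ} (hc : H ≤ c) :
    (TB n b H c).card = (Hb n H).card * b ^ ((n + 1) * c) := by
  unfold TB
  rw [card_sigma, sum_congr rfl (fun h hh => Ib_card hb hc hh)]
  simp

lemma Hb_card (n H : ℕ) : (Hb n H).card = H ^ n := by
  unfold Hb; rw [Fintype.card_piFinset]; simp

lemma TB_pos (hb : 2 ≤ b) {H c : ℕ} (hH : 0 < H) (hc : H ≤ c) : 0 < (TB n b H c).card := by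
  rw [TB_card hb hc, Hb_card]; positivity

open Classical in
/-- fraction with a condition on a coordinate `i j` -/
lemma TB_fi (hb : 2 ≤ b) {H c : ℕ} (hc : H ≤ c) (j : Fin (n + 1)) (e : ℤ → ℕ) (r : ℕ)
    (he : ∀ t : ℤ, t ≤ H → r ≤ e t ∧ (e t : ℤ) ≤ c - t) (B : ℤ) (hB : 0 ≤ B) :
    (((TB n b H c).filter fun τ => nearB ((b : ℤ) ^ e (ht τ.1 j)) B (τ.2 j)).card : ℝ) ≤
      2 * B / (b : ℝ) ^ r * (TB n b H c).card := by
  have hb0 : (0 : ℝ) < b := by exact_mod_cast (by omega : 0 < b)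
  have h1 : ∀ h ∈ Hb n H, (((Ib b c h).filter fun i => nearB ((b : ℤ) ^ e (ht h j)) B (i j)).card : ℝ) ≤
      2 * B / (b : ℝ) ^ r * (Ib b c h).card := by
    intro h hh
    obtain ⟨e1, e2⟩ := he _ (Hb_le hh j)
    unfold Ib
    refine pi_frac _ (fun i => nearB ((b : ℤ) ^ e (ht h j)) B (i j)) j _ fun i hi => ?_
    simp only [Function.update_self]
    obtain ⟨f, hf⟩ := Nat.exists_eq_add_of_le (show e (ht h j) ≤ (c - ht h j).toNat by omega)
    have h2 := count_near ((b : ℤ) ^ e (ht h j)) B (lo b c h j) (b ^ f) (by positivity) hB 1 0 (Or.inl rfl)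
    have h3 : Eb b c (ht h j) = (b : ℤ) ^ e (ht h j) * (b ^ f : ℕ) := by
      unfold Eb; rw [hf, pow_add]; push_cast; ring
    rw [← h3] at h2
    simp only [one_mul, add_zero] at h2
    have h4 : (b : ℝ) ^ r ≤ (b : ℝ) ^ e (ht h j) := pow_le_pow_right₀ (by exact_mod_cast (by omega : 1 ≤ b)) e1
    rw [div_mul_eq_mul_div, le_div_iff₀ (by positivity)]
    refine le_trans ?_ h2
    push_cast
    exact mul_le_mul_of_nonneg_left h4 (by positivity)
  have e1 : ((TB n b H c).filter fun τ => nearB ((b : ℤ) ^ e (ht τ.1 j)) B (τ.2 j)) = 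
      (Hb n H).sigma fun h => (Ib b c h).filter fun i => nearB ((b : ℤ) ^ e (ht h j)) B (i j) := by
    ext ⟨h, i⟩; simp only [TB, mem_filter, mem_sigma, and_assoc]
  rw [e1, TB, card_sigma, card_sigma]
  push_cast
  rw [mul_sum]
  exact sum_le_sum h1

open Classical in
/-- fraction with a condition on a coordinate `t j` -/
lemma TB_ft (hn : 1 ≤ n) (hb : 2 ≤ b) {H c : ℕ} (hc : H ≤ c) (j : Fin (n + 1)) (E : ℕ) (hE : 0 < E) (hEH : E ∣ H)
    (w : ℤ) (hw : 0 ≤ w) :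
    (((TB n b H c).filter fun τ => nearB E w (ht τ.1 j)).card : ℝ) ≤
      2 * w / E * (TB n b H c).card := by
  have hE' : (0 : ℝ) < E := by exact_mod_cast hE
  obtain ⟨m, rfl⟩ := hEH
  have key : ∀ (k : Fin n) (s : ℤ) (hs : s = 1 ∨ s = -1), (∀ h : Fin n → ℤ, ∃ c : ℤ, ∀ x,
      ht (Function.update h k x) j = s * x + c) →
      (((Hb n (E * m)).filter fun h => nearB E w (ht h j)).card : ℝ) ≤ 2 * w / E * (Hb n (E * m)).card := by
    intro k s hs hf
    unfold Hb
    refine pi_frac _ (fun h => nearB E w (ht h j)) k _ fun h hh => ?_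
    obtain ⟨c, hc⟩ := hf h
    simp only [hc]
    have h2 := count_near E w 0 m (by exact_mod_cast hE) hw s c hs
    simp only [zero_add] at h2
    push_cast at h2 ⊢
    rw [div_mul_eq_mul_div, le_div_iff₀ hE']
    exact h2
  have h1 : (((Hb n (E * m)).filter fun h => nearB E w (ht h j)).card : ℝ) ≤ 2 * w / E * (Hb n (E * m)).card := by
    induction j using Fin.lastCases with
    | last =>
      refine key ⟨0, by omega⟩ (-1) (Or.inr rfl) fun h => ?_
      refine ⟨-∑ k ∈ univ.erase (⟨0, by omega⟩ : Fin n), h k, fun x => ?_⟩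
      simp only [ht_last]
      rw [← add_sum_erase _ _ (mem_univ (⟨0, by omega⟩ : Fin n)), Function.update_self, 
        sum_congr rfl fun k hk => Function.update_of_ne (ne_of_mem_erase hk) _ _]
      ring
    | cast k =>
      refine key k 1 (Or.inl rfl) fun h => ⟨0, fun x => ?_⟩
      simp
  have e1 : ((TB n b (E * m) c).filter fun τ => nearB E w (ht τ.1 j)) = 
      ((Hb n (E * m)).filter fun h => nearB E w (ht h j)).sigma fun h => Ib b c h := by
    ext ⟨h, i⟩; simp only [TB, mem_filter, mem_sigma]; tauto
  rw [e1, TB_card hb hc, card_sigma, sum_congr rfl (fun h hh => Ib_card hb hc (mem_filter.1 hh).1)]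
  simp only [sum_const, smul_eq_mul]
  push_cast
  rw [← mul_assoc]
  exact mul_le_mul_of_nonneg_right h1 (by positivity)

open Classical in
lemma P2 (hn : 1 ≤ n) (hb : 2 ≤ b) {H c : ℕ} (j : Fin (n + 1)) (P r w : ℕ) (hP : 0 < P) (hPH : P ∣ H)
    (hc : H + P + r ≤ c) (B : ℤ) (hB : 0 ≤ B) :
    (((TB n b H c).filter fun τ => nbc b P r w B (ht τ.1 j) (τ.2 j)).card : ℝ) ≤
      (2 * w / P + 2 * B / (b : ℝ) ^ r) * (TB n b H c).card := by
  have h1 := TB_ft hn hb (by omega : H ≤ c) j P hP hPH w (by positivity)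
  have h2 := TB_fi hb (by omega : H ≤ c) j (ex P r) r (fun t ht => by
    have := ex_gt hP r t
    have := ex_le hP r t
    omega) B hB
  have h0 : ((TB n b H c).filter fun τ => nbc b P r w B (ht τ.1 j) (τ.2 j)) = 
      ((TB n b H c).filter fun τ => nearB P w (ht τ.1 j)) ∪
    ((TB n b H c).filter fun τ => nearB ((b : ℤ) ^ ex P r (ht τ.1 j)) B (τ.2 j)) := by
    ext τ; rw [mem_union, mem_filter, mem_filter, mem_filter]; unfold nbc; tauto
  rw [h0]
  have h3 := card_union_le ((TB n b H c).filter fun τ => nearB P w (ht τ.1 j))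
    ((TB n b H c).filter fun τ => nearB ((b : ℤ) ^ ex P r (ht τ.1 j)) B (τ.2 j))
  have h4 : (((((TB n b H c).filter fun τ => nearB P w (ht τ.1 j)) ∪ 
    ((TB n b H c).filter fun τ => nearB ((b : ℤ) ^ ex P r (ht τ.1 j)) B (τ.2 j))).card : ℕ) : ℝ) ≤ 
     (#((TB n b H c).filter fun τ => nearB P w (ht τ.1 j)) : ℝ) + 
    #((TB n b H c).filter fun τ => nearB ((b : ℤ) ^ ex P r (ht τ.1 j)) B (τ.2 j)) := by exact_mod_cast h3
  push_cast at h1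
  linarith

/-- boundary tiles -/
def bad (b H c R : ℕ) (τ : Tl n) : Prop :=
  (∃ k : Fin n, nearB H R (ht τ.1 k.castSucc)) ∨ 
    ∃ j : Fin (n + 1), nearB ((b : ℤ) ^ (c - ht τ.1 j).toNat) ((b : ℤ) ^ R + 1) (τ.2 j)

open Classical in
lemma P3 (hn : 1 ≤ n) (hb : 2 ≤ b) {H c : ℕ} (R : ℕ) (hH : 0 < H) (hc : H ≤ c) :
    (((TB n b H c).filter fun τ => bad b H c R τ).card : ℝ) ≤
      (n * (2 * R / H) + (n + 1) * (2 * ((b : ℝ) ^ R + 1) / (b : ℝ) ^ (c - H))) * (TB n b H c).card := by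
  have h1 := fun k : Fin n => TB_ft hn hb hc k.castSucc H hH dvd_rfl R (by positivity)
  have h2 := fun j : Fin (n + 1) => TB_fi hb hc j (fun t => (c - t).toNat) (c - H) (fun t ht => by omega)
    ((b : ℤ) ^ R + 1) (by positivity)
  have h3 : ((TB n b H c).filter fun τ => bad b H c R τ) ⊆
      ((univ : Finset (Fin n)).biUnion fun k => (TB n b H c).filter fun τ => nearB H R (ht τ.1 k.castSucc)) ∪
      ((univ : Finset (Fin (n + 1))).biUnion fun j => (TB n b H c).filter fun τ => 
        nearB ((b : ℤ) ^ (c - ht τ.1 j).toNat) ((b : ℤ) ^ R + 1) (τ.2 j)) := by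
    intro τ hτ
    rw [mem_filter] at hτ
    obtain ⟨h, ⟨k, hk⟩ | ⟨j, hj⟩⟩ := hτ
    · exact mem_union_left _ (mem_biUnion.2 ⟨k, mem_univ _, mem_filter.2 ⟨h, hk⟩⟩)
    · exact mem_union_right _ (mem_biUnion.2 ⟨j, mem_univ _, mem_filter.2 ⟨h, hj⟩⟩)
  have h4 := (card_le_card h3).trans (card_union_le _ _)
  have h5 := h4.trans (add_le_add card_biUnion_le card_biUnion_le)
  have h6 : (((TB n b H c).filter fun τ => bad b H c R τ).card : ℝ) ≤ 
     (∑ k : Fin n, (#((TB n b H c).filter fun τ => nearB H R (ht τ.1 k.castSucc)) : ℝ)) +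
     ∑ j : Fin (n + 1), (#((TB n b H c).filter fun τ => 
        nearB ((b : ℤ) ^ (c - ht τ.1 j).toNat) ((b : ℤ) ^ R + 1) (τ.2 j)) : ℝ) := by exact_mod_cast h5
  refine h6.trans ((add_le_add (sum_le_sum fun k _ => h1 k) (sum_le_sum fun j _ => h2 j)).trans (le_of_eq ?_))
  simp
  ring

/-- the moment facts on the big box -/
lemma P1 (hn : 1 ≤ n) (S : Sc b N P r μ) (m : ℕ) (hm : 0 < m) (hN : N = m ^ 2) {H c : ℕ}
    (hc : ∀ k < N, H + P k + r k + 1 ≤ c) :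
    (∑ τ ∈ TB n b H c, ∑ k ∈ range N, tH b P r μ Q k (ht τ.1) τ.2 = 0) ∧
    (m / 4 : ℝ) * (TB n b H c).card ≤ ∑ τ ∈ TB n b H c, |∑ k ∈ range N, tH b P r μ Q k (ht τ.1) τ.2| := by
  have hb := S.hb
  have hθ : ∀ h ∈ Hb n H, ∀ k < N, ∀ i ∈ Ib b c h, flp b P r (ht h) k i ∈ Ib b c h := by
    intro h hh k hk i hi
    unfold Ib at hi ⊢
    rw [Fintype.mem_piFinset] at hi ⊢
    intro j
    by_cases hj : j = 0
    · subst hj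
      have h0 := hi 0
      simp only [flp, Function.update_self, lo, if_true] at h0 ⊢
      rw [mem_Ico] at h0 ⊢
      have := Hb_le hh 0
      have g2 := ex_le (S.hP k) (r k) (ht h 0)
      have g3 := hc k hk
      obtain ⟨z, hz⟩ := pow_even_split S.ev (e := (c - ht h 0).toNat) (e' := ex (P k) (r k) (ht h 0)) (μ := 0) (by omega)
      have hp := Eb_pos hb c (ht h 0)
      have e : ∀ x : ℤ, (Eb b c (ht h 0) ≤ x ∧ x < Eb b c (ht h 0) + Eb b c (ht h 0)) ↔ x / Eb b c (ht h 0) = 1 := by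
        intro x
        rw [Int.ediv_eq_iff_of_pos hp]; constructor <;> rintro ⟨_, _⟩ <;> constructor <;> linarith
      rw [e] at h0 ⊢
      rw [← h0]
      unfold Eb
      rw [hz]
      exact fl_high (by positivity) _
    · simp only [flp, Function.update_of_ne hj]; exact hi j
  have hinv : ∀ h : Fin n → ℤ, ∀ k, ∀ i, flp b P r (ht h) k (flp b P r (ht h) k i) = i := by
    intro h k i
    unfold flp
    rw [Function.update_self, fl_fl (by positivity)]; simp
  have mom := fun h (hh : h ∈ Hb n H) => moments (Ib b c h) N (fun k => tH b P r μ Q k (ht h)) (fun k => flp b P r (ht h) k)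
    (fun k _ i _ => tH_sq Q k _ i) (hθ h hh) (fun k _ i _ => hinv h k i) (fun k _ i _ => tH_flip Q hn S k _ i)
    (fun k hk k' hk' hne i _ => tH_pres Q hn S k k' hk hk' hne _ i) N le_rfl
  unfold TB
  rw [sum_sigma, sum_sigma, card_sigma]
  constructor
  · refine sum_eq_zero fun h hh => ?_
    dsimp only
    rw [sum_comm]
    refine sum_eq_zero fun k hk => ?_
    have hk := mem_range.1 hk
    have e : ∑ i ∈ Ib b c h, tH b P r μ Q k (ht h) i = ∑ i ∈ Ib b c h, -tH b P r μ Q k (ht h) i := by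
      refine sum_nbij' (flp b P r (ht h) k) (flp b P r (ht h) k) (hθ h hh k hk) (hθ h hh k hk)
        (fun i _ => hinv h k i) (fun i _ => hinv h k i) fun i _ => ?_
      rw [tH_flip Q hn S, neg_neg]
    rw [sum_neg_distrib] at e; linarith
  · push_cast
    rw [mul_sum]
    refine sum_le_sum fun h hh => ?_
    obtain ⟨m2, m4⟩ := mom h hh
    refine l1_lower (Ib b c h) (fun i => ∑ k ∈ range N, tH b P r μ Q k (ht h) i) m (by exact_mod_cast hm) ?_ ?_
    · rw [m2, hN]; push_cast; rfl
    · refine m4.trans (le_of_eq ?_); rw [hN]; push_cast; rfl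
end
end NR


namespace NR
open Finset
set_option linter.unusedSectionVars false
set_option linter.unusedVariables false

structure Scl where
  (c1 g h1 lL W L w2 w3 r P μ T ρ : ℕ)

/-- all constraints at one scale -/
structure Stp (A c0 b N Q₀ q m : ℕ) (s : Scl) (ρ' : ℕ) : Prop where
  lpar : LPar A s.L c0 s.c1 q s.g s.h1 s.lL s.W b
  hν : 4 * A ^ (A * (2 * s.W + 2)) < 3 * 2 ^ s.L
  hw2 : 2 * (A * c0) * (s.c1 + 1) + 2 ≤ s.w2
  hw3 : s.w2 + (s.g + A * c0 + 4 * q) + 1 ≤ s.w3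
  hμ : 2 * (A * c0) * s.L + 2 ≤ s.μ
  hW : s.P + s.r ≤ 2 * s.W + 1
  hP : 0 < s.P
  hρ : 0 < s.ρ
  hL : s.L < 2 ^ (m + 1) * Q₀ * s.ρ
  hg : 2 * (A * c0) * Q₀ * s.ρ ≤ s.g
  hT : 0 < s.T
  hTρ : s.ρ ∣ s.T
  hLT : s.L ≤ s.T
  eT : N * (2 * (A * c0) * s.L) ^ 2 ≤ s.T ^ 2
  hT' : s.T ≤ ρ'
  hm' : 2 ^ m * (2 * Q₀) * s.ρ ≤ ρ'
  e1 : N * (4 * (A * c0) ^ 2 * s.T) ≤ ρ'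
  e2 : N * (4 * (A * c0) ^ 2 * (2 ^ m * (2 * Q₀) * s.ρ)) ≤ ρ'
  hr' : s.P + s.r + s.μ + 1 ≤ ρ'
  hrρ : s.ρ ≤ s.r
  n1 : N * (2 * s.w2) ≤ s.P
  n2 : N * (2 * (b ^ s.w3 + 1)) ≤ b ^ s.r

/-- constraint on the random sign -/
def QGood (A b N : ℕ) (s : Scl) (Q : LabT b s.μ → LabT b s.μ → Bool) : Prop :=
  QLp (Fin s.L → ZMod 2) (FQ Q) (A ^ (A * (2 * s.W + 2))) (1 / N)

lemma ust_abs (F : ℤ → ℝ) (a0 : ℝ) (h0 : 0 ≤ a0) (hF : ∀ x, |F (x + 1) - F x| ≤ a0) (T : ℕ) (x : ℤ) :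
    |ust F T x| ≤ a0 := by
  unfold ust
  rcases Nat.eq_zero_or_pos T with rfl | hT
  · simpa using h0
  have hT' : (0 : ℝ) < T := by exact_mod_cast hT
  rw [abs_div, abs_of_pos hT', div_le_iff₀ hT']
  refine (abs_sum_le_sum_abs _ _).trans ((sum_le_sum fun a _ => slp_abs F a0 h0 hF T _).trans ?_)
  simp; linarith

lemma avg_trans {𝒳 Y : Type*} [AddCommGroup 𝒳] [Fintype 𝒳] [Fintype Y] (ι : Y → 𝒳) (f : 𝒳 → ℝ) :
    ∑ X, ∑ y, f (X + ι y) = Fintype.card Y * ∑ X, f X := by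
  rw [sum_comm]
  have : ∀ y, ∑ X, f (X + ι y) = ∑ X, f X := fun y =>
    Fintype.sum_equiv (Equiv.addRight (ι y)) _ _ fun X => rfl
  simp only [this]
  simp

section st
variable {n : ℕ} {Γ : Type*} [Group Γ] {b : ℕ} {ζ : Γ → Fin (n + 1) → ℤ}
  {ξ : Γ → Fin (n + 1) → ℝ} {dd : Γ → Γ → ℕ} {A : ℕ} {W₀ B₀ : ℕ}
  {pt : (Fin (n + 1) → ℤ) → (Fin (n + 1) → ℤ) → Γ}

/-- the data of the standing assumptions -/
structure Std (b : ℕ) (ζ : Γ → Fin (n + 1) → ℤ) (ξ : Γ → Fin (n + 1) → ℝ) (dd : Γ → Γ → ℕ) (A : ℕ)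
    (pt : (Fin (n + 1) → ℤ) → (Fin (n + 1) → ℤ) → Γ) (K c0 : ℕ) (ψ : Γ → Γ) : Prop where
  G : GM b ζ ξ dd A
  hb : 2 ≤ b
  hn : 1 ≤ n
  hpt : IsPt b ζ ξ pt
  hinv : ∀ g p q, dd (g * p) (g * q) = dd p q
  hψ : Function.Injective ψ
  hK1 : ∀ p q, dd (ψ p) (ψ q) ≤ K * dd p q
  hK2 : ∀ p q, dd p q ≤ K * dd (ψ p) (ψ q)
  hc0 : K * (A * (n + 1 + 3)) ≤ c0
  hc01 : 1 ≤ c0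
  hA : 1 ≤ A

/-- the height function along a line -/
noncomputable def lnF (b B₀ : ℕ) (ζ : Γ → Fin (n + 1) → ℤ) (pt : (Fin (n + 1) → ℤ) → (Fin (n + 1) → ℤ) → Γ)
    (ψ : Γ → Γ) (γ : Γ) (X : Fin (n + 1) → Fin W₀ → ZMod 2)
    (κ : Fin (n + 1) → ℤ) (i j : Fin (n + 1)) (x : ℤ) : ℝ :=
  (ζ (ψ (γ * lam b B₀ pt X (κ + Pi.single i x))) j : ℝ)

lemma lnF_lip {K c0 : ℕ} {ψ : Γ → Γ} (S : Std b ζ ξ dd A pt K c0 ψ) (γ : Γ) (X : Fin (n + 1) → Fin W₀ → ZMod 2)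
    (κ : Fin (n + 1) → ℤ) (i j : Fin (n + 1)) (x : ℤ) :
    |lnF b B₀ ζ pt ψ γ X κ i j (x + 1) - lnF b B₀ ζ pt ψ γ X κ i j x| ≤ (A * c0 : ℕ) := by
  unfold lnF
  have h1 := lam_close (B₀ := B₀) S.G S.hb (by omega) S.hpt X (κ + Pi.single i x) i
  rw [add_assoc, ← Pi.single_add] at h1
  have h2 := S.hK1 (γ * lam b B₀ pt X (κ + Pi.single i x)) (γ * lam b B₀ pt X (κ + Pi.single i (x + 1)))
  rw [S.hinv] at h2
  have h3 := S.G.m1z (ψ (γ * lam b B₀ pt X (κ + Pi.single i x))) (ψ (γ * lam b B₀ pt X (κ + Pi.single i (x + 1)))) j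
  have h4 : A * dd (ψ (γ * lam b B₀ pt X (κ + Pi.single i x))) (ψ (γ * lam b B₀ pt X (κ + Pi.single i (x + 1)))) ≤ A * c0 := 
    Nat.mul_le_mul_left _ ((h2.trans (Nat.mul_le_mul_left _ h1)).trans S.hc0)
  rw [abs_sub_comm] at h3
  have h5 := h3.trans (by exact_mod_cast h4 : ((_ : ℕ) : ℤ) ≤ ((A * c0 : ℕ) : ℤ))
  exact_mod_cast h5

open Classical in
theorem step1 {K c0 : ℕ} {ψ : Γ → Γ} (S : Std b ζ ξ dd A pt K c0 ψ) {N Q₀ q m : ℕ} (hN : 0 < N) (hQ₀ : 0 < Q₀)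
    (hQq : 4 * (A * c0) * q ≤ Q₀) {s : Scl} {ρ' : ℕ}
    (P : Stp A c0 b N Q₀ q m s ρ') {Q : LabT b s.μ → LabT b s.μ → Bool} (hQ : QGood A b N s Q)
    (γ : Γ) (κ : Fin (n + 1) → ℤ) (hκ : ∀ l, -(B₀ : ℤ) ≤ Zc κ l ∧ Zc κ l + s.L ≤ (W₀ : ℤ) - B₀) :
    |∑ X : Fin (n + 1) → Fin W₀ → ZMod 2, FQ Q 
      (lab0 b s.P s.r (b ^ s.μ) (ζ (ψ (γ * lam b B₀ pt X κ)) 0) (ix b ζ ξ (ψ (γ * lam b B₀ pt X κ)) 0))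
      (lab1 b s.P s.r (b ^ s.μ) (ζ (ψ (γ * lam b B₀ pt X κ)) (Fin.last n)) (ix b ζ ξ (ψ (γ * lam b B₀ pt X κ)) (Fin.last n)))| ≤ 
    80 * q ^ 2 * (SS m Q₀ s.ρ s.T).card * (50 * ∑ X : Fin (n + 1) → Fin W₀ → ZMod 2, 
        dev (SS m Q₀ s.ρ s.T) (lnF b B₀ ζ pt ψ γ X κ) (fun i j => ust (lnF b B₀ ζ pt ψ γ X κ i j) ρ' 0) +
          48 * (n + 1) ^ 2 * (1 / N) * Fintype.card (Fin (n + 1) → Fin W₀ → ZMod 2)) +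
      2 * ∑ X : Fin (n + 1) → Fin W₀ → ZMod 2, (if nbc b s.P s.r s.w2 ((b : ℤ) ^ s.w3 + 1) (ζ (ψ (γ * lam b B₀ pt X κ)) 0)
        (ix b ζ ξ (ψ (γ * lam b B₀ pt X κ)) 0) then (1 : ℝ) else 0) +
      2 * ∑ X : Fin (n + 1) → Fin W₀ → ZMod 2, (if nbc b s.P s.r s.w2 ((b : ℤ) ^ s.w3 + 1) (ζ (ψ (γ * lam b B₀ pt X κ)) (Fin.last n))
        (ix b ζ ξ (ψ (γ * lam b B₀ pt X κ)) (Fin.last n)) then (1 : ℝ) else 0) +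
      1 / N * Fintype.card (Fin (n + 1) → Fin W₀ → ZMod 2) := by
  set V := Fin s.L → ZMod 2 with hV
  set 𝒳 := Fin (n + 1) → Fin W₀ → ZMod 2 with h𝒳
  have hb := S.hb
  have hN' : (0 : ℝ) < N := by exact_mod_cast hN
  have hcard : Fintype.card V = 2 ^ s.L := by simp [hV, ZMod.card]
  set cY : ℝ := ((Fintype.card (Fin (n + 1) → V) : ℕ) : ℝ) with hcY
  have hY : 0 < cY := by rw [hcY]; exact_mod_cast Fintype.card_pos
  set a0 : ℝ := ((A * c0 : ℕ) : ℝ) with ha0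
  have hc1L : s.c1 < s.L := P.lpar.ht1
  have hq : 1 ≤ q := P.lpar.hq
  have hq' : (0 : ℝ) < q := by exact_mod_cast hq
  have hQ' : (0 : ℝ) < Q₀ := by exact_mod_cast hQ₀
  have hT' : (0 : ℝ) < s.T := by exact_mod_cast P.hT
  set Ψ : 𝒳 → Γ := fun X => ψ (γ * lam b B₀ pt X κ) with hΨ
  set F : 𝒳 → ℝ := fun X => FQ Q (lab0 b s.P s.r (b ^ s.μ) (ζ (Ψ X) 0) (ix b ζ ξ (Ψ X) 0))
      (lab1 b s.P s.r (b ^ s.μ) (ζ (Ψ X) (Fin.last n)) (ix b ζ ξ (Ψ X) (Fin.last n))) with hFd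
  set NB : Fin (n + 1) → 𝒳 → ℝ := fun j X => if nbc b s.P s.r s.w2 ((b : ℤ) ^ s.w3 + 1) (ζ (Ψ X) j)
        (ix b ζ ξ (Ψ X) j) then (1 : ℝ) else 0 with hNB
  set DV : 𝒳 → ℝ := fun X => dev (SS m Q₀ s.ρ s.T) (lnF b B₀ ζ pt ψ γ X κ) (fun i j => ust (lnF b B₀ ζ pt ψ γ X κ i j) ρ' 0) with hDV
  set sc : ℝ := ((SS m Q₀ s.ρ s.T).card : ℝ) with hsc
  -- the estimate for every `X`
  have hX : ∀ X : 𝒳, |∑ y : Fin (n + 1) → V, F (X + iota B₀ κ y)| ≤ 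
      80 * q ^ 2 * sc * (50 * ∑ y : Fin (n + 1) → V, DV (X + iota B₀ κ y) + 48 * (n + 1) ^ 2 * (1 / N) * cY) + 
      2 * ∑ y : Fin (n + 1) → V, NB 0 (X + iota B₀ κ y) + 2 * ∑ y : Fin (n + 1) → V, NB (Fin.last n) (X + iota B₀ κ y) + 
      1 / N * cY := by
    intro X
    have lb := PhB_LBx (B₀ := B₀) S.G hb (by have := S.hn; omega) S.hpt S.hinv ψ S.hψ S.hK1 S.hK2 S.hc0 S.hc01 hc1L γ X κ hκ
    have lip : ∀ (y : Fin (n + 1) → V) i j x, |(ζ (PhB B₀ b pt ψ γ X κ y i (x + 1)) j : ℝ) - ζ (PhB B₀ b pt ψ γ X κ y i x) j| ≤ a0 :=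
      fun y i j x => lnF_lip S γ (X + iota B₀ κ y) κ i j x
    have a0n : 0 ≤ a0 := by positivity
    have hη : 1 / (2 * (q : ℝ)) + 2 * a0 / Q₀ ≤ 1 / q := by
      have h1 : 4 * a0 * q ≤ Q₀ := by rw [ha0]; exact_mod_cast hQq
      have h2 : 2 * a0 / Q₀ ≤ 1 / (2 * q) := by
        rw [div_le_div_iff₀ hQ' (by positivity)]; linarith
      have h3 : 1 / (2 * (q : ℝ)) + 1 / (2 * q) = 1 / q := by field_simp; norm_num
      linarith
    obtain ⟨u, hu⟩ := box_step ζ (PhB B₀ b pt ψ γ X κ) (fun y : Fin (n + 1) → V => ψ (γ * lam b B₀ pt (X + iota B₀ κ y) κ))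
      (fun y i j => ust (lnF b B₀ ζ pt ψ γ (X + iota B₀ κ y) κ i j) ρ' 0) a0 a0n lip
      (fun y i j => ust_abs _ a0 a0n (lnF_lip S γ _ κ i j) _ _)
      lb.b0 s.L s.T P.hLT P.hT (fun y y' i t ht h => PhB_c2 B₀ ψ γ X κ y y' i t ht h)
      (fun y y' i t ht h => PhB_c3 B₀ (by have := S.hn; omega) ψ γ X κ y y' i t (by omega) h (fun w hw => by omega))
      q Q₀ s.ρ m s.g P.hρ hQ₀ P.hL (1 / (2 * q)) (by positivity) hη (by
        have := P.hg
        rw [ha0]; exact_mod_cast this)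
    have LM := LL_main (u := u) S.G lb P.lpar (by rw [hcard]; exact P.hν) (last_ne S.hn).symm
      (Lab0 (ζ := ζ) (ξ := ξ) hb P.hP s.r s.w2 s.w3 (2 * (A * c0) * s.L) s.μ s.W P.hμ P.hW 0)
      (Lab1 (ζ := ζ) (ξ := ξ) hb P.hP s.r s.w2 s.w3 (2 * (A * c0) * s.L) s.μ s.W P.hμ P.hW (Fin.last n))
      P.hw2 P.hw3 le_rfl (fun x y => (FQ_abs Q x y).le) (by positivity) hQ
    have hTb : (2 * a0 * s.L / s.T) ^ 2 ≤ 1 / N := by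
      rw [div_pow, div_le_div_iff₀ (by positivity) hN', one_mul]
      have h := P.eT
      have : (N : ℝ) * (2 * ((A * c0 : ℕ) : ℝ) * s.L) ^ 2 ≤ (s.T : ℝ) ^ 2 := by exact_mod_cast h
      rw [ha0]; linarith
    refine LM.trans ?_
    have hsc0 : 0 ≤ sc := by positivity
    set bad : ℝ := (((univ.filter fun y => ¬ GoodAt ζ s.L q s.g (PhB B₀ b pt ψ γ X κ)
      (fun y : Fin (n + 1) → V => ψ (γ * lam b B₀ pt (X + iota B₀ κ y) κ)) u y).card : ℕ) : ℝ) with hbad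
    have hbq : bad ≤ 4 * q ^ 2 * (sc * (50 * ∑ y : Fin (n + 1) → V, DV (X + iota B₀ κ y) + 48 * (n + 1) ^ 2 * (1 / N) * cY)) := by
      have h1 : bad * (1 / (2 * (q : ℝ))) ^ 2 ≤ sc * (50 * ∑ y : Fin (n + 1) → V, DV (X + iota B₀ κ y) + 48 * (n + 1) ^ 2 * (1 / N) * cY) := by
        refine hu.trans (mul_le_mul_of_nonneg_left ?_ hsc0)
        refine add_le_add (le_of_eq rfl) ?_
        push_cast
        refine mul_le_mul_of_nonneg_right ?_ hY.le
        exact mul_le_mul_of_nonneg_left hTb (by positivity)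
      have h2 : bad * (1 / (2 * (q : ℝ))) ^ 2 = bad / (4 * q ^ 2) := by field_simp; ring
      rw [h2, div_le_iff₀ (by positivity)] at h1
      linarith
    have hnb : ∀ j, ∑ y : Fin (n + 1) → V, NB j (X + iota B₀ κ y) = 
      (((univ.filter fun y : Fin (n + 1) → V => nbc b s.P s.r s.w2 ((b : ℤ) ^ s.w3 + 1) (ζ (Ψ (X + iota B₀ κ y)) j)
        (ix b ζ ξ (Ψ (X + iota B₀ κ y)) j)).card : ℕ) : ℝ) := by
      intro j
      rw [hNB]; simp only [sum_boole]
    rw [hnb, hnb]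
    simp only [hΨ]
    nlinarith
  have h1 : cY * |∑ X, F X| ≤ ∑ X : 𝒳, |∑ y : Fin (n + 1) → V, F (X + iota B₀ κ y)| := by
    have e : cY * |∑ X, F X| = |cY * ∑ X, F X| := by rw [abs_mul, abs_of_pos hY]
    rw [e, ← avg_trans (fun y : Fin (n + 1) → V => iota B₀ κ y) F]
    exact abs_sum_le_sum_abs _ _
  have h2 := h1.trans (sum_le_sum fun X _ => hX X)
  have t1 := avg_trans (fun y : Fin (n + 1) → V => (iota B₀ κ y : 𝒳)) DV
  have t2 := fun j => avg_trans (fun y : Fin (n + 1) → V => (iota B₀ κ y : 𝒳)) (NB j)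
  simp only [sum_add_distrib, ← mul_sum] at h2
  rw [t1, t2, t2] at h2
  simp only [sum_const, card_univ, nsmul_eq_mul] at h2
  refine le_of_mul_le_mul_left (h2.trans (le_of_eq ?_)) hY
  ring
end st
end NR


namespace NR
open Finset
set_option linter.unusedSectionVars false
set_option linter.unusedVariables false

lemma sum_Ico_int (H : ℕ) (f : ℤ → ℝ) : ∑ x ∈ Ico (0 : ℤ) H, f x = ∑ x ∈ range H, f x := by
  symm
  refine sum_nbij (fun x : ℕ => (x : ℤ)) ?_ ?_ ?_ ?_
  · intro x hx; simp at hx ⊢; exact hx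
  · intro x _ y _ h; simpa using h
  · intro x hx
    simp at hx
    exact ⟨x.toNat, by simp; omega, by simp; omega⟩
  · intro x _; rfl

section st
variable {n : ℕ} {Γ : Type*} [Group Γ] {b : ℕ} {ζ : Γ → Fin (n + 1) → ℤ}
  {ξ : Γ → Fin (n + 1) → ℝ} {dd : Γ → Γ → ℕ} {A : ℕ} {W₀ B₀ : ℕ}
  {pt : (Fin (n + 1) → ℤ) → (Fin (n + 1) → ℤ) → Γ}

lemma lnF_shift (ψ : Γ → Γ) (γ : Γ) (X : Fin (n + 1) → Fin W₀ → ZMod 2) (κ : Fin (n + 1) → ℤ)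
    (i j : Fin (n + 1)) (x y : ℤ) :
    lnF b B₀ ζ pt ψ γ X (Function.update κ i x) i j y = lnF b B₀ ζ pt ψ γ X (Function.update κ i 0) i j (x + y) := by
  unfold lnF
  have : Function.update κ i x + Pi.single i y = Function.update κ i 0 + Pi.single i (x + y) := by
    ext l
    by_cases h : l = i
    · subst h; simp
    · simp [h]
  rw [this]

lemma slp_shift (F F' : ℤ → ℝ) (x : ℤ) (h : ∀ y, F' y = F (x + y)) (s : ℕ) (δ : ℤ) : slp F' s δ = slp F s (x + δ) := by
  unfold slp; rw [h, h, add_assoc]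

lemma ust_shift (F F' : ℤ → ℝ) (x : ℤ) (h : ∀ y, F' y = F (x + y)) (T : ℕ) : ust F' T 0 = ust F T x := by
  unfold ust
  congr 1
  refine sum_congr rfl fun a _ => ?_
  rw [slp_shift F F' x h]; congr 1; ring

lemma kap {K c0 : ℕ} {ψ : Γ → Γ} (S : Std b ζ ξ dd A pt K c0 ψ) (γ : Γ) (X : Fin (n + 1) → Fin W₀ → ZMod 2)
    (i j : Fin (n + 1)) (ρ v s T H : ℕ) (hH : 0 < H) (hρ : 0 < ρ) (hv : 0 < v) (hsv : s = v * ρ) (hsT : s ≤ T) (σ : Bool)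
    (ε : ℝ) (h7 : 7 * ((A * c0 : ℕ) : ℝ) ^ 2 * T ≤ ε * H) (h4 : 4 * ((A * c0 : ℕ) : ℝ) ^ 2 * s ≤ ε * T) :
    ∑ κ ∈ Hb (n + 1) H, (slp (lnF b B₀ ζ pt ψ γ X κ i j) s (off σ s) - ust (lnF b B₀ ζ pt ψ γ X κ i j) T 0) ^ 2 ≤
      ∑ κ ∈ Hb (n + 1) H, slp (lnF b B₀ ζ pt ψ γ X κ i j) ρ 0 ^ 2 - 
      ∑ κ ∈ Hb (n + 1) H, slp (lnF b B₀ ζ pt ψ γ X κ i j) T 0 ^ 2 + 2 * ε * (Hb (n + 1) H).card := by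
  set f := lnF b B₀ ζ pt ψ γ X with hf
  have hH' : (0 : ℝ) < H := by exact_mod_cast hH
  have hT : (0 : ℝ) < T := by
    have : 0 < v * ρ := Nat.mul_pos hv hρ
    exact_mod_cast (by omega : 0 < T)
  have avg : ∀ g : (Fin (n + 1) → ℤ) → ℝ, (H : ℝ) * ∑ κ ∈ Hb (n + 1) H, g κ = 
      ∑ κ ∈ Hb (n + 1) H, ∑ x ∈ range H, g (Function.update κ i x) := by
    intro g
    have := pi_avg (fun _ : Fin (n + 1) => Ico (0 : ℤ) H) g i
    unfold Hb
    simp only [Int.card_Ico, sub_zero, Int.toNat_natCast] at this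
    rw [← this]
    refine sum_congr rfl fun κ _ => ?_
    exact sum_Ico_int H (fun x => g (Function.update κ i x))
  have sh : ∀ κ (x : ℤ) y, f (Function.update κ i x) i j y = f (Function.update κ i 0) i j (x + y) :=
    fun κ x y => lnF_shift ψ γ X κ i j x y
  refine le_of_mul_le_mul_left ?_ hH'
  rw [mul_add, mul_sub, avg, avg, avg, ← sum_sub_distrib]
  have e : (H : ℝ) * (2 * ε * (Hb (n + 1) H).card) = ∑ κ ∈ Hb (n + 1) H, 2 * ε * H := by
    rw [sum_const, nsmul_eq_mul]; ring
  rw [e, ← sum_add_distrib]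
  refine sum_le_sum fun κ _ => ?_
  have h := D1 (f (Function.update κ i 0) i j) ((A * c0 : ℕ) : ℝ) (by positivity) (fun x => lnF_lip S γ X _ i j x)
    ρ v s T H hρ hv hsv hsT (off σ s) (by unfold off; split_ifs <;> simp)
  have g1 : ∀ x : ℕ, (slp (f (Function.update κ i x) i j) s (off σ s) - ust (f (Function.update κ i x) i j) T 0) ^ 2 = 
      (slp (f (Function.update κ i 0) i j) s (x + off σ s) - ust (f (Function.update κ i 0) i j) T x) ^ 2 := by
    intro x
    rw [slp_shift _ _ (x : ℤ) (sh κ x), ust_shift _ _ (x : ℤ) (sh κ x)]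
  have g2 : ∀ (s : ℕ) (x : ℕ), slp (f (Function.update κ i x) i j) s 0 ^ 2 = slp (f (Function.update κ i 0) i j) s x ^ 2 := by
    intro s x
    rw [slp_shift _ _ (x : ℤ) (sh κ x), add_zero]
  simp only [g1, g2]
  refine h.trans ?_
  have : 4 * ((A * c0 : ℕ) : ℝ) ^ 2 * s * H / T ≤ ε * H := by
    rw [div_le_iff₀ hT]; nlinarith
  linarith

/-- total energy at scale `ρ` -/
noncomputable def EN (b B₀ W₀ : ℕ) (ζ : Γ → Fin (n + 1) → ℤ) (pt : (Fin (n + 1) → ℤ) → (Fin (n + 1) → ℤ) → Γ)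
    (ψ : Γ → Γ) (γ : Γ) (H ρ : ℕ) : ℝ :=
  ∑ X : Fin (n + 1) → Fin W₀ → ZMod 2, ∑ i, ∑ j, ∑ κ ∈ Hb (n + 1) H, slp (lnF b B₀ ζ pt ψ γ X κ i j) ρ 0 ^ 2

lemma EN_nonneg (ψ : Γ → Γ) (γ : Γ) (H ρ : ℕ) : 0 ≤ EN b B₀ W₀ ζ pt ψ γ H ρ := by
  unfold EN; positivity

lemma EN_le {K c0 : ℕ} {ψ : Γ → Γ} (S : Std b ζ ξ dd A pt K c0 ψ) (γ : Γ) (H ρ : ℕ) :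
    EN b B₀ W₀ ζ pt ψ γ H ρ ≤ ((A * c0 : ℕ) : ℝ) ^ 2 * (n + 1) ^ 2 * (Hb (n + 1) H).card * 
      Fintype.card (Fin (n + 1) → Fin W₀ → ZMod 2) := by
  unfold EN
  have : ∀ X i j κ, slp (lnF b B₀ ζ pt ψ γ (X : Fin (n + 1) → Fin W₀ → ZMod 2) κ i j) ρ 0 ^ 2 ≤ ((A * c0 : ℕ) : ℝ) ^ 2 :=
    fun X i j κ => slp_sq _ _ (by positivity) (lnF_lip S γ X κ i j) _ _
  refine (sum_le_sum fun X _ => sum_le_sum fun i _ => sum_le_sum fun j _ => sum_le_sum fun κ _ => this X i j κ).trans (le_of_eq ?_)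
  simp only [sum_const, card_univ, nsmul_eq_mul, Fintype.card_fin]
  push_cast; ring

lemma dev_sum {K c0 : ℕ} {ψ : Γ → Γ} (S : Std b ζ ξ dd A pt K c0 ψ) {N Q₀ q m : ℕ} (hN : 0 < N) (hQ₀ : 0 < Q₀)
    {s : Scl} {ρ' : ℕ} (P : Stp A c0 b N Q₀ q m s ρ') (γ : Γ) (H : ℕ) (hH : 0 < H) 
    (h7 : N * (7 * (A * c0) ^ 2 * ρ') ≤ H) :
    ∑ κ ∈ Hb (n + 1) H, ∑ X : Fin (n + 1) → Fin W₀ → ZMod 2, 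
        dev (SS m Q₀ s.ρ s.T) (lnF b B₀ ζ pt ψ γ X κ) (fun i j => ust (lnF b B₀ ζ pt ψ γ X κ i j) ρ' 0) ≤
      2 * (SS m Q₀ s.ρ s.T).card * (EN b B₀ W₀ ζ pt ψ γ H s.ρ - EN b B₀ W₀ ζ pt ψ γ H ρ' + 
        2 * (1 / N) * (n + 1) ^ 2 * (Hb (n + 1) H).card * Fintype.card (Fin (n + 1) → Fin W₀ → ZMod 2)) := by
  have hN' : (0 : ℝ) < N := by exact_mod_cast hN
  rw [sum_comm]
  have h7' : 7 * ((A * c0 : ℕ) : ℝ) ^ 2 * ρ' ≤ 1 / N * H := by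
    rw [div_mul_eq_mul_div, one_mul, le_div_iff₀ hN']
    have : (N : ℝ) * (7 * ((A * c0 : ℕ) : ℝ) ^ 2 * ρ') ≤ H := by exact_mod_cast h7
    linarith
  have key : ∀ X : Fin (n + 1) → Fin W₀ → ZMod 2, ∀ i j, ∀ s' ∈ SS m Q₀ s.ρ s.T, ∀ σ : Bool,
    ∑ κ ∈ Hb (n + 1) H, (slp (lnF b B₀ ζ pt ψ γ X κ i j) s' (off σ s') - ust (lnF b B₀ ζ pt ψ γ X κ i j) ρ' 0) ^ 2 ≤
      ∑ κ ∈ Hb (n + 1) H, slp (lnF b B₀ ζ pt ψ γ X κ i j) s.ρ 0 ^ 2 - 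
      ∑ κ ∈ Hb (n + 1) H, slp (lnF b B₀ ζ pt ψ γ X κ i j) ρ' 0 ^ 2 + 2 * (1 / N) * (Hb (n + 1) H).card := by
    intro X i j s' hs' σ
    have : ∃ v, 0 < v ∧ s' = v * s.ρ ∧ s' ≤ ρ' ∧ N * (4 * (A * c0) ^ 2 * s') ≤ ρ' := by
      unfold SS at hs'
      rw [mem_insert] at hs'
      rcases hs' with rfl | hs'
      · obtain ⟨v, hv⟩ := P.hTρ
        refine ⟨v, ?_, by rw [hv, mul_comm], P.hT', P.e1⟩
        rcases Nat.eq_zero_or_pos v with rfl | h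
        · have := P.hT; simp at hv; omega
        · exact h
      · simp only [mem_image, mem_product, mem_range, mem_Ico, Prod.exists] at hs'
        obtain ⟨k, Q', ⟨h1, h2, h3⟩, rfl⟩ := hs'
        have le : 2 ^ k * Q' * s.ρ ≤ 2 ^ m * (2 * Q₀) * s.ρ := by
          refine Nat.mul_le_mul_right _ (Nat.mul_le_mul (Nat.pow_le_pow_right (by norm_num) (by omega)) h3.le)
        refine ⟨2 ^ k * Q', Nat.mul_pos (by positivity) (by omega), rfl, le.trans P.hm', le_trans ?_ P.e2⟩
        gcongr
    obtain ⟨v, v1, v2, v3, v4⟩ := this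
    refine kap S γ X i j s.ρ v s' ρ' H hH P.hρ v1 v2 v3 σ (1 / N) h7' ?_
    rw [div_mul_eq_mul_div, one_mul, le_div_iff₀ hN']
    have : (N : ℝ) * (4 * ((A * c0 : ℕ) : ℝ) ^ 2 * s') ≤ ρ' := by exact_mod_cast v4
    linarith
  have step : ∀ X : Fin (n + 1) → Fin W₀ → ZMod 2, ∑ κ ∈ Hb (n + 1) H,
        dev (SS m Q₀ s.ρ s.T) (lnF b B₀ ζ pt ψ γ X κ) (fun i j => ust (lnF b B₀ ζ pt ψ γ X κ i j) ρ' 0) ≤ 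
      ∑ i, ∑ j, ∑ s' ∈ SS m Q₀ s.ρ s.T, ∑ σ : Bool, 
       (∑ κ ∈ Hb (n + 1) H, slp (lnF b B₀ ζ pt ψ γ X κ i j) s.ρ 0 ^ 2 - 
      ∑ κ ∈ Hb (n + 1) H, slp (lnF b B₀ ζ pt ψ γ X κ i j) ρ' 0 ^ 2 + 2 * (1 / N) * (Hb (n + 1) H).card) := by
    intro X
    unfold dev
    rw [sum_comm]
    refine sum_le_sum fun i _ => ?_
    rw [sum_comm]
    refine sum_le_sum fun j _ => ?_
    rw [sum_comm]
    refine sum_le_sum fun s' hs' => ?_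
    rw [sum_comm]
    exact sum_le_sum fun σ _ => key X i j s' hs' σ
  refine (sum_le_sum fun X _ => step X).trans (le_of_eq ?_)
  unfold EN
  simp only [sum_const, card_univ, nsmul_eq_mul, Fintype.card_bool, sum_add_distrib, sum_sub_distrib, ← mul_sum,
    Fintype.card_fin]
  push_cast; ring
end st
end NR


namespace NR
open Finset
set_option linter.unusedSectionVars false
set_option linter.unusedVariables false

section st
variable {n : ℕ} {Γ : Type*} [Group Γ] {b : ℕ} {ζ : Γ → Fin (n + 1) → ℤ}
  {ξ : Γ → Fin (n + 1) → ℝ} {dd : Γ → Γ → ℕ} {A : ℕ} {W₀ B₀ : ℕ}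
  {pt : (Fin (n + 1) → ℤ) → (Fin (n + 1) → ℤ) → Γ}

noncomputable def tile (b : ℕ) (ζ : Γ → Fin (n + 1) → ℤ) (ξ : Γ → Fin (n + 1) → ℝ) (q : Γ) : Tl n :=
  ⟨fun k => ζ q k.castSucc, ix b ζ ξ q⟩

lemma tile_ht (hsum : ∀ q, ∑ j, ζ q j = 0) (q : Γ) : ht (tile b ζ ξ q).1 = ζ q := by
  funext j
  unfold tile
  induction j using Fin.lastCases with
  | last =>
    have := hsum q
    rw [Fin.sum_univ_castSucc] at this
    simp only [ht_last]; omega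
  | cast k => simp

/-- total function at a tile -/
noncomputable def Hk (b : ℕ) (s : ℕ → Scl) (Q : ∀ k, LabT b (s k).μ → LabT b (s k).μ → Bool) (k : ℕ) (τ : Tl n) : ℝ :=
  tH b (fun k => (s k).P) (fun k => (s k).r) (fun k => (s k).μ) Q k (ht τ.1) τ.2

open Classical in
noncomputable def NBk (b : ℕ) (s : Scl) (j : Fin (n + 1)) (τ : Tl n) : ℝ :=
  if nbc b s.P s.r s.w2 ((b : ℤ) ^ s.w3 + 1) (ht τ.1 j) (τ.2 j) then 1 else 0

lemma NBk_abs (s : Scl) (j : Fin (n + 1)) (τ : Tl n) : |NBk b s j τ| ≤ 1 ∧ 0 ≤ NBk b s j τ := by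
  unfold NBk; split_ifs <;> simp

noncomputable def Cst (n A c0 q Q₀ m : ℕ) : ℝ :=
  80 * q ^ 2 * ((m + 1) * Q₀ + 1 : ℕ) * (50 * (2 * ((m + 1) * Q₀ + 1 : ℕ) * (((A * c0 : ℕ) : ℝ) ^ 2 * (n + 1) ^ 2 + 2 * (n + 1) ^ 2)) +
    48 * (n + 1) ^ 2) + 1

open Classical in
theorem sumk {K c0 : ℕ} {ψ : Γ → Γ} (S : Std b ζ ξ dd A pt K c0 ψ) (hsum : ∀ q, ∑ j, ζ q j = 0) 
    {N Q₀ q m : ℕ} (hN : 0 < N) (hQ₀ : 0 < Q₀)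
    (hQq : 4 * (A * c0) * q ≤ Q₀) {s : ℕ → Scl}
    (P : ∀ k < N, Stp A c0 b N Q₀ q m (s k) (s (k + 1)).ρ) {Q : ∀ k, LabT b (s k).μ → LabT b (s k).μ → Bool} 
    (hQ : ∀ k < N, QGood A b N (s k) (Q k))
    (γ : Γ) (H : ℕ) (hH : 0 < H) (hκ : ∀ κ ∈ Hb (n + 1) H, ∀ k < N, ∀ l, -(B₀ : ℤ) ≤ Zc κ l ∧ Zc κ l + (s k).L ≤ (W₀ : ℤ) - B₀)
    (h7 : ∀ k < N, N * (7 * (A * c0) ^ 2 * (s (k + 1)).ρ) ≤ H) :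
    ∑ k ∈ range N, ∑ κ ∈ Hb (n + 1) H, 
      |∑ X : Fin (n + 1) → Fin W₀ → ZMod 2, Hk b s Q k (tile b ζ ξ (ψ (γ * lam b B₀ pt X κ)))| ≤
    Cst n A c0 q Q₀ m * ((Hb (n + 1) H).card * Fintype.card (Fin (n + 1) → Fin W₀ → ZMod 2)) +
    2 * ∑ k ∈ range N, ∑ κ ∈ Hb (n + 1) H, ∑ X : Fin (n + 1) → Fin W₀ → ZMod 2, NBk b (s k) 0 (tile b ζ ξ (ψ (γ * lam b B₀ pt X κ))) +
    2 * ∑ k ∈ range N, ∑ κ ∈ Hb (n + 1) H, ∑ X : Fin (n + 1) → Fin W₀ → ZMod 2, 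
      NBk b (s k) (Fin.last n) (tile b ζ ξ (ψ (γ * lam b B₀ pt X κ))) := by
  have hN' : (0 : ℝ) < N := by exact_mod_cast hN
  set cX : ℝ := ((Fintype.card (Fin (n + 1) → Fin W₀ → ZMod 2) : ℕ) : ℝ) with hcX
  set cH : ℝ := (((Hb (n + 1) H).card : ℕ) : ℝ) with hcH
  set M : ℝ := (((m + 1) * Q₀ + 1 : ℕ) : ℝ) with hM
  set en : ℕ → ℝ := fun k => EN b B₀ W₀ ζ pt ψ γ H (s k).ρ with hen
  have hM0 : 0 ≤ M := by positivity
  have hcX0 : 0 ≤ cX := by positivity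
  have hcH0 : 0 ≤ cH := by positivity
  have one : ∀ k < N, ∑ κ ∈ Hb (n + 1) H, 
      |∑ X : Fin (n + 1) → Fin W₀ → ZMod 2, Hk b s Q k (tile b ζ ξ (ψ (γ * lam b B₀ pt X κ)))| ≤
      80 * q ^ 2 * M * (50 * (2 * M * (en k - en (k + 1) + 2 * (1 / N) * (n + 1) ^ 2 * cH * cX)) + 
        48 * (n + 1) ^ 2 * (1 / N) * cX * cH) + 
      2 * ∑ κ ∈ Hb (n + 1) H, ∑ X : Fin (n + 1) → Fin W₀ → ZMod 2, NBk b (s k) 0 (tile b ζ ξ (ψ (γ * lam b B₀ pt X κ))) +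
      2 * ∑ κ ∈ Hb (n + 1) H, ∑ X : Fin (n + 1) → Fin W₀ → ZMod 2, 
        NBk b (s k) (Fin.last n) (tile b ζ ξ (ψ (γ * lam b B₀ pt X κ))) + 1 / N * cX * cH := by
    intro k hk
    have st := fun κ (hh : κ ∈ Hb (n + 1) H) => step1 S hN hQ₀ hQq (P k hk) (hQ k hk) γ κ (hκ κ hh k hk)
    have ds := dev_sum (B₀ := B₀) (W₀ := W₀) S hN hQ₀ (P k hk) γ H hH (h7 k hk)
    set DV : (Fin (n + 1) → ℤ) → ℝ := fun κ => ∑ X : Fin (n + 1) → Fin W₀ → ZMod 2, 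
        dev (SS m Q₀ (s k).ρ (s k).T) (lnF b B₀ ζ pt ψ γ X κ) (fun i j => ust (lnF b B₀ ζ pt ψ γ X κ i j) (s (k + 1)).ρ 0) with hDV
    set sc : ℝ := (((SS m Q₀ (s k).ρ (s k).T).card : ℕ) : ℝ) with hsc
    have hsc1 : 0 < sc := by
      rw [hsc]; exact_mod_cast card_pos.2 ⟨(s k).T, by unfold SS; exact mem_insert_self _ _⟩
    have hscM : sc ≤ M := by rw [hsc, hM]; exact_mod_cast SS_card m Q₀ (s k).ρ (s k).T
    have hDV0 : 0 ≤ ∑ κ ∈ Hb (n + 1) H, DV κ := by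
      rw [hDV]; unfold dev; positivity
    set Δ := en k - en (k + 1) + 2 * (1 / N) * (n + 1) ^ 2 * cH * cX with hΔ
    have ds' : ∑ κ ∈ Hb (n + 1) H, DV κ ≤ 2 * sc * Δ := ds
    have hΔ0 : 0 ≤ Δ := by
      by_contra hneg
      push Not at hneg
      have : 2 * sc * Δ < 0 := mul_neg_of_pos_of_neg (by linarith) hneg
      linarith
    have ds2 : ∑ κ ∈ Hb (n + 1) H, DV κ ≤ 2 * M * Δ := ds'.trans (by gcongr)
    have hNB : ∀ q j, (if nbc b (s k).P (s k).r (s k).w2 ((b : ℤ) ^ (s k).w3 + 1) (ζ q j) (ix b ζ ξ q j) then (1 : ℝ) else 0) =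
        NBk b (s k) j (tile b ζ ξ q) := by
      intro q j
      unfold NBk
      rw [tile_ht hsum]
      rfl
    have st2 : ∀ κ ∈ Hb (n + 1) H, |∑ X : Fin (n + 1) → Fin W₀ → ZMod 2, Hk b s Q k (tile b ζ ξ (ψ (γ * lam b B₀ pt X κ)))| ≤
        80 * q ^ 2 * sc * (50 * DV κ + 48 * (n + 1) ^ 2 * (1 / N) * cX) +
        2 * ∑ X : Fin (n + 1) → Fin W₀ → ZMod 2, NBk b (s k) 0 (tile b ζ ξ (ψ (γ * lam b B₀ pt X κ))) +
        2 * ∑ X : Fin (n + 1) → Fin W₀ → ZMod 2, NBk b (s k) (Fin.last n) (tile b ζ ξ (ψ (γ * lam b B₀ pt X κ))) +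
        1 / N * cX := by
      intro κ hh
      have := st κ hh
      simp only [hNB] at this
      simp only [Hk, tH, tile_ht hsum]
      exact this
    refine (sum_le_sum st2).trans ?_
    have e2 : ∀ (f g h : (Fin (n + 1) → ℤ) → ℝ) (u v w : ℝ), ∑ κ ∈ Hb (n + 1) H, (u * (50 * f κ + v) + 2 * g κ + 2 * h κ + w) =
        u * (50 * ∑ κ ∈ Hb (n + 1) H, f κ + cH * v) + 2 * ∑ κ ∈ Hb (n + 1) H, g κ + 2 * ∑ κ ∈ Hb (n + 1) H, h κ + cH * w := by
      intro f g h u v w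
      simp only [sum_add_distrib, ← mul_sum, sum_const, nsmul_eq_mul, hcH]
    rw [e2]
    have : 80 * (q : ℝ) ^ 2 * sc * (50 * ∑ κ ∈ Hb (n + 1) H, DV κ + cH * (48 * (n + 1) ^ 2 * (1 / N) * cX)) ≤ 
       80 * q ^ 2 * M * (50 * (2 * M * Δ) + 48 * (n + 1) ^ 2 * (1 / N) * cX * cH) := by
      refine mul_le_mul (by gcongr) (by nlinarith) (by positivity) (by positivity)
    have e1 : cH * (1 / (N : ℝ) * cX) = 1 / N * cX * cH := by ring
    refine add_le_add (add_le_add (add_le_add this (le_of_eq rfl)) (le_of_eq rfl)) (le_of_eq e1)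
  refine (sum_le_sum fun k hk => one k (mem_range.1 hk)).trans ?_
  simp only [sum_add_distrib, ← mul_sum, sum_const, nsmul_eq_mul, card_range]
  rw [sum_range_sub']
  have e0 : en 0 - en N ≤ ((A * c0 : ℕ) : ℝ) ^ 2 * (n + 1) ^ 2 * cH * cX := by
    have h1 := EN_le (B₀ := B₀) (W₀ := W₀) S γ H (s 0).ρ
    have h2 := EN_nonneg (b := b) (B₀ := B₀) (W₀ := W₀) (ζ := ζ) (pt := pt) ψ γ H (s N).ρ
    simp only [hen]; linarith
  have e1 : 80 * (q : ℝ) ^ 2 * M * (50 * (2 * M * (en 0 - en N + N * (2 * (1 / N) * (n + 1) ^ 2 * cH * cX))) + 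
       N * (48 * (n + 1) ^ 2 * (1 / N) * cX * cH)) + N * (1 / N * cX * cH) ≤ Cst n A c0 q Q₀ m * (cH * cX) := by
    have r1 : (N : ℝ) * (2 * (1 / N) * (n + 1) ^ 2 * cH * cX) = 2 * (n + 1) ^ 2 * cH * cX := by field_simp
    have r2 : (N : ℝ) * (48 * (n + 1) ^ 2 * (1 / N) * cX * cH) = 48 * (n + 1) ^ 2 * cX * cH := by field_simp
    have r3 : (N : ℝ) * (1 / N * cX * cH) = cX * cH := by field_simp
    rw [r1, r2, r3]
    unfold Cst
    rw [← hM]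
    have : 80 * (q : ℝ) ^ 2 * M * (50 * (2 * M * (en 0 - en N + 2 * (n + 1) ^ 2 * cH * cX)) + 
       48 * (n + 1) ^ 2 * cX * cH) ≤ 80 * (q : ℝ) ^ 2 * M * (50 * (2 * M * (((A * c0 : ℕ) : ℝ) ^ 2 * (n + 1) ^ 2 * cH * cX + 2 * (n + 1) ^ 2 * cH * cX)) + 
       48 * (n + 1) ^ 2 * cX * cH) := by gcongr
    refine (add_le_add this le_rfl).trans (le_of_eq ?_)
    ring
  linarith
end st
end NR


namespace NR
open Finset
set_option linter.unusedSectionVars false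
set_option linter.unusedVariables false

open Classical in
lemma shift_sum {Γ : Type*} [Group Γ] (E : Finset Γ) (l : Γ) (f : Γ → ℝ) (hf : ∀ x, |f x| ≤ 1) :
    |∑ x ∈ E, f (x * l) - ∑ x ∈ E, f x| ≤ 2 * (E.filter fun x => x * l⁻¹ ∉ E).card := by
  set E' := E.map (mulRightEmbedding l) with hE'
  have h1 : ∑ x ∈ E, f (x * l) = ∑ y ∈ E', f y := by rw [hE', sum_map]; rfl
  have hc : E'.card = E.card := card_map _
  have h2 : E.filter (fun x => x * l⁻¹ ∉ E) = E \ E' := by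
    ext x
    simp only [mem_filter, mem_sdiff, hE', mem_map, mulRightEmbedding_apply, not_exists, not_and]
    refine and_congr_right fun _ => ⟨fun h y hy e => h ?_, fun h hx => h _ hx (by group)⟩
    rw [← e]; simpa using hy
  have h3 : (E' \ E).card = (E \ E').card := by
    have := card_sdiff_add_card_inter E' E
    have := card_sdiff_add_card_inter E E'
    rw [inter_comm] at this
    omega
  rw [h1, h2, ← sum_sdiff_sub_sum_sdiff]
  have bd : ∀ F : Finset Γ, |∑ x ∈ F, f x| ≤ F.card := fun F =>
    (abs_sum_le_sum_abs _ _).trans ((sum_le_sum fun x _ => hf x).trans (by simp))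
  refine (abs_sub _ _).trans ?_
  have := bd (E' \ E)
  have := bd (E \ E')
  rw [h3] at *
  linarith

open Classical in
lemma abs_avg {Γ : Type*} [Group Γ] {I X : Type*} [Fintype X] (E : Finset Γ) (J : Finset I) (l : X → I → Γ) (N : ℕ)
    (h nb0 nb1 : ℕ → Γ → ℝ) (C B bE : ℝ) (hbE : ∀ x, ∀ κ ∈ J, ((E.filter fun y => y * (l x κ)⁻¹ ∉ E).card : ℝ) ≤ bE)
    (hh : ∀ k y, |h k y| ≤ 1) (h0 : ∀ k y, |nb0 k y| ≤ 1) (h1 : ∀ k y, |nb1 k y| ≤ 1)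
    (main : ∀ γ, ∑ k ∈ range N, ∑ κ ∈ J, |∑ x : X, h k (γ * l x κ)| ≤ C * (J.card * Fintype.card X) +
      2 * ∑ k ∈ range N, ∑ κ ∈ J, ∑ x : X, nb0 k (γ * l x κ) + 2 * ∑ k ∈ range N, ∑ κ ∈ J, ∑ x : X, nb1 k (γ * l x κ))
    (b0 : ∀ k < N, ∑ x ∈ E, nb0 k x ≤ B) (b1 : ∀ k < N, ∑ x ∈ E, nb1 k x ≤ B) (hJ : 0 < J.card) (hX : 0 < Fintype.card X) :
    ∑ x ∈ E, ∑ k ∈ range N, h k x ≤ E.card * C + 4 * N * B + 10 * N * bE := by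
  set cJ : ℝ := ((J.card : ℕ) : ℝ) with hcJ
  set cX : ℝ := ((Fintype.card X : ℕ) : ℝ) with hcX
  have hJ' : 0 < cJ := by rw [hcJ]; exact_mod_cast hJ
  have hX' : 0 < cX := by rw [hcX]; exact_mod_cast hX
  have sw : ∀ f : ℕ → Γ → ℝ, ∑ γ ∈ E, ∑ k ∈ range N, ∑ κ ∈ J, ∑ x : X, f k (γ * l x κ) =
      ∑ k ∈ range N, ∑ κ ∈ J, ∑ x : X, ∑ γ ∈ E, f k (γ * l x κ) := by
    intro f
    rw [sum_comm]; refine sum_congr rfl fun k _ => ?_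
    rw [sum_comm]; refine sum_congr rfl fun κ _ => ?_
    rw [sum_comm]
  have cst : ∀ u : ℕ → ℝ, ∑ k ∈ range N, ∑ κ ∈ J, ∑ x : X, u k = (∑ k ∈ range N, u k) * (cJ * cX) := by
    intro u
    simp only [sum_const, nsmul_eq_mul, sum_mul, card_univ, ← hcJ, ← hcX]
    exact sum_congr rfl fun k _ => by ring
  have sh : ∀ f : ℕ → Γ → ℝ, (∀ k y, |f k y| ≤ 1) → ∀ k x, ∀ κ ∈ J, |∑ y ∈ E, f k (y * l x κ) - ∑ y ∈ E, f k y| ≤ 2 * bE := by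
    intro f hf k x κ hκ
    exact (shift_sum E (l x κ) (f k) (hf k)).trans (by linarith [hbE x κ hκ])
  have tot := sum_le_sum (s := E) fun γ _ => main γ
  simp only [sum_add_distrib, ← mul_sum, sw, sum_const, nsmul_eq_mul] at tot
  have up : ∀ f : ℕ → Γ → ℝ, (∀ k y, |f k y| ≤ 1) → (∀ k < N, ∑ x ∈ E, f k x ≤ B) → 
     ∑ k ∈ range N, ∑ κ ∈ J, ∑ x : X, ∑ γ ∈ E, f k (γ * l x κ) ≤ N * (B + 2 * bE) * (cJ * cX) := by
    intro f hf hB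
    have : ∑ k ∈ range N, ∑ κ ∈ J, ∑ x : X, ∑ γ ∈ E, f k (γ * l x κ) ≤ ∑ k ∈ range N, ∑ κ ∈ J, ∑ x : X, (B + 2 * bE) := by
      refine sum_le_sum fun k hk => sum_le_sum fun κ hκ => sum_le_sum fun x _ => ?_
      have := abs_le.1 (sh f hf k x κ hκ)
      have := hB k (mem_range.1 hk)
      linarith
    refine this.trans (le_of_eq ?_)
    rw [cst, sum_const, card_range, nsmul_eq_mul]
  have u0 := up nb0 h0 b0
  have u1 := up nb1 h1 b1
  have low : (∑ x ∈ E, ∑ k ∈ range N, h k x - N * (2 * bE)) * (cJ * cX) ≤ ∑ γ ∈ E, ∑ k ∈ range N, ∑ κ ∈ J, |∑ x : X, h k (γ * l x κ)| := by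
    have g1 : ∑ γ ∈ E, ∑ k ∈ range N, ∑ κ ∈ J, ∑ x : X, h k (γ * l x κ) ≤ ∑ γ ∈ E, ∑ k ∈ range N, ∑ κ ∈ J, |∑ x : X, h k (γ * l x κ)| :=
      sum_le_sum fun k hk => sum_le_sum fun κ hκ => sum_le_sum fun x _ => le_abs_self _
    refine le_trans ?_ g1
    rw [sw]
    have : ∑ k ∈ range N, ∑ κ ∈ J, ∑ x : X, (∑ y ∈ E, h k y - 2 * bE) ≤ ∑ k ∈ range N, ∑ κ ∈ J, ∑ x : X, ∑ γ ∈ E, h k (γ * l x κ) := by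
      refine sum_le_sum fun k hk => sum_le_sum fun κ hκ => sum_le_sum fun x _ => ?_
      have := abs_le.1 (sh h hh k x κ hκ)
      linarith
    refine le_trans (le_of_eq ?_) this
    rw [cst, sum_comm]; simp
  have fin : (∑ x ∈ E, ∑ k ∈ range N, h k x - N * (2 * bE)) * (cJ * cX) ≤ (E.card * C + 4 * N * B + 8 * N * bE) * (cJ * cX) := by
    linarith
  have := le_of_mul_le_mul_right fin (by positivity)
  linarith

/-- sums over a finset with fibres of size one or three -/
lemma fib_sum {Γ Y : Type*} [DecidableEq Y] (E : Finset Γ) (T : Finset Y) (t : Γ → Y) (hE : ∀ x ∈ E, t x ∈ T) (u : Y → ℕ)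
    (hc : ∀ y ∈ T, (E.filter fun x => t x = y).card = u y) (f : Y → ℝ) : ∑ x ∈ E, f (t x) = ∑ y ∈ T, u y * f y := by
  rw [← sum_fiberwise_of_maps_to hE]
  refine sum_congr rfl fun y hy => ?_
  rw [sum_congr rfl (g := fun _ => f y) fun x hx => by rw [(mem_filter.1 hx).2]]
  simp [hc y hy]

lemma mem_TB {n : ℕ} {Γ : Type*} [Group Γ] {b : ℕ} {ζ : Γ → Fin (n + 1) → ℤ}
    {ξ : Γ → Fin (n + 1) → ℝ} (hb : 2 ≤ b) (hsum : ∀ q, ∑ j, ζ q j = 0) 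
    {H c : ℕ} (hHc : H ≤ c) (q : Γ) : tile b ζ ξ q ∈ TB n b H c ↔ 
      (∀ k : Fin n, 0 ≤ ζ q k.castSucc ∧ ζ q k.castSucc < H) ∧ ∀ j, ⌊ξ q j / (b : ℝ) ^ (c : ℤ)⌋ = if j = 0 then 1 else 0 := by
  unfold TB
  rw [mem_sigma]
  have e1 : (tile b ζ ξ q).1 ∈ Hb n H ↔ ∀ k : Fin n, 0 ≤ ζ q k.castSucc ∧ ζ q k.castSucc < H := by
    unfold Hb; simp [tile]
  rw [← e1]
  refine and_congr_right fun hh => ?_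
  unfold Ib
  rw [Fintype.mem_piFinset]
  refine forall_congr' fun j => ?_
  have hle := Hb_le hh j
  unfold lo
  rw [tile_ht hsum] at hle ⊢
  have he : (0 : ℤ) < Eb b c (ζ q j) := by unfold Eb; positivity
  have fl := floor_lvl hb (ξ q j) (ζ q j) (c - ζ q j).toNat
  rw [show ζ q j + ((c - ζ q j).toNat : ℤ) = c by omega] at fl
  rw [← fl]
  change ix b ζ ξ q j ∈ _ ↔ (ix b ζ ξ q j) / Eb b c (ζ q j) = _
  rw [mem_Ico]
  generalize Eb b c (ζ q j) = e at *
  generalize ix b ζ ξ q j = i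
  split_ifs
  · constructor
    · rintro ⟨h1, h2⟩
      have := (Int.le_ediv_iff_mul_le he (a := 1) (b := i)).2 (by linarith)
      have := (Int.ediv_lt_iff_lt_mul he (a := i) (b := 2)).2 (by linarith)
      omega
    · intro h
      have := (Int.le_ediv_iff_mul_le he (a := 1) (b := i)).1 (by linarith)
      have := (Int.ediv_lt_iff_lt_mul he (a := i) (b := 2)).1 (by linarith)
      constructor <;> linarith
  · constructor
    · rintro ⟨h1, h2⟩
      have := (Int.le_ediv_iff_mul_le he (a := 0) (b := i)).2 (by linarith)
      have := (Int.ediv_lt_iff_lt_mul he (a := i) (b := 1)).2 (by linarith)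
      omega
    · intro h
      have := (Int.le_ediv_iff_mul_le he (a := 0) (b := i)).1 (by linarith)
      have := (Int.ediv_lt_iff_lt_mul he (a := i) (b := 1)).1 (by linarith)
      constructor <;> linarith

/-- leaving the big box only happens from bad tiles -/
lemma bad_of {n : ℕ} {Γ : Type*} [Group Γ] {b : ℕ} {ζ : Γ → Fin (n + 1) → ℤ}
    {ξ : Γ → Fin (n + 1) → ℝ} {dd : Γ → Γ → ℕ} {A : ℕ} (G : GM b ζ ξ dd A) (hb : 2 ≤ b) (hsum : ∀ q, ∑ j, ζ q j = 0) 
    (H c R : ℕ) (hHc : H ≤ c) {p q : Γ} (hp : tile b ζ ξ p ∈ TB n b H c) (hd : dd p q ≤ R) (hq : tile b ζ ξ q ∉ TB n b H c) :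
    bad b H c (A * R) (tile b ζ ξ p) := by
  by_contra hnb
  apply hq
  unfold bad at hnb
  push Not at hnb
  obtain ⟨hn1, hn2⟩ := hnb
  have hh : (tile b ζ ξ p).1 ∈ Hb n H := by unfold TB at hp; exact (mem_sigma.1 hp).1
  have hle := fun j => Hb_le hh j
  rw [tile_ht hsum] at hn1 hn2 hle
  rw [mem_TB hb hsum hHc] at hp ⊢
  obtain ⟨hp1, hp2⟩ := hp
  have hAR : A * dd p q ≤ A * R := by gcongr
  refine ⟨fun k => ?_, fun j => ?_⟩
  · have h1 := abs_le.1 (G.m1z p q k.castSucc)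
    have h2 := hn1 k
    have h3 := hp1 k
    unfold nearB at h2
    rw [Int.emod_eq_of_lt h3.1 h3.2] at h2
    push Not at h2
    omega
  · rw [← hp2 j]
    have := cell_stable hb (ξ p j) (ξ q j) (ζ p j) (c - ζ p j).toNat (A * R) (hn2 j) 
      ((G.m1x p q j).trans (zpow_mono hb (by omega)))
    rwa [show ζ p j + ((c - ζ p j).toNat : ℤ) = c by have := hle j; omega] at this
end NR


namespace NR
open Finset
set_option linter.unusedSectionVars false
set_option linter.unusedVariables false

section st
variable {n : ℕ} {Γ : Type*} [Group Γ] {b : ℕ} {ζ : Γ → Fin (n + 1) → ℤ}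
  {ξ : Γ → Fin (n + 1) → ℝ} {dd : Γ → Γ → ℕ} {A : ℕ} {W₀ B₀ : ℕ}
  {pt : (Fin (n + 1) → ℤ) → (Fin (n + 1) → ℤ) → Γ}

lemma sc_of {A c0 N Q₀ q m : ℕ} (hb : 2 ≤ b) (ev : Even b) {s : ℕ → Scl} (P : ∀ k, Stp A c0 b N Q₀ q m (s k) (s (k + 1)).ρ) :
    Sc b N (fun k => (s k).P) (fun k => (s k).r) (fun k => (s k).μ) := by
  refine ⟨ev, hb, fun k => (P k).hP, ?_⟩
  have mono : Monotone fun k => (s k).r := monotone_nat_of_le_succ fun k => by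
    have := (P k).hr'
    have := (P (k + 1)).hrρ
    omega
  intro k' k h _
  have h1 := (P k').hr'
  have h2 := (P (k' + 1)).hrρ
  have h3 : (s (k' + 1)).r ≤ (s k).r := mono h
  omega

open Classical in
theorem no_map {K c0 : ℕ} {ψ : Γ → Γ} (S : Std b ζ ξ dd A pt K c0 ψ) (hsum : ∀ q, ∑ j, ζ q j = 0) (ev : Even b)
    {N Q₀ q m m' : ℕ} (hm' : 0 < m') (hN : N = m' ^ 2) (hQ₀ : 0 < Q₀)
    (hQq : 4 * (A * c0) * q ≤ Q₀) {s : ℕ → Scl}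
    (P : ∀ k, Stp A c0 b N Q₀ q m (s k) (s (k + 1)).ρ) {Q : ∀ k, LabT b (s k).μ → LabT b (s k).μ → Bool} 
    (hQ : ∀ k < N, QGood A b N (s k) (Q k))
    (H : ℕ) (hH : 0 < H) (hκ : ∀ κ ∈ Hb (n + 1) H, ∀ k < N, ∀ l, -(B₀ : ℤ) ≤ Zc κ l ∧ Zc κ l + (s k).L ≤ (W₀ : ℤ) - B₀)
    (h7 : ∀ k < N, N * (7 * (A * c0) ^ 2 * (s (k + 1)).ρ) ≤ H) (R : ℕ) 
    (hR : ∀ X : Fin (n + 1) → Fin W₀ → ZMod 2, ∀ κ ∈ Hb (n + 1) H, dd 1 (lam b B₀ pt X κ) ≤ R)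
    (Hh c : ℕ) (hHh : 0 < Hh) (hPH : ∀ k < N, (s k).P ∣ Hh) (hc : ∀ k < N, Hh + (s k).P + (s k).r + 1 ≤ c) 
    (hβ : n * (2 * (A * (K * R) : ℕ) / Hh : ℝ) + (n + 1) * (2 * ((b : ℝ) ^ (A * (K * R)) + 1) / (b : ℝ) ^ (c - Hh)) ≤ 1 / N)
    (hfib : ∀ τ ∈ TB n b Hh c, {x | tile b ζ ξ (ψ x) = τ}.ncard = if 0 ≤ ∑ k ∈ range N, Hk b s Q k τ then 3 else 1) :
    (m' / 4 : ℝ) ≤ 3 * Cst n A c0 q Q₀ m + 54 := by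
  have hb := S.hb
  have hN0 : 0 < N := by rw [hN]; positivity
  have hN' : (0 : ℝ) < N := by exact_mod_cast hN0
  have hHc : Hh ≤ c := by have := hc 0 hN0; omega
  set T := TB n b Hh c with hT
  set cT : ℝ := ((T.card : ℕ) : ℝ) with hcT
  have hcT0 : 0 < cT := by rw [hcT]; exact_mod_cast TB_pos hb hHh hHc
  set t : Γ → Tl n := fun x => tile b ζ ξ (ψ x) with ht'
  set Sg : Tl n → ℝ := fun τ => ∑ k ∈ range N, Hk b s Q k τ with hSg
  have fin : {x | t x ∈ T}.Finite := by
    have : {x | t x ∈ T} = ⋃ τ ∈ T, {x | t x = τ} := by ext x; simp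
    rw [this]
    refine Set.Finite.biUnion T.finite_toSet fun τ hτ => Set.finite_of_ncard_ne_zero ?_
    have := hfib τ hτ
    simp only [ht']
    rw [this]; split_ifs <;> norm_num
  set E := fin.toFinset with hE
  have memE : ∀ x, x ∈ E ↔ t x ∈ T := by intro x; simp [hE]
  set u : Tl n → ℕ := fun τ => if 0 ≤ Sg τ then 3 else 1 with hu
  have hfc : ∀ τ ∈ T, (E.filter fun x => t x = τ).card = u τ := by
    intro τ hτ
    have := hfib τ hτ
    rw [← Set.ncard_coe_finset]
    rw [show ((E.filter fun x => t x = τ : Finset Γ) : Set Γ) = {x | tile b ζ ξ (ψ x) = τ} by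
      ext x
      simp only [coe_filter, memE, Set.mem_ofPred_eq]
      exact ⟨fun h => h.2, fun h => ⟨by rw [show t x = τ from h]; exact hτ, h⟩⟩]
    exact this
  have fs := fib_sum E T t (fun x hx => (memE x).1 hx) u hfc
  have hu3 : ∀ τ, (u τ : ℝ) ≤ 3 := by intro τ; simp only [hu]; split_ifs <;> norm_num
  have le3 : ∀ f : Tl n → ℝ, (∀ τ, 0 ≤ f τ) → ∑ x ∈ E, f (t x) ≤ 3 * ∑ τ ∈ T, f τ := by
    intro f hf
    rw [fs, mul_sum]
    exact sum_le_sum fun τ _ => mul_le_mul_of_nonneg_right (hu3 τ) (hf τ)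
  have cardE : (E.card : ℝ) ≤ 3 * cT := by
    have := le3 (fun _ => 1) (fun _ => zero_le_one)
    simpa using this
  obtain ⟨p1, p2⟩ := P1 (Q := Q) (n := n) S.hn (sc_of hb ev P) m' hm' hN hc
  have low : (m' / 4 : ℝ) * cT ≤ ∑ x ∈ E, ∑ k ∈ range N, Hk b s Q k (t x) := by
    have e := fs Sg
    have : ∀ τ ∈ T, (u τ : ℝ) * Sg τ = 2 * Sg τ + |Sg τ| := by
      intro τ _
      simp only [hu]
      split_ifs with h
      · rw [abs_of_nonneg h]; push_cast; ring
      · rw [abs_of_neg (not_le.1 h)]; push_cast; ring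
    rw [sum_congr rfl this, sum_add_distrib, ← mul_sum] at e
    change _ = 2 * ∑ τ ∈ TB n b Hh c, ∑ k ∈ range N, tH b (fun k => (s k).P) (fun k => (s k).r) (fun k => (s k).μ) Q k (ht τ.1) τ.2 + _ at e
    rw [p1, mul_zero, zero_add] at e
    change _ ≤ ∑ x ∈ E, Sg (t x)
    rw [e]
    exact p2
  have nbB : ∀ k < N, ∀ j, ∑ x ∈ E, NBk b (s k) j (t x) ≤ 6 / N * cT := by
    intro k hk j
    refine (le3 (NBk b (s k) j) fun τ => (NBk_abs _ _ _).2).trans ?_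
    have h2 := P2 (n := n) S.hn hb j (s k).P (s k).r (s k).w2 (P k).hP (hPH k hk) 
      (by have := hc k hk; omega : Hh + (s k).P + (s k).r ≤ c) ((b : ℤ) ^ (s k).w3 + 1) (by positivity)
    have e : ∑ τ ∈ T, NBk b (s k) j τ = ((T.filter fun τ => nbc b (s k).P (s k).r (s k).w2 ((b : ℤ) ^ (s k).w3 + 1) (ht τ.1 j) (τ.2 j)).card : ℝ) := by
      unfold NBk; simp
    rw [e]
    have h3 : 2 * ((s k).w2 : ℝ) / (s k).P ≤ 1 / N := by
      have : (0 : ℝ) < (s k).P := by exact_mod_cast (P k).hP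
      rw [div_le_div_iff₀ this hN']
      have : (N * (2 * (s k).w2) : ℝ) ≤ (s k).P := by exact_mod_cast (P k).n1
      linarith
    have h4 : 2 * (((b : ℤ) ^ (s k).w3 + 1 : ℤ) : ℝ) / (b : ℝ) ^ (s k).r ≤ 1 / N := by
      have hb' : (0 : ℝ) < b := by exact_mod_cast (by omega : 0 < b)
      rw [div_le_div_iff₀ (by positivity) hN']
      have : (N * (2 * (b ^ (s k).w3 + 1)) : ℝ) ≤ (b : ℝ) ^ (s k).r := by exact_mod_cast (P k).n2
      push_cast
      linarith
    calc _ ≤ 3 * ((1 / N + 1 / N) * cT) := by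
          refine mul_le_mul_of_nonneg_left (h2.trans ?_) (by norm_num)
          refine mul_le_mul_of_nonneg_right (add_le_add h3 h4) hcT0.le
      _ = _ := by ring
  have badE : ∀ X : Fin (n + 1) → Fin W₀ → ZMod 2, ∀ κ ∈ Hb (n + 1) H, 
      ((E.filter fun y => y * (lam b B₀ pt X κ)⁻¹ ∉ E).card : ℝ) ≤ 3 / N * cT := by
    intro X κ hκ'
    have sub : (E.filter fun y => y * (lam b B₀ pt X κ)⁻¹ ∉ E) ⊆ E.filter fun y => bad b Hh c (A * (K * R)) (t y) := by
      intro y hy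
      rw [mem_filter] at hy ⊢
      refine ⟨hy.1, ?_⟩
      rw [memE, memE] at hy
      refine bad_of S.G hb hsum Hh c (K * R) hHc hy.1 ?_ hy.2
      refine (S.hK1 _ _).trans ?_
      gcongr
      refine le_trans (le_of_eq ?_) (hR X κ hκ')
      rw [S.G.symm]
      have := S.hinv (y * (lam b B₀ pt X κ)⁻¹) 1 (lam b B₀ pt X κ)
      rw [← this]; simp
    have h1 : ((E.filter fun y => bad b Hh c (A * (K * R)) (t y)).card : ℝ) ≤ 
        3 * ((T.filter fun τ => bad b Hh c (A * (K * R)) τ).card : ℝ) := by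
      have := le3 (fun τ => if bad b Hh c (A * (K * R)) τ then 1 else 0) (fun τ => by positivity)
      simpa using this
    have h2 := P3 (n := n) S.hn hb (A * (K * R)) hHh hHc
    have h3 : ((E.filter fun y => y * (lam b B₀ pt X κ)⁻¹ ∉ E).card : ℝ) ≤ ((E.filter fun y => bad b Hh c (A * (K * R)) (t y)).card : ℝ) := by
      exact_mod_cast card_le_card sub
    have h4 := mul_le_mul_of_nonneg_right hβ hcT0.le
    have h5 := h2.trans h4
    calc _ ≤ 3 * (1 / N * cT) := by linarith
      _ = _ := by ring
  have hJ : 0 < (Hb (n + 1) H).card := by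
    refine card_pos.2 ⟨fun _ => 0, ?_⟩
    unfold Hb; simp; exact hH
  have main := abs_avg E (Hb (n + 1) H) (lam b B₀ pt) N (fun k x => Hk b s Q k (t x)) (fun k x => NBk b (s k) 0 (t x)) 
    (fun k x => NBk b (s k) (Fin.last n) (t x)) (Cst n A c0 q Q₀ m) (6 / N * cT) (3 / N * cT) badE 
    (fun k y => tH_abs _ _ _ _) (fun k y => (NBk_abs _ _ _).1) (fun k y => (NBk_abs _ _ _).1)
    (fun γ => sumk S hsum hN0 hQ₀ hQq (fun k _ => P k) hQ γ H hH hκ h7) (fun k hk => nbB k hk 0) (fun k hk => nbB k hk _) hJ Fintype.card_pos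
  have hC0 : 0 ≤ Cst n A c0 q Q₀ m := by unfold Cst; positivity
  have f1 : (4 : ℝ) * N * (6 / N * cT) = 24 * cT := by field_simp; norm_num
  have f2 : (10 : ℝ) * N * (3 / N * cT) = 30 * cT := by field_simp; norm_num
  rw [f1, f2] at main
  have f3 : (m' / 4 : ℝ) * cT ≤ (3 * Cst n A c0 q Q₀ m + 54) * cT := by
    have := mul_le_mul_of_nonneg_right cardE hC0
    linarith
  exact le_of_mul_le_mul_right f3 hcT0
end st
end NR


namespace NR
open Finset
set_option linter.unusedSectionVars false
set_option linter.unusedVariables false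

def cX (a0 q Q₀ : ℕ) : ℕ := 6 * (a0 * Q₀) + a0 + 4 * q + 5
def cY (a0 q Q₀ : ℕ) : ℕ := 2 * a0 * (q * cX a0 q Q₀) + 2
def cZ (a0 q Q₀ : ℕ) : ℕ := 3 * cY a0 q Q₀ + cX a0 q Q₀ + 3

def mkS (a0 q N ρ g x w2 M : ℕ) : Scl where
  g := g
  h1 := 2 * x + 2 * g
  c1 := q * x - 1
  w2 := w2
  w3 := w2 + (g + a0 + 4 * q) + 1
  r := w2 + (g + a0 + 4 * q) + 1 + N + 2
  P := N * (2 * w2)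
  lL := M
  L := 2 * q * M
  W := 12 * M
  μ := 2 * a0 * (2 * q * M) + 2
  T := N * (2 * a0 * (2 * q * M)) * ρ
  ρ := ρ

def nxt (a0 Q₀ N m : ℕ) (s : Scl) : ℕ :=
  s.T + 2 ^ m * (2 * Q₀) * s.ρ + N * (4 * a0 ^ 2 * s.T) + N * (4 * a0 ^ 2 * (2 ^ m * (2 * Q₀) * s.ρ)) + (s.P + s.r + s.μ + 1)

lemma par_bounds {a0 q Q₀ N ρ g x w2 M X Y : ℕ} (ha : 1 ≤ a0) (hq1 : 1 ≤ q) (hQ1 : q ≤ Q₀) (hN : 1 ≤ N) (hρ : 1 ≤ ρ)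
    (hX : X = 6 * (a0 * Q₀) + a0 + 4 * q + 5) (hY : Y = 2 * a0 * (q * X) + 2) (hMd : M = (3 * Y + X + 3) * N * ρ)
    (hg : g = 2 * a0 * Q₀ * ρ) (hx : x = (g + a0 + 4 * q) + 2 * g + 5) (hw2 : w2 = 2 * a0 * (q * x) + 2) :
    ρ ≤ g ∧ x ≤ M ∧ N * (2 * w2) + (w2 + (g + a0 + 4 * q) + 1 + N + 2) ≤ M := by
  have hgρ : ρ ≤ g := by 
    rw [hg]
    have : 1 * ρ ≤ 2 * a0 * Q₀ * ρ := by
      gcongr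
      have : 0 < a0 * Q₀ := Nat.mul_pos ha (by omega)
      nlinarith
    linarith
  have hxX : x ≤ X * ρ := by
    rw [hx, hg, hX]
    have : (a0 + 4 * q + 5) * 1 ≤ (a0 + 4 * q + 5) * ρ := by gcongr
    linarith
  have hwY : w2 ≤ Y * ρ := by
    rw [hw2, hY]
    have : 2 * a0 * (q * x) ≤ 2 * a0 * (q * (X * ρ)) := by gcongr
    linarith
  have hPr : N * (2 * w2) + (w2 + (g + a0 + 4 * q) + 1 + N + 2) ≤ M := by
    rw [hMd]
    have h1 : N * (2 * w2) ≤ N * (2 * (Y * ρ)) := by gcongr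
    have h2 : 1 * (Y * ρ) ≤ N * (Y * ρ) := by gcongr
    have h3 : 1 * (X * ρ) ≤ N * (X * ρ) := by gcongr
    have h4 : N * 1 ≤ N * ρ := by gcongr
    have h5 : g + a0 + 4 * q + 1 ≤ x := by omega
    have h6 : (3 * Y + X + 3) * N * ρ = N * (2 * (Y * ρ)) + N * (Y * ρ) + N * (X * ρ) + 3 * (N * ρ) := by ring
    rw [h6]
    linarith
  refine ⟨hgρ, ?_, hPr⟩
  have : x ≤ w2 := by 
    rw [hw2]
    have : 1 * x ≤ 2 * a0 * q * x := by
      gcongr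
      nlinarith [Nat.mul_pos ha hq1]
    linarith
  have : 1 * (2 * w2) ≤ N * (2 * w2) := by gcongr
  omega

lemma nu_bound {A lA q M : ℕ} (hlA : A ≤ 2 ^ lA) (hq2 : 52 * lA * A ≤ q) (hM1 : 1 ≤ M) : 
    A ^ (A * (2 * (12 * M) + 2)) * A ^ (A * (2 * (12 * M) + 2)) ≤ 2 ^ (q * M) := by
  have hν : A ^ (A * (2 * (12 * M) + 2)) ≤ 2 ^ (lA * (A * (26 * M))) := by
    calc A ^ (A * (2 * (12 * M) + 2)) ≤ (2 ^ lA) ^ (A * (2 * (12 * M) + 2)) := Nat.pow_le_pow_left hlA _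
      _ = 2 ^ (lA * (A * (2 * (12 * M) + 2))) := by rw [← pow_mul]
      _ ≤ _ := by
        refine Nat.pow_le_pow_right (by norm_num) ?_
        gcongr
        omega
  have hex : lA * (A * (26 * M)) + lA * (A * (26 * M)) ≤ q * M := by
    have : 52 * lA * A * M ≤ q * M := by gcongr
    linarith
  refine (Nat.mul_le_mul hν hν).trans ?_
  rw [← pow_add]
  exact Nat.pow_le_pow_right (by norm_num) hex

lemma nu_lt {ν q M : ℕ} (h0 : 1 ≤ ν) (h : ν * ν ≤ 2 ^ (q * M)) (hq1 : 1 ≤ q) (hM1 : 1 ≤ M) : 4 * ν < 3 * 2 ^ (2 * q * M) := by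
  have h1 : ν ≤ 2 ^ (q * M) := le_trans (Nat.le_mul_of_pos_left ν h0) h
  have h2 : 2 ^ (2 * q * M) = 2 ^ (q * M) * 2 ^ (q * M) := by rw [← pow_add]; congr 1; ring
  have h3 : 2 ^ 1 ≤ 2 ^ (q * M) := Nat.pow_le_pow_right (by norm_num) (Nat.mul_pos hq1 hM1)
  rw [h2]
  generalize 2 ^ (q * M) = v at *
  have : 2 * v ≤ v * v := by gcongr; omega
  omega

lemma stp_mk {A c0 b N Q₀ q m lA : ℕ} (hA : 1 ≤ A) (hc0 : 1 ≤ c0) (hb : 2 ≤ b) {a0 : ℕ} (ha0 : a0 = A * c0) (hq : 4 * a0 ≤ q) (hlA : A ≤ 2 ^ lA)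
    (hq2 : 52 * lA * A ≤ q) (hQ : 4 * a0 * q ≤ Q₀) (hN : 1 ≤ N) {X Y ρ g x w2 M : ℕ} (hm : (3 * Y + X + 3) * N < 2 ^ m) (hρ : 1 ≤ ρ)
    (hX : X = 6 * (a0 * Q₀) + a0 + 4 * q + 5) (hY : Y = 2 * a0 * (q * X) + 2) (hMd : M = (3 * Y + X + 3) * N * ρ)
    (hg : g = 2 * a0 * Q₀ * ρ) (hx : x = (g + a0 + 4 * q) + 2 * g + 5) (hw2 : w2 = 2 * a0 * (q * x) + 2)
    (hM : 2 * q * M ≤ 2 ^ M) :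
    Stp A c0 b N Q₀ q m (mkS a0 q N ρ g x w2 M) (nxt a0 Q₀ N m (mkS a0 q N ρ g x w2 M)) := by
  have ha : 1 ≤ a0 := by rw [ha0]; exact Nat.mul_pos hA hc0
  have hq1 : 1 ≤ q := by omega
  have hQ1 : q ≤ Q₀ := by
    have : 1 * q ≤ 4 * a0 * q := by gcongr; omega
    omega
  obtain ⟨p1, p2, p3⟩ := par_bounds ha hq1 hQ1 hN hρ hX hY hMd hg hx hw2
  have hM1 : 1 ≤ M := by omega
  have hνν := nu_bound hlA hq2 hM1
  have hqx : 1 ≤ q * x := Nat.mul_pos hq1 (by omega)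
  have hqx2 : q * x - 1 + 1 = q * x := by omega
  have hL1 : 1 ≤ 2 * q * M := Nat.mul_pos (by omega) hM1
  constructor
  · constructor
    · exact hb
    · exact hq1
    · simp only [mkS]; rw [hqx2]; apply le_of_eq; ring
    · simp only [mkS]
      rw [← ha0]
      have e1 : c0 * (A * ((g + a0 + 4 * q) + (2 * x + 2 * g) + 2 + 1) + 1) ≤ a0 * ((g + a0 + 4 * q) + (2 * x + 2 * g) + 4) := by
        rw [ha0]
        have : c0 * 1 ≤ c0 * A := by gcongr
        linarith
      have e2 : a0 * ((g + a0 + 4 * q) + (2 * x + 2 * g) + 4) + a0 = 3 * a0 * x := by rw [hx]; ring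
      have e3 : 4 * a0 * x ≤ q * x := by gcongr
      have e4 : 1 * 1 ≤ a0 * x := Nat.mul_le_mul ha (by omega)
      have e5 : 4 * a0 * x = 3 * a0 * x + a0 * x := by ring
      omega
    · simp only [mkS]; rw [hqx2]
      have : q * x ≤ q * M := by gcongr
      linarith
    · simp only [mkS]
      exact hM.trans (Nat.pow_le_pow_left hb _)
    · simp only [mkS]; rw [← ha0]
      have : q * (2 * g + a0 + M + 4 * q) ≤ q * (2 * M) := by gcongr; omega
      linarith
  · simp only [mkS]
    exact nu_lt (Nat.one_le_pow _ _ hA) hνν hq1 hM1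
  · simp only [mkS]; rw [hqx2, ← ha0, hw2]
  · simp only [mkS]; rw [← ha0]
  · simp only [mkS]; rw [← ha0]
  · simp only [mkS]; omega
  · simp only [mkS]; exact Nat.mul_pos hN (by omega)
  · exact hρ
  · simp only [mkS]
    rw [hMd]
    have : 2 * q * ((3 * Y + X + 3) * N * ρ) ≤ 2 * Q₀ * ((3 * Y + X + 3) * N * ρ) := by gcongr
    refine this.trans_lt ?_
    have e : 2 ^ (m + 1) * Q₀ * ρ = 2 * Q₀ * (2 ^ m * ρ) := by rw [pow_succ]; ring
    rw [e]
    have : (3 * Y + X + 3) * N * ρ < 2 ^ m * ρ := Nat.mul_lt_mul_of_pos_right hm hρ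
    exact Nat.mul_lt_mul_of_pos_left this (by omega)
  · simp only [mkS]; rw [← ha0, hg]
  · simp only [mkS]
    exact Nat.mul_pos (Nat.mul_pos hN (Nat.mul_pos (by omega) hL1)) hρ
  · simp only [mkS]; exact Dvd.intro_left _ rfl
  · simp only [mkS]
    calc 2 * q * M = 1 * (1 * (2 * q * M)) * 1 := by ring
      _ ≤ _ := by gcongr; omega
  · simp only [mkS]
    rw [← ha0]
    calc N * (2 * a0 * (2 * q * M)) ^ 2 ≤ N ^ 2 * (2 * a0 * (2 * q * M)) ^ 2 * 1 ^ 2 := by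
          have : N ≤ N ^ 2 := by nlinarith
          rw [one_pow, mul_one]; gcongr
      _ ≤ N ^ 2 * (2 * a0 * (2 * q * M)) ^ 2 * ρ ^ 2 := by gcongr
      _ = _ := by ring
  · unfold nxt; simp only [mkS]; omega
  · unfold nxt; simp only [mkS]; omega
  · unfold nxt; simp only [mkS]; rw [ha0]; omega
  · unfold nxt; simp only [mkS]; rw [ha0]; omega
  · unfold nxt; omega
  · simp only [mkS]; omega
  · simp only [mkS]; exact le_rfl
  · simp only [mkS]
    set w3 := w2 + (g + a0 + 4 * q) + 1
    have h1 : b ^ (w3 + N + 2) = b ^ w3 * b ^ (N + 2) := by rw [add_assoc, pow_add]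
    have h2 : 1 ≤ b ^ w3 := Nat.one_le_pow _ _ (by omega)
    have h3 : 2 ^ (N + 2) ≤ b ^ (N + 2) := Nat.pow_le_pow_left hb _
    have h4 : N < 2 ^ N := Nat.lt_two_pow_self
    have h5 : 4 * N ≤ b ^ (N + 2) := by rw [pow_add] at h3; omega
    rw [h1]
    calc N * (2 * (b ^ w3 + 1)) ≤ N * (2 * (b ^ w3 + b ^ w3)) := by gcongr
      _ = b ^ w3 * (4 * N) := by ring
      _ ≤ _ := by gcongr
end NR


namespace NR
open Finset
set_option linter.unusedSectionVars false
set_option linter.unusedVariables false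

lemma exp_big {v N ν b μ : ℕ} {B : ℝ} (hv : 1 ≤ v) (hN : 1 ≤ N) (hν : 1 ≤ ν) (hb : 1 ≤ b)
    (h1 : (4 * N ^ 2 * (5 + 4 * b * μ) : ℝ) < B) (h2 : B * (ν : ℝ) ^ 2 ≤ v) :
    2 * ((2 * ((b ^ μ * b ^ μ : ℕ) : ℝ) + 1) ^ v * (((b ^ μ * b ^ μ : ℕ) : ℝ) + 1) ^ v) <
      Real.exp ((1 / N : ℝ) ^ 2 * (v : ℝ) ^ 2 / (4 * ν ^ 2)) := by
  have hv' : (1 : ℝ) ≤ v := by exact_mod_cast hv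
  have hN' : (1 : ℝ) ≤ N := by exact_mod_cast hN
  have hν' : (1 : ℝ) ≤ ν := by exact_mod_cast hν
  have hb' : (1 : ℝ) ≤ b := by exact_mod_cast hb
  have hc : ((b ^ μ * b ^ μ : ℕ) : ℝ) ≤ Real.exp (2 * (b * μ)) := by
    push_cast
    have : (b : ℝ) ≤ Real.exp b := by have := Real.add_one_le_exp (b : ℝ); linarith
    calc (b : ℝ) ^ μ * (b : ℝ) ^ μ ≤ Real.exp b ^ μ * Real.exp b ^ μ := by gcongr
      _ = _ := by rw [← Real.exp_nat_mul, ← Real.exp_add]; congr 1; ring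
  have hc1 : (1 : ℝ) ≤ ((b ^ μ * b ^ μ : ℕ) : ℝ) := by
    exact_mod_cast Nat.mul_pos (Nat.pow_pos (by omega)) (Nat.pow_pos (by omega))
  generalize ((b ^ μ * b ^ μ : ℕ) : ℝ) = c at *
  have h3 : 3 ≤ Real.exp 2 := by have := Real.add_one_le_exp (2 : ℝ); linarith
  have h3c : 3 * c ≤ Real.exp (2 + 2 * (b * μ)) := by rw [Real.exp_add]; gcongr
  have e2 : 2 ≤ Real.exp 1 := by have := Real.add_one_le_exp (1 : ℝ); linarith
  calc 2 * ((2 * c + 1) ^ v * (c + 1) ^ v) ≤ Real.exp 1 * (Real.exp (2 + 2 * (b * μ)) ^ v * Real.exp (2 + 2 * (b * μ)) ^ v) := by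
        gcongr <;> linarith
    _ = Real.exp (1 + v * (4 + 4 * (b * μ))) := by
        rw [← Real.exp_nat_mul, ← Real.exp_add, ← Real.exp_add]; congr 1; ring
    _ < _ := by
        rw [Real.exp_lt_exp, lt_div_iff₀ (by positivity), one_div, inv_pow, inv_mul_eq_div, lt_div_iff₀ (by positivity)]
        calc (1 + v * (4 + 4 * (b * μ))) * (4 * (ν : ℝ) ^ 2) * N ^ 2 ≤ (v * (5 + 4 * (b * μ))) * (4 * (ν : ℝ) ^ 2) * N ^ 2 := by
              gcongr; linarith
          _ = v * ((4 * N ^ 2 * (5 + 4 * b * μ)) * (ν : ℝ) ^ 2) := by ring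
          _ < v * (B * (ν : ℝ) ^ 2) := by gcongr
          _ ≤ v * v := by gcongr
          _ = _ := by ring

lemma ev_lin (α β : ℕ) : ∃ M0 : ℕ, ∀ M ≥ M0, α * M + β < 2 ^ M := by
  have h := tendsto_pow_const_div_const_pow_of_one_lt 1 (by norm_num : (1 : ℝ) < 2)
  have := (h.const_mul ((α + β : ℕ) : ℝ)).eventually (gt_mem_nhds (by norm_num : ((α + β : ℕ) : ℝ) * 0 < 1))
  obtain ⟨M0, hM⟩ := Filter.eventually_atTop.1 this
  refine ⟨M0 + 1, fun M h => ?_⟩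
  have h1 := hM M (by omega)
  rw [← mul_div_assoc, div_lt_one (by positivity), pow_one] at h1
  have h2 : (α + β) * M < 2 ^ M := by exact_mod_cast h1
  have : β * 1 ≤ β * M := by gcongr; omega
  nlinarith

lemma ev_m (Z C : ℕ) : ∃ m : ℕ, 1 ≤ m ∧ C ≤ m ∧ Z * (m ^ 4) ^ 2 < 2 ^ m := by
  have h := tendsto_pow_const_div_const_pow_of_one_lt 8 (by norm_num : (1 : ℝ) < 2)
  have := (h.const_mul (Z : ℝ)).eventually (gt_mem_nhds (by norm_num : (Z : ℝ) * 0 < 1))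
  obtain ⟨M0, hM⟩ := Filter.eventually_atTop.1 this
  refine ⟨M0 + C + 1, by omega, by omega, ?_⟩
  have h1 := hM (M0 + C + 1) (by omega)
  rw [← mul_div_assoc, div_lt_one (by positivity)] at h1
  rw [← pow_mul]
  exact_mod_cast h1

lemma cst_small (n A c0 q Q₀ : ℕ) : ∃ C : ℕ, ∀ m : ℕ, 1 ≤ m → C ≤ m → 3 * Cst n A c0 q Q₀ m + 54 < ((m ^ 4 : ℕ) : ℝ) / 4 := by
  set e : ℝ := ((A * c0 : ℕ) : ℝ) ^ 2 * (n + 1) ^ 2 + 2 * (n + 1) ^ 2 with he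
  set C' : ℝ := 80 * q ^ 2 * (2 * Q₀ + 1) * (50 * (2 * (2 * Q₀ + 1) * e) + 48 * (n + 1) ^ 2) + 1 with hC'
  obtain ⟨C, hC⟩ := exists_nat_gt (12 * C' + 216)
  refine ⟨C, fun m hm hCm => ?_⟩
  have hm' : (1 : ℝ) ≤ m := by exact_mod_cast hm
  have he0 : 0 ≤ e := by positivity
  have hQ0 : (0 : ℝ) ≤ Q₀ := by positivity
  have hM : (((m + 1) * Q₀ + 1 : ℕ) : ℝ) ≤ m * (2 * Q₀ + 1) := by
    push_cast
    nlinarith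
  have h1 : Cst n A c0 q Q₀ m ≤ m ^ 2 * C' := by
    unfold Cst
    rw [← he]
    have hM0 : (0 : ℝ) ≤ (((m + 1) * Q₀ + 1 : ℕ) : ℝ) := by positivity
    generalize (((m + 1) * Q₀ + 1 : ℕ) : ℝ) = M at *
    have h48 : (0 : ℝ) ≤ 48 * (n + 1) ^ 2 := by positivity
    rw [hC']
    generalize (48 * ((n : ℝ) + 1) ^ 2) = y at *
    calc 80 * (q : ℝ) ^ 2 * M * (50 * (2 * M * e) + y) + 1 ≤ 
        80 * (q : ℝ) ^ 2 * (m * (2 * Q₀ + 1)) * (50 * (2 * (m * (2 * Q₀ + 1)) * e) + m * y) + m ^ 2 := by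
          gcongr
          · nlinarith
          · nlinarith
      _ = _ := by ring
  have hC2 : 12 * C' + 216 < m := hC.trans_le (by exact_mod_cast hCm)
  have hm2 : (m : ℝ) ≤ m ^ 2 := by nlinarith
  have h4 : (m : ℝ) ^ 4 = m ^ 2 * m ^ 2 := by ring
  push_cast
  rw [h4]
  have : 1 ≤ (m : ℝ) ^ 2 := by nlinarith
  nlinarith

theorem params (n : ℕ) {A c0 b : ℕ} (hA : 1 ≤ A) (hc0 : 1 ≤ c0) (hb : 2 ≤ b) : ∃ (q Q₀ m m' : ℕ) (s : ℕ → Scl), 0 < m' ∧ 0 < Q₀ ∧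
    4 * (A * c0) * q ≤ Q₀ ∧ 3 * Cst n A c0 q Q₀ m + 54 < (m' : ℝ) / 4 ∧
    (∀ k, Stp A c0 b (m' ^ 2) Q₀ q m (s k) (s (k + 1)).ρ) ∧ ∀ k, ∃ Q, QGood A b (m' ^ 2) (s k) Q := by
  obtain ⟨a0, ha0⟩ : ∃ a0, a0 = A * c0 := ⟨_, rfl⟩
  have ha : 1 ≤ a0 := by rw [ha0]; exact Nat.mul_pos hA hc0
  obtain ⟨q, hq⟩ : ∃ q, q = 4 * a0 + 52 * A * A := ⟨_, rfl⟩
  obtain ⟨Q₀, hQ₀⟩ : ∃ q', q' = 4 * a0 * q := ⟨_, rfl⟩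
  have hq1 : 1 ≤ q := by omega
  obtain ⟨X, hX⟩ : ∃ X, X = 6 * (a0 * Q₀) + a0 + 4 * q + 5 := ⟨_, rfl⟩
  obtain ⟨Y, hY⟩ : ∃ Y, Y = 2 * a0 * (q * X) + 2 := ⟨_, rfl⟩
  obtain ⟨C, hC⟩ := cst_small n A c0 q Q₀
  obtain ⟨m, hm1, hmC, hm⟩ := ev_m (3 * Y + X + 3) C
  obtain ⟨N, hN⟩ : ∃ N, N = (m ^ 4) ^ 2 := ⟨_, rfl⟩
  have hN1 : 1 ≤ N := by rw [hN]; exact Nat.one_le_pow _ _ (Nat.one_le_pow _ _ hm1)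
  obtain ⟨M0, hM0⟩ := ev_lin (2 * q + 4 * N ^ 2 * (4 * b * (2 * a0 * (2 * q)))) (4 * N ^ 2 * (5 + 4 * b * 2))
  set f : ℕ → Scl := fun ρ => mkS a0 q N ρ (2 * a0 * Q₀ * ρ) ((2 * a0 * Q₀ * ρ + a0 + 4 * q) + 2 * (2 * a0 * Q₀ * ρ) + 5)
    (2 * a0 * (q * ((2 * a0 * Q₀ * ρ + a0 + 4 * q) + 2 * (2 * a0 * Q₀ * ρ) + 5)) + 2) ((3 * Y + X + 3) * N * ρ) with hf
  have fρ : ∀ ρ, (f ρ).ρ = ρ := fun ρ => rfl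
  have hlA : A ≤ 2 ^ A := Nat.lt_two_pow_self.le
  have hMρ : ∀ ρ, ρ ≤ (3 * Y + X + 3) * N * ρ := fun ρ => Nat.le_mul_of_pos_left ρ (Nat.mul_pos (by omega) hN1)
  have st : ∀ ρ ≥ M0 + 1, Stp A c0 b N Q₀ q m (f ρ) (nxt a0 Q₀ N m (f ρ)) := by
    intro ρ hρ
    refine stp_mk hA hc0 hb ha0 (by omega) hlA (by omega) hQ₀.ge hN1 (hN ▸ hm) (by omega) hX hY rfl rfl rfl rfl ?_
    have h := hM0 ((3 * Y + X + 3) * N * ρ) (by have := hMρ ρ; omega)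
    rw [add_mul] at h
    omega
  have qg : ∀ ρ ≥ M0 + 1, ∃ Q, QGood A b N (f ρ) Q := by
    intro ρ hρ
    have hMM := hMρ ρ
    have h := hM0 ((3 * Y + X + 3) * N * ρ) (by omega)
    have nb := nu_bound (M := (3 * Y + X + 3) * N * ρ) (q := q) hlA (by omega) (by omega)
    have hfμ : (f ρ).μ = 2 * a0 * (2 * q * ((3 * Y + X + 3) * N * ρ)) + 2 := rfl
    change ∃ Q : LabT b (f ρ).μ → LabT b (f ρ).μ → Bool, QLp (Fin (2 * q * ((3 * Y + X + 3) * N * ρ)) → ZMod 2) (FQ Q) (A ^ (A * (2 * (12 * ((3 * Y + X + 3) * N * ρ)) + 2))) (1 / (N : ℝ))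
    generalize (3 * Y + X + 3) * N * ρ = M at *
    have hν1 : 1 ≤ A ^ (A * (2 * (12 * M) + 2)) := Nat.one_le_pow _ _ hA
    generalize A ^ (A * (2 * (12 * M) + 2)) = ν at *
    have : NeZero (b ^ (f ρ).μ) := ⟨by positivity⟩
    have hcV : Fintype.card (Fin (2 * q * M) → ZMod 2) = 2 ^ (2 * q * M) := by simp [ZMod.card]
    have hca : Fintype.card (LabT b (f ρ).μ) = b ^ (f ρ).μ * b ^ (f ρ).μ := by
      simp only [LabT, Fintype.card_prod, ZMod.card]
    have hN'' : (0 : ℝ) < 1 / N := one_div_pos.2 (by exact_mod_cast hN1)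
    refine QL (α := LabT b (f ρ).μ) (β := LabT b (f ρ).μ) (V := Fin (2 * q * M) → ZMod 2) ν hν1 (1 / N) hN'' Fintype.card_pos ?_
    rw [hcV, hca]
    have hμ : (f ρ).μ = 2 * a0 * (2 * q * M) + 2 := hfμ
    refine exp_big (B := ((2 ^ (q * M) : ℕ) : ℝ)) (Nat.one_le_pow _ _ (by norm_num)) hN1 hν1 (by omega) ?_ ?_
    · rw [hμ]
      have h5 : 2 ^ M ≤ 2 ^ (q * M) := Nat.pow_le_pow_right (by norm_num) (Nat.le_mul_of_pos_left M hq1)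
      have h6 : 4 * N ^ 2 * (5 + 4 * b * (2 * a0 * (2 * q * M) + 2)) < 2 ^ (q * M) := by
        refine lt_of_le_of_lt ?_ (h.trans_le h5)
        have : 4 * N ^ 2 * (5 + 4 * b * (2 * a0 * (2 * q * M) + 2)) + 2 * q * M = (2 * q + 4 * N ^ 2 * (4 * b * (2 * a0 * (2 * q)))) * M + 4 * N ^ 2 * (5 + 4 * b * 2) := by
          ring
        omega
      exact_mod_cast h6
    · have h7 : 2 ^ (2 * q * M) = 2 ^ (q * M) * 2 ^ (q * M) := by rw [← pow_add]; congr 1; ring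
      rw [h7]
      have : 2 ^ (q * M) * ν ^ 2 ≤ 2 ^ (q * M) * 2 ^ (q * M) := by
        rw [pow_two]; exact Nat.mul_le_mul_left _ nb
      exact_mod_cast this
  have nx : ∀ ρ ≥ M0 + 1, M0 + 1 ≤ nxt a0 Q₀ N m (f ρ) := by
    intro ρ hρ
    have h1 := (st ρ hρ).hr'
    have h2 := (st ρ hρ).hrρ
    rw [fρ] at h2
    omega
  set ρs : ℕ → ℕ := fun k => (fun ρ => nxt a0 Q₀ N m (f ρ))^[k] (M0 + 1) with hρs
  have hge : ∀ k, M0 + 1 ≤ ρs k := by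
    intro k
    induction k with
    | zero => exact le_rfl
    | succ k ih => 
      simp only [hρs, Function.iterate_succ_apply'] at ih ⊢
      exact nx _ ih
  refine ⟨q, Q₀, m, m ^ 4, fun k => f (ρs k), Nat.pow_pos hm1, ?_, ?_, hC m hm1 hmC, ?_, ?_⟩
  · rw [hQ₀]; exact Nat.mul_pos (by omega) hq1
  · rw [← ha0, hQ₀]
  · intro k
    rw [← hN, fρ]
    have : ρs (k + 1) = nxt a0 Q₀ N m (f (ρs k)) := by simp only [hρs, Function.iterate_succ_apply']
    rw [this]
    exact st _ (hge k)
  · intro k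
    rw [← hN]
    exact qg _ (hge k)
end NR


namespace NR
open Finset
set_option linter.unusedSectionVars false
set_option linter.unusedVariables false

section st
variable {n : ℕ} {Γ : Type*} [Group Γ] {b : ℕ} {ζ : Γ → Fin (n + 1) → ℤ}
  {ξ : Γ → Fin (n + 1) → ℝ} 
  {pt : (Fin (n + 1) → ℤ) → (Fin (n + 1) → ℤ) → Γ}

lemma fin_bound (hb : 2 ≤ b) (F : Finset Γ) : ∃ M : ℕ, ∀ q ∈ F, (∀ j, |ζ 1 j - ζ q j| ≤ M) ∧ ∀ j, |ξ 1 j - ξ q j| ≤ (b : ℝ) ^ (ζ 1 j + M) := by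
  have one : ∀ q j, ∃ M : ℕ, |ζ 1 j - ζ q j| ≤ M ∧ |ξ 1 j - ξ q j| ≤ (b : ℝ) ^ (ζ 1 j + M) := by
    intro q j
    have hb1 : (1 : ℝ) < b := by exact_mod_cast (by omega : 1 < b)
    have hz := zpow_pos' hb (ζ 1 j)
    obtain ⟨M, hM⟩ := pow_unbounded_of_one_lt (|ξ 1 j - ξ q j| / (b : ℝ) ^ (ζ 1 j)) hb1
    refine ⟨M + (ζ 1 j - ζ q j).natAbs, by rw [Int.abs_eq_natAbs]; omega, ?_⟩
    rw [div_lt_iff₀ hz, mul_comm, ← zpow_natCast, ← zpow_add₀ (by positivity)] at hM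
    refine hM.le.trans (zpow_mono hb (by omega))
  choose M hM1 hM2 using one
  refine ⟨∑ q ∈ F, ∑ j, M q j, fun q hq => ?_⟩
  have key : ∀ j, M q j ≤ ∑ q ∈ F, ∑ j, M q j := fun j => 
    (single_le_sum (f := fun j => M q j) (fun _ _ => Nat.zero_le _) (mem_univ j)).trans
      (single_le_sum (f := fun q => ∑ j, M q j) (fun _ _ => Nat.zero_le _) hq)
  refine ⟨fun j => (hM1 q j).trans (by exact_mod_cast key j), fun j => (hM2 q j).trans (zpow_mono hb ?_)⟩
  have := key j
  omega

open Classical in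
theorem pattern (hn : 1 ≤ n) (hb : 2 ≤ b) (ev : Even b) (hsum : ∀ q, ∑ j, ζ q j = 0) (hpt : IsPt b ζ ξ pt) (K : ℕ) (hK : 1 ≤ K) :
    ∃ Hh thr : ℕ, 0 < Hh ∧ Hh ≤ thr ∧ ∀ c ≥ thr, ∃ pat : Tl n → Prop, ∀ (dd : Γ → Γ → ℕ) (ψ : Γ → Γ), GM b ζ ξ dd K → 
      (∀ g p q, dd (g * p) (g * q) = dd p q) → Function.Injective ψ → (∀ p q, dd (ψ p) (ψ q) ≤ K * dd p q) → 
      (∀ p q, dd p q ≤ K * dd (ψ p) (ψ q)) → 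
      ¬ ∀ τ ∈ TB n b Hh c, {x | tile b ζ ξ (ψ x) = τ}.ncard = if pat τ then 3 else 1 := by
  obtain ⟨c0, hc0⟩ : ∃ c0, c0 = K * (K * (n + 1 + 3)) := ⟨_, rfl⟩
  have hc01 : 1 ≤ c0 := by rw [hc0]; exact Nat.mul_pos hK (Nat.mul_pos hK (by omega))
  obtain ⟨q, Q₀, m, m', s, hm', hQ₀, hQq, hC, hs, hQ⟩ := params n hK hc01 hb
  choose Q hQ using hQ
  obtain ⟨N, hN⟩ : ∃ N, N = m' ^ 2 := ⟨_, rfl⟩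
  rw [← hN] at hs hQ
  have hN1 : 1 ≤ N := by rw [hN]; exact Nat.pow_pos hm'
  have hN' : (0 : ℝ) < N := by exact_mod_cast hN1
  obtain ⟨H, hH⟩ : ∃ H, H = ∑ k ∈ range N, N * (7 * (K * c0) ^ 2 * (s (k + 1)).ρ) + 1 := ⟨_, rfl⟩
  obtain ⟨B₀, hB₀⟩ : ∃ B₀, B₀ = (n + 1) * H := ⟨_, rfl⟩
  obtain ⟨W₀, hW₀⟩ : ∃ W₀, W₀ = B₀ + B₀ + ∑ k ∈ range N, (s k).L := ⟨_, rfl⟩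
  obtain ⟨M1, hM1⟩ := fin_bound (ζ := ζ) (ξ := ξ) hb 
    (((univ : Finset (Fin (n + 1) → Fin W₀ → ZMod 2)) ×ˢ Hb (n + 1) H).image fun z => lam b B₀ pt z.1 z.2)
  obtain ⟨R', hR'⟩ : ∃ R', R' = K * (K * (K * (M1 + 1))) := ⟨_, rfl⟩
  obtain ⟨Hh, hHh⟩ : ∃ Hh, Hh = (∏ k ∈ range N, (s k).P) * (4 * n * R' * N + 1) := ⟨_, rfl⟩
  obtain ⟨e, he⟩ : ∃ e, e = 2 * N * ((n + 1) * (2 * (b ^ R' + 1))) := ⟨_, rfl⟩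
  have hPp : 0 < ∏ k ∈ range N, (s k).P := prod_pos fun k _ => (hs k).hP
  have hHh0 : 0 < Hh := by rw [hHh]; positivity
  refine ⟨Hh, Hh + ∑ k ∈ range N, ((s k).P + (s k).r) + 1 + e, hHh0, by omega, fun c hc => ⟨fun τ => 0 ≤ ∑ k ∈ range N, Hk b s Q k τ, ?_⟩⟩
  intro dd ψ G hinv hψ hK1 hK2 hfib
  have S : Std b ζ ξ dd K pt K c0 ψ := ⟨G, hb, hn, hpt, hinv, hψ, hK1, hK2, hc0.ge, hc01, hK⟩
  refine absurd (no_map (W₀ := W₀) (B₀ := B₀) S hsum ev hm' hN hQ₀ hQq hs (fun k _ => hQ k) H (by omega) ?_ ?_ (K * (M1 + 1)) ?_ Hh c hHh0 ?_ ?_ ?_ ?_) (not_le.2 hC)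
  · intro κ hκ k hk l
    unfold Hb at hκ
    simp only [Fintype.mem_piFinset, mem_Ico] at hκ
    have h1 : 0 ≤ ∑ l, κ l := sum_nonneg fun l _ => (hκ l).1
    have h2 : ∑ l, κ l ≤ ∑ l : Fin (n + 1), (H : ℤ) := sum_le_sum fun l _ => (hκ l).2.le
    simp only [sum_const, card_univ, Fintype.card_fin, nsmul_eq_mul] at h2
    have h3 : (s k).L ≤ ∑ k ∈ range N, (s k).L := single_le_sum (f := fun k => (s k).L) (fun _ _ => Nat.zero_le _) (mem_range.2 hk)
    have h4 := hκ l
    have h5 : ((n + 1 : ℕ) : ℤ) * κ l ≤ ((n + 1 : ℕ) : ℤ) * H := mul_le_mul_of_nonneg_left h4.2.le (by positivity)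
    have h6 : 0 ≤ ((n + 1 : ℕ) : ℤ) * κ l := mul_nonneg (by positivity) h4.1
    have h7 : (B₀ : ℤ) = ((n + 1 : ℕ) : ℤ) * H := by rw [hB₀]; push_cast; ring
    have h8 : (W₀ : ℤ) = B₀ + B₀ + ((∑ k ∈ range N, (s k).L : ℕ) : ℤ) := by rw [hW₀]; push_cast; ring
    unfold Zc
    rw [h8, h7]
    constructor <;> omega
  · intro k hk
    rw [hH]
    have := single_le_sum (f := fun k => N * (7 * (K * c0) ^ 2 * (s (k + 1)).ρ)) (fun _ _ => Nat.zero_le _) (mem_range.2 hk)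
    omega
  · intro X κ hκ
    obtain ⟨h1, h2⟩ := hM1 (lam b B₀ pt X κ) (mem_image.2 ⟨(X, κ), by simp [hκ], rfl⟩)
    exact G.m2 _ _ M1 h1 h2
  · intro k hk
    rw [hHh]
    exact Dvd.dvd.mul_right (dvd_prod_of_mem _ (mem_range.2 hk)) _
  · intro k hk
    have := single_le_sum (f := fun k => (s k).P + (s k).r) (fun _ _ => Nat.zero_le _) (mem_range.2 hk)
    omega
  · rw [← hR']
    have h1 : (n : ℝ) * (2 * (R' : ℕ) / Hh : ℝ) ≤ 1 / (2 * N) := by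
      have : 4 * n * R' * N ≤ Hh := by rw [hHh]; nlinarith
      have : (4 * n * R' * N : ℝ) ≤ Hh := by exact_mod_cast this
      have h0 : (0 : ℝ) < Hh := by exact_mod_cast hHh0
      rw [← mul_div_assoc, div_le_div_iff₀ h0 (by positivity)]
      linarith
    have h2 : ((n : ℝ) + 1) * (2 * ((b : ℝ) ^ R' + 1) / (b : ℝ) ^ (c - Hh)) ≤ 1 / (2 * N) := by
      have h3 : e ≤ b ^ (c - Hh) := by
        calc e ≤ 2 ^ e := Nat.lt_two_pow_self.le
          _ ≤ 2 ^ (c - Hh) := Nat.pow_le_pow_right (by norm_num) (by omega)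
          _ ≤ _ := Nat.pow_le_pow_left hb _
      have h4 : (2 * N * ((n + 1) * (2 * (b ^ R' + 1))) : ℝ) ≤ (b : ℝ) ^ (c - Hh) := by rw [he] at h3; exact_mod_cast h3
      have hb' : (0 : ℝ) < b := by exact_mod_cast (by omega : 0 < b)
      rw [← mul_div_assoc, div_le_div_iff₀ (by positivity) (by positivity)]
      linarith
    calc _ ≤ 1 / (2 * (N : ℝ)) + 1 / (2 * N) := add_le_add h1 h2
      _ = _ := by field_simp; norm_num
  · exact hfib
end st
end NR


namespace NR
open Finset
set_option linter.unusedSectionVars false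
set_option linter.unusedVariables false

lemma GM.mono {d : ℕ} {Γ : Type*} {b : ℕ} {ζ : Γ → Fin d → ℤ} {ξ : Γ → Fin d → ℝ} {dd : Γ → Γ → ℕ} {A A' : ℕ}
    (hb : 2 ≤ b) (G : GM b ζ ξ dd A) (h : A ≤ A') : GM b ζ ξ dd A' where
  self := G.self
  symm := G.symm
  tri := G.tri
  growth := fun p m F hF => (G.growth p m F hF).trans (Nat.pow_le_pow_left h m)
  m1z := fun p q j => (G.m1z p q j).trans (by gcongr)
  m1x := fun p q j => (G.m1x p q j).trans (zpow_mono hb (by gcongr))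
  m2 := fun p q m h1 h2 => (G.m2 p q m h1 h2).trans (by gcongr)

lemma TB_disj {n b H c H' c' : ℕ} (hb : 2 ≤ b) (h1 : H ≤ c) (hcc : c < c') {τ : Tl n} (hτ : τ ∈ TB n b H c) : τ ∉ TB n b H' c' := by
  intro hτ'
  unfold TB at hτ hτ'
  rw [mem_sigma] at hτ hτ'
  have hle := Hb_le hτ.1 0
  have a1 := hτ.2
  have a2 := hτ'.2
  unfold Ib at a1 a2
  rw [Fintype.mem_piFinset] at a1 a2
  have a1 := a1 0
  have a2 := a2 0
  simp only [lo, if_true, mem_Ico, Eb] at a1 a2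
  have h : (b : ℤ) ^ ((c : ℤ) - ht τ.1 0).toNat * 2 ≤ (b : ℤ) ^ ((c' : ℤ) - ht τ.1 0).toNat := by
    calc (b : ℤ) ^ ((c : ℤ) - ht τ.1 0).toNat * 2 ≤ (b : ℤ) ^ ((c : ℤ) - ht τ.1 0).toNat * b := by gcongr; exact_mod_cast hb
      _ = (b : ℤ) ^ (((c : ℤ) - ht τ.1 0).toNat + 1) := by rw [pow_succ]
      _ ≤ _ := by
        gcongr
        · exact_mod_cast (by omega : 1 ≤ b)
        · omega
  omega

open Classical in
theorem glue {n : ℕ} {Γ : Type*} [Group Γ] {b : ℕ} {ζ : Γ → Fin (n + 1) → ℤ} {ξ : Γ → Fin (n + 1) → ℝ} 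
    (hn : 1 ≤ n) (hb : 2 ≤ b) (ev : Even b) (hsum : ∀ q, ∑ j, ζ q j = 0) 
    (h3 : ∀ τ : Tl n, ∃ F : Finset Γ, F.card = 3 ∧ ∀ x ∈ F, tile b ζ ξ x = τ) : 
    ∃ D : Set Γ, (∀ τ, ∃ y ∈ D, tile b ζ ξ y = τ) ∧ ∀ (K : ℕ) (dd : Γ → Γ → ℕ) (ψ : Γ → Γ), 1 ≤ K → GM b ζ ξ dd K → 
      (∀ g p q, dd (g * p) (g * q) = dd p q) → Function.Injective ψ → Set.range ψ = D → (∀ p q, dd (ψ p) (ψ q) ≤ K * dd p q) → 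
      (∀ p q, dd p q ≤ K * dd (ψ p) (ψ q)) → False := by
  choose F hF1 hF2 using h3
  have hF0 : ∀ τ, ∃ x, x ∈ F τ := fun τ => by
    have : 0 < (F τ).card := by rw [hF1]; norm_num
    exact card_pos.1 this
  choose x0 hx0 using hF0
  have hpt : IsPt b ζ ξ (fun t i => x0 ⟨fun k => t k.castSucc, i⟩) := by
    intro t i ht0
    have h := hF2 _ _ (hx0 ⟨fun k => t k.castSucc, i⟩)
    have hz : ζ (x0 ⟨fun k => t k.castSucc, i⟩) = t := by
      rw [← tile_ht (b := b) (ξ := ξ) hsum, h]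
      funext j
      induction j using Fin.lastCases with
      | last => 
        rw [Fin.sum_univ_castSucc] at ht0
        simp only [ht_last]; omega
      | cast k => simp
    refine ⟨hz, fun j => ?_⟩
    have h2 : ix b ζ ξ (x0 ⟨fun k => t k.castSucc, i⟩) = i := by
      have : (tile b ζ ξ (x0 ⟨fun k => t k.castSucc, i⟩)).2 = i := by rw [h]
      exact this
    have h4 := congrFun h2 j
    unfold ix at h4
    rw [hz] at h4
    exact h4
  have pat := fun K : ℕ => pattern hn hb ev hsum hpt (K + 1) (by omega)
  choose Hh thr hHh hthr pat using pat
  obtain ⟨c, hcm, hct⟩ : ∃ c : ℕ → ℕ, StrictMono c ∧ ∀ K, thr K ≤ c K := by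
    refine ⟨fun K => ∑ k ∈ range (K + 1), (thr k + 1), strictMono_nat_of_lt_succ fun K => ?_, fun K => ?_⟩
    · rw [sum_range_succ _ (K + 1)]; omega
    · change thr K ≤ ∑ k ∈ range (K + 1), (thr k + 1)
      rw [sum_range_succ]; omega
  choose pt hpat using fun K => pat K (c K) (hct K)
  have disj : ∀ K K' τ, τ ∈ TB n b (Hh K) (c K) → τ ∈ TB n b (Hh K') (c K') → K = K' := by
    intro K K' τ h h'
    rcases lt_trichotomy K K' with hl | hl | hl
    · exact absurd h' (TB_disj hb ((hthr K).trans (hct K)) (hcm hl) h)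
    · exact hl
    · exact absurd h (TB_disj hb ((hthr K').trans (hct K')) (hcm hl) h')
  set P : Tl n → Prop := fun τ => ∃ K, τ ∈ TB n b (Hh K) (c K) ∧ pt K τ with hP
  set Dt : Tl n → Finset Γ := fun τ => if P τ then F τ else {x0 τ} with hDt
  have hDs : ∀ τ, Dt τ ⊆ F τ := by
    intro τ; simp only [hDt]; split_ifs
    · exact subset_rfl
    · exact singleton_subset_iff.2 (hx0 τ)
  have hx0D : ∀ τ, x0 τ ∈ Dt τ := by
    intro τ; simp only [hDt]; split_ifs
    · exact hx0 τ
    · exact mem_singleton_self _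
  refine ⟨{x | x ∈ Dt (tile b ζ ξ x)}, fun τ => ⟨x0 τ, ?_, hF2 _ _ (hx0 τ)⟩, ?_⟩
  · change x0 τ ∈ Dt (tile b ζ ξ (x0 τ))
    rw [hF2 _ _ (hx0 τ)]; exact hx0D τ
  · intro K dd ψ hK G hinv hψ hrange hK1 hK2
    obtain ⟨K, rfl⟩ : ∃ K', K = K' + 1 := ⟨K - 1, by omega⟩
    refine hpat K dd ψ G hinv hψ hK1 hK2 fun τ hτ => ?_
    have e1 : ψ '' {x | tile b ζ ξ (ψ x) = τ} = (Dt τ : Set Γ) := by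
      ext y
      constructor
      · rintro ⟨x, hx, rfl⟩
        have : ψ x ∈ {x | x ∈ Dt (tile b ζ ξ x)} := by rw [← hrange]; exact ⟨x, rfl⟩
        change ψ x ∈ Dt (tile b ζ ξ (ψ x)) at this
        rwa [show tile b ζ ξ (ψ x) = τ from hx] at this
      · intro hy
        have hyt := hF2 _ _ (hDs τ hy)
        have : y ∈ {x | x ∈ Dt (tile b ζ ξ x)} := by
          change y ∈ Dt (tile b ζ ξ y); rw [hyt]; exact hy
        rw [← hrange] at this
        obtain ⟨x, rfl⟩ := this
        exact ⟨x, hyt, rfl⟩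
    rw [← Set.ncard_image_of_injective _ hψ, e1, Set.ncard_coe_finset]
    have e2 : P τ ↔ pt K τ := by
      constructor
      · rintro ⟨K', h1, h2⟩
        rwa [disj K K' τ hτ h1]
      · exact fun h => ⟨K, hτ, h⟩
    simp only [hDt, e2]
    split_ifs
    · exact hF1 τ
    · simp
end NR

namespace NR
open Finset
set_option linter.unusedSectionVars false
set_option linter.unusedVariables false

variable {n : ℕ} {a : Fin n → ℝ}

/-- root coordinates of a group element -/
noncomputable def rho (g : Gphi a) (j : Fin (n + 1)) : ℝ := root a g.s j

lemma rho_mul (g h : Gphi a) (j) : rho (g * h) j = rho g j + rho h j := root_add a g.s h.s j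
lemma rho_one (j) : rho (1 : Gphi a) j = 0 := root_zero a j
lemma rho_inv (g : Gphi a) (j) : rho g⁻¹ j = - rho g j := root_neg a g.s j
lemma x_mul (g h : Gphi a) (j) : (g * h).x j = g.x j + Real.exp (rho g j) * h.x j := rfl
lemma x_one (j) : (1 : Gphi a).x j = 0 := rfl
lemma x_inv (g : Gphi a) (j) : (g⁻¹).x j = -(Real.exp (-rho g j) * g.x j) := by
  rw [← rho_inv]; rfl
lemma root_cast (s : Fin n → ℝ) (k : Fin n) : root a s k.castSucc = a k * s k := by
  simp [root]
lemma root_last' (s : Fin n → ℝ) : root a s (Fin.last n) = -∑ k, a k * s k := by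
  simp [root]
lemma rho_sum (g : Gphi a) : ∑ j, rho g j = 0 := by
  rw [Fin.sum_univ_castSucc]
  simp [rho, root_cast, root_last']

lemma g_ext (ha : ∀ i, 0 < a i) {g h : Gphi a} (hx : ∀ j, g.x j = h.x j) (hr : ∀ j, rho g j = rho h j) : g = h := by
  ext j
  · exact hx j
  · have := hr j.castSucc
    simp only [rho, root_cast] at this
    exact mul_left_cancel₀ (ha j).ne' this

noncomputable def el (a : Fin n → ℝ) (x r : Fin (n + 1) → ℝ) : Gphi a :=
  ⟨x, fun k => r k.castSucc / a k⟩

lemma el_x (x r : Fin (n + 1) → ℝ) (j) : (el a x r).x j = x j := rfl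
lemma el_rho_cast (ha : ∀ i, 0 < a i) (x r : Fin (n + 1) → ℝ) (k : Fin n) : rho (el a x r) k.castSucc = r k.castSucc := by
  simp only [rho, root_cast, el]
  have := (ha k).ne'
  field_simp
lemma el_rho (ha : ∀ i, 0 < a i) (x r : Fin (n + 1) → ℝ) (hr : ∑ j, r j = 0) (j) : rho (el a x r) j = r j := by
  induction j using Fin.lastCases with
  | cast k => exact el_rho_cast ha x r k
  | last =>
    have h1 := rho_sum (el a x r)
    rw [Fin.sum_univ_castSucc] at h1 hr
    simp only [el_rho_cast ha] at h1
    linarith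

/-- bounded elements -/
def bd (R : ℝ) (g : Gphi a) : Prop := ∀ j, |g.x j| ≤ R ∧ |rho g j| ≤ R

lemma bd.mono {R R' : ℝ} {g : Gphi a} (h : bd R g) (hR : R ≤ R') : bd R' g :=
  fun j => ⟨(h j).1.trans hR, (h j).2.trans hR⟩

lemma bd_one {R : ℝ} (hR : 0 ≤ R) : bd R (1 : Gphi a) := by
  intro j; rw [x_one, rho_one]; simp [hR]

lemma bd_mul {R R' : ℝ} {g h : Gphi a} (hg : bd R g) (hh : bd R' h) (hR : 0 ≤ R) (hR' : 0 ≤ R') :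
    bd (R + Real.exp R * R' + R') (g * h) := by
  intro j
  have e := Real.exp_pos R
  rw [x_mul, rho_mul]
  constructor
  · have : |Real.exp (rho g j) * h.x j| ≤ Real.exp R * R' := by
      rw [abs_mul, abs_of_pos (Real.exp_pos _)]
      exact mul_le_mul (Real.exp_le_exp.2 ((le_abs_self _).trans (hg j).2)) (hh j).1 (abs_nonneg _) e.le
    have := abs_add_le (g.x j) (Real.exp (rho g j) * h.x j)
    have := (hg j).1
    linarith
  · have := abs_add_le (rho g j) (rho h j)
    have := (hg j).2
    have := (hh j).2
    nlinarith

lemma bd_inv {R : ℝ} {g : Gphi a} (hg : bd R g) (hR : 0 ≤ R) : bd (Real.exp R * R + R) g⁻¹ := by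
  intro j
  have e := Real.exp_pos R
  rw [x_inv, rho_inv, abs_neg, abs_neg, abs_mul, abs_of_pos (Real.exp_pos _)]
  constructor
  · have : Real.exp (-rho g j) * |g.x j| ≤ Real.exp R * R :=
      mul_le_mul (Real.exp_le_exp.2 ((neg_le_abs _).trans (hg j).2)) (hg j).1 (abs_nonneg _) e.le
    linarith
  · have := (hg j).2
    nlinarith

lemma cont_coord : Continuous (fun g : Gphi a => (g.x, g.s)) := continuous_induced_dom

lemma cont_x (j) : Continuous (fun g : Gphi a => g.x j) :=
  (continuous_apply j).comp (continuous_fst.comp cont_coord)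
lemma cont_rho (j) : Continuous (fun g : Gphi a => rho g j) := by
  have hs : ∀ k, Continuous (fun g : Gphi a => g.s k) := fun k => (continuous_apply k).comp (continuous_snd.comp cont_coord)
  induction j using Fin.lastCases with
  | cast k => simp only [rho, root_cast]; exact continuous_const.mul (hs k)
  | last =>
    simp only [rho, root_last']
    exact (continuous_finsetSum _ fun k _ => continuous_const.mul (hs k)).neg

lemma compact_bd {C : Set (Gphi a)} (hC : IsCompact C) : ∃ R : ℝ, 0 < R ∧ ∀ c ∈ C, bd R c := by
  have h1 : ∀ j, ∃ R : ℝ, ∀ c ∈ C, |c.x j| ≤ R := fun j => hC.exists_bound_of_continuousOn (cont_x j).continuousOn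
  have h2 : ∀ j, ∃ R : ℝ, ∀ c ∈ C, |rho c j| ≤ R := fun j => hC.exists_bound_of_continuousOn (cont_rho j).continuousOn
  choose R1 h1 using h1
  choose R2 h2 using h2
  have p : ∀ i, |R1 i| + |R2 i| ≤ ∑ j, (|R1 j| + |R2 j|) := fun i =>
    single_le_sum (f := fun j => |R1 j| + |R2 j|) (fun _ _ => by positivity) (mem_univ i)
  refine ⟨∑ j, (|R1 j| + |R2 j|) + 1, by positivity, fun c hc j => ⟨?_, ?_⟩⟩
  · have := p j; have := h1 j c hc; have := le_abs_self (R1 j); have := abs_nonneg (R2 j); linarith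
  · have := p j; have := h2 j c hc; have := le_abs_self (R2 j); have := abs_nonneg (R1 j); linarith

lemma coarse {Γ : Subgroup (Gphi a)} (hcocompact : ∃ C : Set (Gphi a), IsCompact C ∧
      ∀ g : Gphi a, ∃ γ ∈ Γ, ∃ c ∈ C, g = γ * c) :
    ∃ R : ℝ, 0 < R ∧ ∀ g : Gphi a, ∃ γ ∈ Γ, ∃ c, bd R c ∧ g = γ * c := by
  obtain ⟨C, hC, h⟩ := hcocompact
  obtain ⟨R, hR, hb⟩ := compact_bd hC
  refine ⟨R, hR, fun g => ?_⟩
  obtain ⟨γ, hγ, c, hc, e⟩ := h g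
  exact ⟨γ, hγ, c, hb c hc, e⟩

lemma disc_one (ha : ∀ i, 0 < a i) {Γ : Subgroup (Gphi a)}
    (hdiscrete : ∀ γ ∈ Γ, ∃ U : Set (Gphi a), IsOpen U ∧ U ∩ (Γ : Set (Gphi a)) = {γ}) :
    ∃ ε : ℝ, 0 < ε ∧ ∀ γ ∈ Γ, (∀ j, |γ.x j| < ε ∧ |rho γ j| < ε) → γ = 1 := by
  obtain ⟨U, hU, e⟩ := hdiscrete 1 Γ.one_mem
  obtain ⟨V, hV, rfl⟩ := isOpen_induced_iff.1 hU
  have h1 : (1 : Gphi a) ∈ (fun g : Gphi a => (g.x, g.s)) ⁻¹' V := by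
    have : (1 : Gphi a) ∈ (fun g : Gphi a => (g.x, g.s)) ⁻¹' V ∩ (Γ : Set (Gphi a)) := by rw [e]; rfl
    exact this.1
  obtain ⟨ε, hε, hb⟩ := Metric.isOpen_iff.1 hV _ h1
  obtain ⟨m, hm, hma⟩ : ∃ m : ℝ, 0 < m ∧ ∀ i, m ≤ a i := by
    rcases isEmpty_or_nonempty (Fin n) with h | h
    · exact ⟨1, one_pos, fun i => isEmptyElim i⟩
    · obtain ⟨i, hi⟩ := Finite.exists_min a
      exact ⟨a i, ha i, hi⟩
  refine ⟨min ε (ε * m), lt_min hε (mul_pos hε hm), fun γ hγ h => ?_⟩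
  have : γ ∈ (fun g : Gphi a => (g.x, g.s)) ⁻¹' V ∩ (Γ : Set (Gphi a)) := by
    refine ⟨hb ?_, hγ⟩
    rw [Metric.mem_ball, Prod.dist_eq, max_lt_iff]
    constructor
    · rw [dist_pi_lt_iff hε]
      intro j
      have := (h j).1.trans_le (min_le_left _ _)
      simpa [Real.dist_eq, x_one] using this
    · rw [dist_pi_lt_iff hε]
      intro j
      have := (h j.castSucc).2.trans_le (min_le_right _ _)
      simp only [rho, root_cast, abs_mul, abs_of_pos (ha j)] at this
      have h0 : (1 : Gphi a).s j = 0 := rfl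
      change |γ.s j - (1 : Gphi a).s j| < ε
      rw [h0, sub_zero]
      have h3 : m * |γ.s j| ≤ a j * |γ.s j| := mul_le_mul_of_nonneg_right (hma j) (abs_nonneg _)
      by_contra hc
      push Not at hc
      nlinarith
  rw [e] at this
  exact this

lemma fin_bd (ha : ∀ i, 0 < a i) {Γ : Subgroup (Gphi a)}
    (hdiscrete : ∀ γ ∈ Γ, ∃ U : Set (Gphi a), IsOpen U ∧ U ∩ (Γ : Set (Gphi a)) = {γ}) (R : ℝ) :
    {γ : Gphi a | γ ∈ Γ ∧ bd R γ}.Finite := by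
  obtain ⟨ε, hε, h1⟩ := disc_one ha hdiscrete
  have eR := Real.exp_pos R
  set δ : ℝ := min ε (ε / Real.exp R) with hδ
  have hδ0 : 0 < δ := lt_min hε (div_pos hε eR)
  set N : ℤ := ⌈R / δ⌉ + 1
  set f : Gphi a → (Fin (n + 1) → ℤ) × (Fin (n + 1) → ℤ) := fun g => (fun j => ⌊g.x j / δ⌋, fun j => ⌊rho g j / δ⌋) with hf
  have hfl : ∀ y : ℝ, |y| ≤ R → ⌊y / δ⌋ ∈ Set.Icc (-N) N := by
    intro y hy
    have h2 := abs_le.1 hy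
    have h3 : y / δ ≤ R / δ := by gcongr; exact h2.2
    have h4 : -(R / δ) ≤ y / δ := by rw [← neg_div]; gcongr; exact h2.1
    have h5 := Int.le_ceil (R / δ)
    constructor
    · rw [Int.le_floor]; simp only [N]; push_cast; linarith
    · rw [← Int.lt_add_one_iff, Int.floor_lt]; simp only [N]; push_cast; linarith
  have hcl : ∀ y z : ℝ, ⌊y / δ⌋ = ⌊z / δ⌋ → |y - z| < δ := by
    intro y z h
    have := Int.abs_sub_lt_one_of_floor_eq_floor h
    rw [← sub_div, abs_div, abs_of_pos hδ0, div_lt_one hδ0] at this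
    exact this
  refine Set.Finite.of_injOn (f := f) (t := Set.Icc (fun _ => -N) (fun _ => N) ×ˢ Set.Icc (fun _ => -N) (fun _ => N)) ?_ ?_
    ((Set.finite_Icc _ _).prod (Set.finite_Icc _ _))
  · rintro g ⟨-, hg⟩
    refine ⟨⟨fun j => ?_, fun j => ?_⟩, ⟨fun j => ?_, fun j => ?_⟩⟩
    · exact (hfl _ (hg j).1).1
    · exact (hfl _ (hg j).1).2
    · exact (hfl _ (hg j).2).1
    · exact (hfl _ (hg j).2).2
  · rintro g ⟨hgΓ, hg⟩ h ⟨hhΓ, hh⟩ e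
    have e1 : ∀ j, |h.x j - g.x j| < δ := fun j => hcl _ _ (congrFun (congrArg Prod.fst e) j).symm
    have e2 : ∀ j, |rho h j - rho g j| < δ := fun j => hcl _ _ (congrFun (congrArg Prod.snd e) j).symm
    have := h1 (g⁻¹ * h) (Γ.mul_mem (Γ.inv_mem hgΓ) hhΓ) fun j => by
      rw [x_mul, rho_mul, x_inv, rho_inv]
      constructor
      · rw [show -(Real.exp (-rho g j) * g.x j) + Real.exp (-rho g j) * h.x j = Real.exp (-rho g j) * (h.x j - g.x j) by ring,
          abs_mul, abs_of_pos (Real.exp_pos _)]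
        have : Real.exp (-rho g j) ≤ Real.exp R := Real.exp_le_exp.2 ((neg_le_abs _).trans (hg j).2)
        calc _ ≤ Real.exp R * |h.x j - g.x j| := by gcongr
          _ < Real.exp R * δ := by gcongr; exact e1 j
          _ ≤ Real.exp R * (ε / Real.exp R) := by gcongr; exact min_le_right _ _
          _ = ε := by field_simp
      · rw [show -rho g j + rho h j = rho h j - rho g j by ring]
        exact (e2 j).trans_le (min_le_left _ _)
    exact inv_mul_eq_one.1 this
end NR

namespace NR
open Finset
set_option linter.unusedSectionVars false
set_option linter.unusedVariables false

section word
variable {G : Type*} [Group G]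

/-- a word in `S` and inverses -/
def Wd (S : Set G) (l : List G) : Prop := ∀ w ∈ l, w ∈ S ∨ w⁻¹ ∈ S

lemma wd_exists (S : Set G) {g : G} (hg : g ∈ Subgroup.closure S) : ∃ l, Wd S l ∧ g = l.prod := by
  have hg' : g ∈ (Subgroup.closure S).toSubmonoid := hg
  rw [Subgroup.closure_toSubmonoid] at hg'
  obtain ⟨l, h1, h2⟩ := Submonoid.exists_list_of_mem_closure hg'
  exact ⟨l, h1, h2.symm⟩

lemma wordDist_spec (S : Set G) {g h : G} (hg : g⁻¹ * h ∈ Subgroup.closure S) :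
    ∃ l, l.length = wordDist S g h ∧ Wd S l ∧ g⁻¹ * h = l.prod := by
  have : wordDist S g h ∈ {n : ℕ | ∃ l : List G, l.length = n ∧ (∀ w ∈ l, w ∈ S ∨ w⁻¹ ∈ S) ∧ g⁻¹ * h = l.prod} := by
    apply Nat.sInf_mem
    obtain ⟨l, h1, h2⟩ := wd_exists S hg
    exact ⟨l.length, l, rfl, h1, h2⟩
  exact this

lemma wordDist_le (S : Set G) {g h : G} (l : List G) (h1 : Wd S l) (h2 : g⁻¹ * h = l.prod) :
    wordDist S g h ≤ l.length := Nat.sInf_le ⟨l, rfl, h1, h2⟩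

lemma wordDist_self (S : Set G) (g : G) : wordDist S g g = 0 := by
  have := wordDist_le S (g := g) (h := g) [] (by intro w hw; simp at hw) (by simp)
  simpa using this

lemma wordDist_inv (S : Set G) (k g h : G) : wordDist S (k * g) (k * h) = wordDist S g h := by
  unfold wordDist
  have : (k * g)⁻¹ * (k * h) = g⁻¹ * h := by group
  rw [this]

lemma Wd_inv {S : Set G} {l : List G} (h : Wd S l) : Wd S (l.map (·⁻¹)).reverse := by
  intro w hw
  simp only [List.mem_reverse, List.mem_map] at hw
  obtain ⟨v, hv, rfl⟩ := hw
  rw [inv_inv]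
  exact (h v hv).symm

lemma Wd_app {S : Set G} {l l' : List G} (h : Wd S l) (h' : Wd S l') : Wd S (l ++ l') := by
  intro w hw
  rcases List.mem_append.1 hw with hw | hw
  · exact h w hw
  · exact h' w hw

variable {S : Set G} {Γ : Subgroup G}

lemma wd_spec' (hS : Subgroup.closure S = Γ) {g h : G} (hg : g ∈ Γ) (hh : h ∈ Γ) :
    ∃ l, l.length = wordDist S g h ∧ Wd S l ∧ g⁻¹ * h = l.prod :=
  wordDist_spec S (by rw [hS]; exact Γ.mul_mem (Γ.inv_mem hg) hh)

lemma wd_symm_le (hS : Subgroup.closure S = Γ) {g h : G} (hg : g ∈ Γ) (hh : h ∈ Γ) : wordDist S h g ≤ wordDist S g h := by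
  obtain ⟨l, h1, h2, h3⟩ := wd_spec' hS hg hh
  have := wordDist_le S (g := h) (h := g) _ (Wd_inv h2) (by
    rw [← List.prod_inv_reverse, ← h3]; group)
  simpa [h1] using this

lemma wd_tri (hS : Subgroup.closure S = Γ) {g h k : G} (hg : g ∈ Γ) (hh : h ∈ Γ) (hk : k ∈ Γ) :
    wordDist S g k ≤ wordDist S g h + wordDist S h k := by
  obtain ⟨l, h1, h2, h3⟩ := wd_spec' hS hg hh
  obtain ⟨l', h1', h2', h3'⟩ := wd_spec' hS hh hk
  have := wordDist_le S (g := g) (h := k) _ (Wd_app h2 h2') (by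
    rw [List.prod_append, ← h3, ← h3']; group)
  simpa [h1, h1'] using this
end word

lemma wd_growth {G : Type*} [Group G] {S : Finset G} {Γ : Subgroup G} (hS : Subgroup.closure (S : Set G) = Γ)
    {A : ℕ} (hA : 2 * S.card + 1 ≤ A) (p : Γ) (m : ℕ) (F : Finset Γ)
    (hF : ∀ q ∈ F, wordDist (S : Set G) p.1 q.1 ≤ m) : F.card ≤ A ^ m := by
  classical
  set T : Finset G := insert 1 (S ∪ S.image (·⁻¹)) with hT
  have hTc : T.card ≤ A := by
    refine (card_insert_le _ _).trans ?_
    have := card_union_le S (S.image (·⁻¹))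
    have : (S.image (·⁻¹)).card ≤ S.card := card_image_le
    omega
  set I : Finset G := (Fintype.piFinset fun _ : Fin m => T).image fun v => p.1 * (List.ofFn v).prod with hI
  have hIc : I.card ≤ A ^ m := by
    refine card_image_le.trans ?_
    rw [Fintype.card_piFinset]
    simp only [prod_const, card_univ, Fintype.card_fin]
    exact Nat.pow_le_pow_left hTc m
  refine le_trans ?_ hIc
  rw [← card_image_of_injective F Subtype.val_injective]
  refine card_le_card fun g hg => ?_
  obtain ⟨q, hq, rfl⟩ := mem_image.1 hg
  obtain ⟨l, h1, h2, h3⟩ := wd_spec' hS p.2 q.2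
  have hm := hF q hq
  rw [← h1] at hm
  set l' := l ++ List.replicate (m - l.length) 1 with hl'
  have hlen : l'.length = m := by simp [hl']; omega
  have hprod : l'.prod = l.prod := by simp [hl']
  refine mem_image.2 ⟨fun i => l'.get (Fin.cast hlen.symm i), ?_, ?_⟩
  · rw [Fintype.mem_piFinset]
    intro i
    have hmem : l'.get (Fin.cast hlen.symm i) ∈ l' := List.get_mem _ _
    rcases List.mem_append.1 hmem with h | h
    · rcases h2 _ h with h | h
      · exact mem_insert_of_mem (mem_union_left _ h)
      · exact mem_insert_of_mem (mem_union_right _ (mem_image.2 ⟨_, h, inv_inv _⟩))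
    · rw [List.eq_of_mem_replicate h]; exact mem_insert_self _ _
  · have : List.ofFn (fun i => l'.get (Fin.cast hlen.symm i)) = l' := by
      apply List.ext_get
      · simp [hlen]
      · intro k h1 h2; simp
    simp only [this]
    rw [hprod, ← h3]; group

variable {n : ℕ} {a : Fin n → ℝ}

/-- products of at most `k` elements bounded by `R` -/
def Pb (R : ℝ) (k : ℕ) (g : Gphi a) : Prop := ∃ l : List (Gphi a), l.length ≤ k ∧ (∀ w ∈ l, bd R w) ∧ g = l.prod

lemma Pb.mul {R : ℝ} {k k' : ℕ} {g h : Gphi a} (hg : Pb R k g) (hh : Pb R k' h) : Pb R (k + k') (g * h) := by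
  obtain ⟨l, h1, h2, rfl⟩ := hg
  obtain ⟨l', h1', h2', rfl⟩ := hh
  refine ⟨l ++ l', by simp; omega, ?_, by simp⟩
  intro w hw
  rcases List.mem_append.1 hw with hw | hw
  · exact h2 w hw
  · exact h2' w hw

lemma Pb.pow {R : ℝ} {g : Gphi a} (hg : bd R g) (m : ℕ) : Pb R m (g ^ m) :=
  ⟨List.replicate m g, by simp, fun w hw => by rw [List.eq_of_mem_replicate hw]; exact hg, by simp⟩

lemma Pb.one' {R : ℝ} : Pb R 0 (1 : Gphi a) := ⟨[], by simp, by simp, by simp⟩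
lemma Pb.single {R : ℝ} {g : Gphi a} (hg : bd R g) : Pb R 1 g := by simpa using Pb.pow hg 1
lemma Pb.mono {R : ℝ} {k k' : ℕ} {g : Gphi a} (hg : Pb R k g) (h : k ≤ k') : Pb R k' g := by
  obtain ⟨l, h1, h2, e⟩ := hg
  exact ⟨l, h1.trans h, h2, e⟩

lemma pow_rho (g : Gphi a) (m : ℕ) (j) : rho (g ^ m) j = m * rho g j := by
  induction m with
  | zero => simp [rho_one]
  | succ m ih => rw [pow_succ, rho_mul, ih]; push_cast; ring

lemma pow_x0 (g : Gphi a) (hg : ∀ j, g.x j = 0) (m : ℕ) (j) : (g ^ m).x j = 0 := by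
  induction m with
  | zero => simp [x_one]
  | succ m ih => rw [pow_succ, x_mul, ih, hg]; simp

lemma dec_rho (ha : ∀ i, 0 < a i) {L : ℝ} {M : ℕ} (hM : 1 ≤ M) (h : Gphi a) (hx : ∀ j, h.x j = 0)
    (hr : ∀ j, |rho h j| ≤ L * M) (hL : 0 ≤ L) : Pb L M h := by
  have hM' : (0 : ℝ) < M := by exact_mod_cast hM
  set g := el a (fun _ => 0) (fun j => rho h j / M) with hg
  have hgr : ∀ j, rho g j = rho h j / M := el_rho ha _ _ (by rw [← sum_div, rho_sum, zero_div])
  have e : h = g ^ M := by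
    refine g_ext ha (fun j => ?_) (fun j => ?_)
    · rw [hx, pow_x0 g (fun _ => rfl)]
    · rw [pow_rho, hgr]; field_simp
  rw [e]
  refine Pb.pow (fun j => ⟨?_, ?_⟩) M
  · rw [show g.x j = 0 from rfl]; simpa using hL
  · rw [hgr, abs_div, abs_of_pos hM', div_le_iff₀ hM']; exact hr j

lemma dec_x (hn : 1 ≤ n) (ha : ∀ i, 0 < a i) {L : ℝ} {M : ℕ} (hL : 1 ≤ L) (j : Fin (n + 1)) (y : ℝ)
    (hy : |y| ≤ Real.exp (M * L)) : Pb L (2 * M + 1) (el a (Pi.single j y) (fun _ => 0)) := by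
  obtain ⟨j', hj'⟩ : ∃ j' : Fin (n + 1), j' ≠ j := by
    have : Nontrivial (Fin (n + 1)) := Fin.nontrivial_iff_two_le.2 (by omega)
    exact exists_ne j
  set r : Fin (n + 1) → ℝ := Pi.single j L - Pi.single j' L with hr
  have hrs : ∑ i, r i = 0 := by simp [hr, sum_sub_distrib]
  have hrj : r j = L := by simp [hr, Pi.single_eq_of_ne hj'.symm]
  have hrb : ∀ i, |r i| ≤ L := by
    intro i
    simp only [hr, Pi.sub_apply, Pi.single_apply]
    split_ifs with h1 h2 h2
    · simp; linarith
    · simp [abs_of_nonneg (by linarith : (0:ℝ) ≤ L)]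
    · simp [abs_of_nonneg (by linarith : (0:ℝ) ≤ L)]
    · simp; linarith
  set g := el a (fun _ => 0) r with hg
  set g' := el a (fun _ => 0) (-r) with hg'
  have hgr : ∀ i, rho g i = r i := el_rho ha _ _ hrs
  have hgr' : ∀ i, rho g' i = - r i := el_rho ha _ _ (by simp [hrs])
  set u := el a (Pi.single j (y * Real.exp (-(M * L)))) (fun _ => 0) with hu
  have hur : ∀ i, rho u i = 0 := el_rho ha _ _ (by simp)
  have e : el a (Pi.single j y) (fun _ => 0) = g ^ M * u * g' ^ M := by
    refine g_ext ha (fun i => ?_) (fun i => ?_)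
    · rw [x_mul, x_mul, pow_x0 g (fun _ => rfl), pow_x0 g' (fun _ => rfl), pow_rho, hgr, mul_zero, add_zero, zero_add, el_x, hu, el_x]
      by_cases h : i = j
      · subst h
        rw [hrj, Pi.single_eq_same, Pi.single_eq_same, mul_left_comm, ← Real.exp_add]; simp
      · rw [Pi.single_eq_of_ne h, Pi.single_eq_of_ne h, mul_zero]
    · rw [rho_mul, rho_mul, pow_rho, pow_rho, hur, hgr, hgr', el_rho ha _ _ (by simp)]; ring
  rw [e]
  have b1 : bd L g := fun i => ⟨by rw [show g.x i = 0 from rfl]; simp; linarith, by rw [hgr]; exact hrb i⟩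
  have b2 : bd L g' := fun i => ⟨by rw [show g'.x i = 0 from rfl]; simp; linarith, by rw [hgr', abs_neg]; exact hrb i⟩
  have b3 : bd L u := by
    intro i
    rw [hur]
    refine ⟨?_, by simp; linarith⟩
    rw [hu, el_x]
    by_cases h : i = j
    · subst h
      rw [Pi.single_eq_same, abs_mul, abs_of_pos (Real.exp_pos _)]
      calc _ ≤ Real.exp (M * L) * Real.exp (-(M * L)) := by gcongr
        _ = 1 := by rw [← Real.exp_add]; simp
        _ ≤ L := hL
    · rw [Pi.single_eq_of_ne h]; simp; linarith
  exact (((Pb.pow b1 M).mul (Pb.single b3)).mul (Pb.pow b2 M)).mono (by omega)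

lemma dec_xs (hn : 1 ≤ n) (ha : ∀ i, 0 < a i) {L : ℝ} {M : ℕ} (hL : 1 ≤ L) (x : Fin (n + 1) → ℝ)
    (hx : ∀ j, |x j| ≤ Real.exp (M * L)) (F : Finset (Fin (n + 1))) :
    Pb L (F.card * (2 * M + 1)) (el a (fun j => if j ∈ F then x j else 0) (fun _ => 0)) := by
  induction F using Finset.induction_on with
  | empty =>
    have : el a (fun j : Fin (n + 1) => if j ∈ (∅ : Finset (Fin (n + 1))) then x j else 0) (fun _ => 0) = 1 := by
      refine g_ext ha (fun j => ?_) (fun j => ?_)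
      · rw [el_x, x_one]; simp
      · rw [el_rho ha _ _ (by simp), rho_one]
    rw [this, card_empty, zero_mul]
    exact Pb.one'
  | insert i F hi ih =>
    have : el a (fun j : Fin (n + 1) => if j ∈ insert i F then x j else 0) (fun _ => 0)
        = el a (fun j => if j ∈ F then x j else 0) (fun _ => 0) * el a (Pi.single i (x i)) (fun _ => 0) := by
      refine g_ext ha (fun j => ?_) (fun j => ?_)
      · rw [x_mul, el_x, el_x, el_x, el_rho ha _ _ (by simp), Real.exp_zero, one_mul]
        by_cases h : j = i
        · subst h; simp [hi]
        · simp [h]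
      · rw [rho_mul, el_rho ha _ _ (by simp), el_rho ha _ _ (by simp), el_rho ha _ _ (by simp)]; simp
    rw [this, card_insert_of_notMem hi]
    exact (ih.mul (dec_x hn ha hL i (x i) (hx i))).mono (by ring_nf; omega)

lemma dec (hn : 1 ≤ n) (ha : ∀ i, 0 < a i) {L : ℝ} {M : ℕ} (hL : 1 ≤ L) (hM : 1 ≤ M) (h : Gphi a)
    (hx : ∀ j, |h.x j| ≤ Real.exp (M * L)) (hr : ∀ j, |rho h j| ≤ L * M) :
    Pb L ((n + 1) * (2 * M + 1) + M) h := by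
  have e : h = el a (fun j => if j ∈ (univ : Finset (Fin (n + 1))) then h.x j else 0) (fun _ => 0) * el a (fun _ => 0) (rho h) := by
    refine g_ext ha (fun j => ?_) (fun j => ?_)
    · rw [x_mul, el_x, el_x]; simp
    · rw [rho_mul, el_rho ha _ _ (by simp), el_rho ha _ _ (rho_sum h)]; simp
  have h1 := dec_xs hn ha hL h.x hx univ
  have h2 : Pb L M (el a (fun _ => 0) (rho h)) := dec_rho ha hM _ (fun _ => rfl)
    (fun j => by rw [el_rho ha _ _ (rho_sum h)]; exact hr j) (by linarith)
  rw [card_univ, Fintype.card_fin] at h1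
  have := h1.mul h2
  rwa [← e] at this

lemma approx {Γ : Subgroup (Gphi a)} {S : Set (Gphi a)} (hS : Subgroup.closure S = Γ) {R L R2 : ℝ} {W : ℕ} (hR : 0 < R)
    (hc : ∀ g : Gphi a, ∃ γ ∈ Γ, ∃ c, bd R c ∧ g = γ * c)
    (h2 : ∀ c u c' : Gphi a, bd R c → bd L u → bd R c' → bd R2 (c * u * c'⁻¹)) (h2' : R ≤ R2)
    (hW : ∀ γ ∈ Γ, bd R2 γ → wordDist S 1 γ ≤ W) (l : List (Gphi a)) :
    (∀ w ∈ l, bd L w) → ∀ c γ : Gphi a, bd R c → γ ∈ Γ → γ = c * l.prod → wordDist S 1 γ ≤ W * (l.length + 1) := by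
  induction l with
  | nil =>
    intro _ c γ hc hγ e
    rw [List.prod_nil, mul_one] at e
    subst e
    simpa using hW γ hγ (hc.mono h2')
  | cons u l ih =>
    intro hl c γ hcR hγ e
    obtain ⟨γ1, hγ1, c1, hc1, e1⟩ := hc (c * u)
    have e2 : γ1 = c * u * c1⁻¹ := by rw [e1]; group
    have w1 := hW γ1 hγ1 (by rw [e2]; exact h2 c u c1 hcR (hl u (by simp)) hc1)
    have w2 := ih (fun w hw => hl w (by simp [hw])) c1 (γ1⁻¹ * γ) hc1 (Γ.mul_mem (Γ.inv_mem hγ1) hγ) (by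
      rw [e, List.prod_cons, ← mul_assoc c, e1]; group)
    have w3 := wd_tri hS Γ.one_mem hγ1 hγ
    have w4 : wordDist S γ1 γ = wordDist S 1 (γ1⁻¹ * γ) := by
      rw [← wordDist_inv S γ1 1 (γ1⁻¹ * γ)]; group
    rw [w4] at w3
    have : (u :: l).length = l.length + 1 := rfl
    rw [this]
    nlinarith
end NR

namespace NR
open Finset
set_option linter.unusedSectionVars false
set_option linter.unusedVariables false

variable {n : ℕ} {a : Fin n → ℝ}

/-- integer heights -/
noncomputable def zet (b : ℕ) (g : Gphi a) : Fin (n + 1) → ℤ := ht fun k => ⌊rho g k.castSucc / Real.log b⌋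

/-- rescaled positions -/
noncomputable def xi (b : ℕ) (g : Gphi a) (j : Fin (n + 1)) : ℝ := g.x j / (b : ℝ) ^ (n + 1)

lemma zet_cast (b : ℕ) (g : Gphi a) (k : Fin n) : zet b g k.castSucc = ⌊rho g k.castSucc / Real.log b⌋ := by
  simp [zet, ht]

lemma zet_sum (b : ℕ) (g : Gphi a) : ∑ j, zet b g j = 0 := by
  rw [Fin.sum_univ_castSucc]; simp [zet, ht]

lemma zet_near (hn : 1 ≤ n) {b : ℕ} (hL : 0 < Real.log b) (g : Gphi a) (j) : |rho g j - Real.log b * zet b g j| ≤ n * Real.log b := by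
  have hn' : (1 : ℝ) ≤ n := by exact_mod_cast hn
  have hc : ∀ k : Fin n, 0 ≤ rho g k.castSucc - Real.log b * zet b g k.castSucc ∧ rho g k.castSucc - Real.log b * zet b g k.castSucc ≤ Real.log b := by
    intro k
    rw [zet_cast]
    have h1 := Int.floor_le (rho g k.castSucc / Real.log b)
    have h2 := Int.lt_floor_add_one (rho g k.castSucc / Real.log b)
    rw [le_div_iff₀ hL] at h1
    rw [div_lt_iff₀ hL] at h2
    constructor <;> nlinarith
  induction j using Fin.lastCases with
  | cast k =>
    rw [abs_of_nonneg (hc k).1]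
    have := (hc k).2
    nlinarith
  | last =>
    have h1 := rho_sum g
    have h2 := zet_sum b g
    rw [Fin.sum_univ_castSucc] at h1 h2
    have h3 : (∑ k : Fin n, (zet b g k.castSucc : ℝ)) + zet b g (Fin.last n) = 0 := by exact_mod_cast h2
    have e : rho g (Fin.last n) - Real.log b * zet b g (Fin.last n) = -∑ k : Fin n, (rho g k.castSucc - Real.log b * zet b g k.castSucc) := by
      rw [sum_sub_distrib, ← mul_sum]
      linear_combination h1 - Real.log b * h3
    rw [e, abs_neg, abs_of_nonneg (sum_nonneg fun k _ => (hc k).1)]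
    calc _ ≤ ∑ k : Fin n, Real.log b := sum_le_sum fun k _ => (hc k).2
      _ = n * Real.log b := by simp

lemma zpow_exp {b : ℕ} (hb : 2 ≤ b) (m : ℤ) : (b : ℝ) ^ m = Real.exp (Real.log b * m) := by
  have : (0 : ℝ) < b := by exact_mod_cast (by omega : 0 < b)
  rw [← Real.rpow_intCast, Real.rpow_def_of_pos this]

lemma exp_rho_le (hn : 1 ≤ n) {b : ℕ} (hb : 2 ≤ b) (hL : 0 < Real.log b) (g : Gphi a) (j) : Real.exp (rho g j) ≤ (b : ℝ) ^ (zet b g j + n) := by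
  rw [zpow_exp hb, Real.exp_le_exp]
  have := (abs_le.1 (zet_near hn hL g j)).2
  push_cast; linarith

lemma exp_neg_rho_le (hn : 1 ≤ n) {b : ℕ} (hb : 2 ≤ b) (hL : 0 < Real.log b) (g : Gphi a) (j) : Real.exp (-rho g j) ≤ (b : ℝ) ^ (-zet b g j + n) := by
  rw [zpow_exp hb, Real.exp_le_exp]
  have := (abs_le.1 (zet_near hn hL g j)).1
  push_cast; linarith

lemma list_bd {R : ℝ} (hR : 0 ≤ R) (l : List (Gphi a)) (hl : ∀ w ∈ l, bd R w) (j) :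
    |rho l.prod j| ≤ R * l.length ∧ |l.prod.x j| ≤ Real.exp (2 * R * l.length) - 1 := by
  induction l with
  | nil => simp [rho_one, x_one]
  | cons w l ih =>
    obtain ⟨h1, h2⟩ := ih fun w hw => hl w (by simp [hw])
    obtain ⟨h3, h4⟩ := hl w (by simp) j
    rw [List.prod_cons, rho_mul, x_mul, List.length_cons]
    push_cast
    constructor
    · have := abs_add_le (rho w j) (rho l.prod j)
      nlinarith
    · have e1 : |Real.exp (rho w j) * l.prod.x j| ≤ Real.exp R * (Real.exp (2 * R * l.length) - 1) := by
        rw [abs_mul, abs_of_pos (Real.exp_pos _)]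
        exact mul_le_mul (Real.exp_le_exp.2 ((le_abs_self _).trans h4)) h2 (abs_nonneg _) (Real.exp_pos _).le
      have e2 := abs_add_le (w.x j) (Real.exp (rho w j) * l.prod.x j)
      have e3 := Real.add_one_le_exp R
      have e4 : Real.exp R * Real.exp (2 * R * l.length) ≤ Real.exp (2 * R * (l.length + 1)) := by
        rw [← Real.exp_add, Real.exp_le_exp]; nlinarith
      rw [mul_sub, mul_one] at e1
      linarith

/-- The word metric satisfies the geometric model. -/
theorem gm_word (hn : 1 ≤ n) (ha : ∀ i, 0 < a i) {Γ : Subgroup (Gphi a)}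
    (hdiscrete : ∀ γ ∈ Γ, ∃ U : Set (Gphi a), IsOpen U ∧ U ∩ (Γ : Set (Gphi a)) = {γ})
    {R : ℝ} (hR : 0 < R) (hc : ∀ g : Gphi a, ∃ γ ∈ Γ, ∃ c, bd R c ∧ g = γ * c)
    {b : ℕ} (hb : 2 ≤ b) (hL : 1 ≤ Real.log b) (S : Finset (Gphi a))
    (hS : Subgroup.closure (S : Set (Gphi a)) = Γ) :
    ∃ A : ℕ, GM b (fun p : Γ => zet b p.1) (fun p : Γ => xi b p.1)
      (fun p q : Γ => wordDist (S : Set (Gphi a)) p.1 q.1) A := by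
  classical
  have hL0 : 0 < Real.log b := by linarith
  have hb0 : (0 : ℝ) < b := by exact_mod_cast (by omega : 0 < b)
  have hb1 : (1 : ℝ) ≤ b := by exact_mod_cast (by omega : 1 ≤ b)
  set L := Real.log b with hLdef
  have fin_le : ∀ (T : Set (Gphi a)), T.Finite → ∀ f : Gphi a → ℕ, ∃ W : ℕ, ∀ γ ∈ T, f γ ≤ W := by
    intro T hT f
    obtain ⟨W, hW⟩ := (hT.image f).bddAbove
    exact ⟨W, fun γ hγ => hW ⟨γ, hγ, rfl⟩⟩
  -- generators are bounded
  obtain ⟨RS, hRS0, hRS⟩ : ∃ RS : ℝ, 0 ≤ RS ∧ ∀ w : Gphi a, w ∈ (S : Set (Gphi a)) ∨ w⁻¹ ∈ (S : Set (Gphi a)) → bd RS w := by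
    have hfin : {w : Gphi a | w ∈ (S : Set (Gphi a)) ∨ w⁻¹ ∈ (S : Set (Gphi a))}.Finite := by
      have h1 : {w : Gphi a | w⁻¹ ∈ (S : Set (Gphi a))}.Finite :=
        Set.Finite.preimage (inv_injective.injOn) S.finite_toSet
      exact S.finite_toSet.union h1
    obtain ⟨W, hW⟩ := fin_le _ hfin (fun w => ∑ j, (⌈|w.x j|⌉₊ + ⌈|rho w j|⌉₊))
    refine ⟨W, Nat.cast_nonneg _, fun w hw j => ?_⟩
    have h1 : ∑ j, (⌈|w.x j|⌉₊ + ⌈|rho w j|⌉₊) ≤ W := hW w hw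
    have h2 := single_le_sum (f := fun j => ⌈|w.x j|⌉₊ + ⌈|rho w j|⌉₊) (fun _ _ => Nat.zero_le _) (mem_univ j)
    constructor
    · exact (Nat.le_ceil _).trans (by exact_mod_cast (by omega))
    · exact (Nat.le_ceil _).trans (by exact_mod_cast (by omega))
  obtain ⟨R2, hR2, hR2'⟩ : ∃ R2 : ℝ, (∀ c u c' : Gphi a, bd R c → bd L u → bd R c' → bd R2 (c * u * c'⁻¹)) ∧ R ≤ R2 := by
    set Q := (R + Real.exp R * L + L) + Real.exp (R + Real.exp R * L + L) * (Real.exp R * R + R) + (Real.exp R * R + R) with hQ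
    have : 0 < Q := by positivity
    refine ⟨Q + R, fun c u c' h1 h2 h3 => ?_, by linarith⟩
    exact (bd_mul (bd_mul h1 h2 hR.le hL0.le) (bd_inv h3 hR.le) (by positivity) (by positivity)).mono (by linarith)
  obtain ⟨W, hW⟩ := fin_le _ (fin_bd ha hdiscrete R2) (fun γ => wordDist (S : Set (Gphi a)) 1 γ)
  set A : ℕ := (2 * S.card + 1) + (2 * n + ⌈2 * RS⌉₊) + W * ((n + 1) * (4 * n + 5) + (2 * n + 1) + 1) with hA
  have hA1 : 2 * n + 2 * RS ≤ A := by
    have h1 := Nat.le_ceil (2 * RS)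
    have h2 : 2 * n + ⌈2 * RS⌉₊ ≤ A := by rw [hA]; omega
    have h3 : (2 * n + ⌈2 * RS⌉₊ : ℝ) ≤ A := by exact_mod_cast h2
    linarith
  have key : ∀ p q : Γ, ∀ j, |rho (p.1⁻¹ * q.1) j| ≤ RS * wordDist (S : Set (Gphi a)) p.1 q.1 ∧
      |(p.1⁻¹ * q.1).x j| ≤ Real.exp (2 * RS * wordDist (S : Set (Gphi a)) p.1 q.1) - 1 := by
    intro p q j
    obtain ⟨l, h1, h2, h3⟩ := wd_spec' hS p.2 q.2
    have := list_bd hRS0 l (fun w hw => hRS w (h2 w hw)) j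
    rw [← h3, h1] at this
    exact this
  refine ⟨A, ⟨fun p => wordDist_self _ _, fun p q => le_antisymm (wd_symm_le hS q.2 p.2) (wd_symm_le hS p.2 q.2),
    fun p q r => wd_tri hS p.2 q.2 r.2, fun p m F hF => wd_growth hS (by rw [hA]; omega) p m F hF, ?_, ?_, ?_⟩⟩
  · intro p q j
    change |zet b p.1 j - zet b q.1 j| ≤ ((A * wordDist (S : Set (Gphi a)) p.1 q.1 : ℕ) : ℤ)
    rcases Nat.eq_zero_or_pos (wordDist (S : Set (Gphi a)) p.1 q.1) with h0 | h0
    · obtain ⟨l, h1, h2, h3⟩ := wd_spec' hS p.2 q.2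
      rw [h0, List.length_eq_zero_iff] at h1
      subst h1
      rw [List.prod_nil, inv_mul_eq_one] at h3
      rw [h3, sub_self, abs_zero]; positivity
    · have h1 := (key p q j).1
      set d := wordDist (S : Set (Gphi a)) p.1 q.1
      have hd : (1 : ℝ) ≤ d := by exact_mod_cast h0
      rw [rho_mul, rho_inv] at h1
      have h2 := abs_le.1 (zet_near hn hL0 p.1 j)
      have h3 := abs_le.1 (zet_near hn hL0 q.1 j)
      have h4 := abs_le.1 h1
      have h5 : RS * d ≤ L * (RS * d) := by nlinarith [mul_nonneg hRS0 (by linarith : (0:ℝ) ≤ d)]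
      have h6 : |((zet b p.1 j : ℤ) : ℝ) - zet b q.1 j| ≤ 2 * n + RS * d := by
        rw [abs_le]
        constructor
        · have : L * (-(2 * n + RS * d)) ≤ L * ((zet b p.1 j : ℝ) - zet b q.1 j) := by linarith [h2.1, h2.2, h3.1, h3.2, h4.1, h4.2]
          exact le_of_mul_le_mul_left this hL0
        · have : L * ((zet b p.1 j : ℝ) - zet b q.1 j) ≤ L * (2 * n + RS * d) := by linarith [h2.1, h2.2, h3.1, h3.2, h4.1, h4.2]
          exact le_of_mul_le_mul_left this hL0
      have h7 : (2 * n + RS * d : ℝ) ≤ A * d := by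
        have : (2 * n + 2 * RS) * (d : ℝ) ≤ A * d := by gcongr
        have hn0 : (0 : ℝ) ≤ n := Nat.cast_nonneg _
        nlinarith [mul_nonneg hRS0 (by linarith : (0:ℝ) ≤ d)]
      have := h6.trans h7
      exact_mod_cast this
  · intro p q j
    change |xi b p.1 j - xi b q.1 j| ≤ (b : ℝ) ^ (zet b p.1 j + ((A * wordDist (S : Set (Gphi a)) p.1 q.1 : ℕ) : ℤ))
    have h1 := (key p q j).2
    set d := wordDist (S : Set (Gphi a)) p.1 q.1
    have h2 : q.1.x j - p.1.x j = Real.exp (rho p.1 j) * (p.1⁻¹ * q.1).x j := by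
      conv_lhs => rw [show q.1 = p.1 * (p.1⁻¹ * q.1) by group]
      rw [x_mul]; ring
    have h3 : |q.1.x j - p.1.x j| ≤ (b : ℝ) ^ (zet b p.1 j + n) * Real.exp (2 * RS * d) := by
      rw [h2, abs_mul, abs_of_pos (Real.exp_pos _)]
      exact mul_le_mul (exp_rho_le hn hb hL0 _ _) (by linarith) (abs_nonneg _) (zpow_pos' hb _).le
    have h4 : Real.exp (2 * RS * d) ≤ (b : ℝ) ^ ((A * d : ℕ) : ℤ) := by
      rw [zpow_exp hb, Real.exp_le_exp]
      push_cast
      have hd : (0 : ℝ) ≤ d := Nat.cast_nonneg _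
      have hn0 : (0 : ℝ) ≤ n := Nat.cast_nonneg _
      have : 2 * RS * d ≤ A * d := by gcongr; linarith
      have h5 : (A : ℝ) * d ≤ L * (A * d) := by
        have : (0 : ℝ) ≤ A * d := by positivity
        nlinarith
      linarith
    unfold xi
    rw [← sub_div, abs_div, abs_of_pos (by positivity : (0 : ℝ) < (b : ℝ) ^ (n + 1)), div_le_iff₀ (by positivity), abs_sub_comm]
    calc _ ≤ (b : ℝ) ^ (zet b p.1 j + n) * (b : ℝ) ^ ((A * d : ℕ) : ℤ) := h3.trans (by gcongr)
      _ ≤ (b : ℝ) ^ (zet b p.1 j + ((A * d : ℕ) : ℤ) + (n + 1 : ℕ)) := by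
        rw [← zpow_add₀ hb0.ne']
        apply zpow_mono hb; push_cast; omega
      _ = _ := by rw [zpow_add₀ hb0.ne', zpow_natCast]
  · intro p q m hz hx
    change wordDist (S : Set (Gphi a)) p.1 q.1 ≤ A * (m + 1)
    have hz' : ∀ j, |zet b p.1 j - zet b q.1 j| ≤ m := hz
    have hx' : ∀ j, |xi b p.1 j - xi b q.1 j| ≤ (b : ℝ) ^ (zet b p.1 j + m) := hx
    set M := m + 2 * n + 1 with hM
    set h := p.1⁻¹ * q.1 with hh
    have hd1 : ∀ j, |rho h j| ≤ L * M := by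
      intro j
      have h2 := abs_le.1 (zet_near hn hL0 p.1 j)
      have h3 := abs_le.1 (zet_near hn hL0 q.1 j)
      have h4 : |((zet b p.1 j : ℤ) : ℝ) - zet b q.1 j| ≤ m := by exact_mod_cast hz' j
      have h4 := abs_le.1 h4
      rw [hh, rho_mul, rho_inv, abs_le, hM]
      push_cast
      constructor <;> nlinarith [h4.1, h4.2]
    have hd2 : ∀ j, |h.x j| ≤ Real.exp (M * L) := by
      intro j
      have e : h.x j = Real.exp (-rho p.1 j) * (q.1.x j - p.1.x j) := by
        rw [hh, x_mul, x_inv, rho_inv]; ring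
      have h1 := hx' j
      unfold xi at h1
      rw [← sub_div, abs_div, abs_of_pos (by positivity : (0 : ℝ) < (b : ℝ) ^ (n + 1)), div_le_iff₀ (by positivity), abs_sub_comm] at h1
      rw [e, abs_mul, abs_of_pos (Real.exp_pos _)]
      calc _ ≤ (b : ℝ) ^ (-zet b p.1 j + n) * ((b : ℝ) ^ (zet b p.1 j + m) * (b : ℝ) ^ (n + 1)) :=
            mul_le_mul (exp_neg_rho_le hn hb hL0 _ _) h1 (abs_nonneg _) (zpow_pos' hb _).le
        _ = (b : ℝ) ^ (M : ℤ) := by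
          rw [← zpow_natCast (b : ℝ) (n + 1), ← zpow_add₀ hb0.ne', ← zpow_add₀ hb0.ne']
          congr 1; rw [hM]; push_cast; ring
        _ = _ := by rw [zpow_exp hb, mul_comm]; push_cast; rfl
    obtain ⟨l, hl1, hl2, hl3⟩ := dec hn ha hL (by omega : 1 ≤ M) h hd2 hd1
    have w := approx hS hR hc hR2 hR2' (fun γ h1 h2 => hW γ ⟨h1, h2⟩) l hl2 1 h (bd_one hR.le) (Γ.mul_mem (Γ.inv_mem p.2) q.2) (by rw [one_mul, hl3])
    have e : wordDist (S : Set (Gphi a)) p.1 q.1 = wordDist (S : Set (Gphi a)) 1 h := by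
      rw [← wordDist_inv _ p.1 1 h, hh]; congr 1 <;> group
    rw [e]
    refine w.trans ?_
    calc _ ≤ W * ((n + 1) * (2 * M + 1) + M + 1) := by gcongr
      _ ≤ W * (((n + 1) * (4 * n + 5) + (2 * n + 1) + 1) * (m + 1)) := by
        gcongr; rw [hM]; nlinarith [Nat.zero_le (n * m), Nat.zero_le (n * n * m)]
      _ ≤ A * (m + 1) := by
        rw [← mul_assoc]; gcongr; rw [hA]; omega
end NR

namespace NR
open Finset
set_option linter.unusedSectionVars false
set_option linter.unusedVariables false

variable {n : ℕ} {a : Fin n → ℝ}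

lemma point_in (hn : 1 ≤ n) (ha : ∀ i, 0 < a i) {Γ : Subgroup (Gphi a)}
    {R : ℝ} (hR : 0 < R) (hc : ∀ g : Gphi a, ∃ γ ∈ Γ, ∃ c, bd R c ∧ g = γ * c)
    {b : ℕ} (hb : 2 ≤ b) (hL : 2 * R < Real.log b) (hbR : 8 * R < b) (h : Fin n → ℤ) (i : Fin (n + 1) → ℤ) (θ : ℝ) :
    ∃ γ : Γ, zet b γ.1 = ht h ∧ ∀ j, |xi b γ.1 j / (b : ℝ) ^ (zet b γ.1 j) - (i j + θ)| < 1 / 8 := by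
  have hL0 : 0 < Real.log b := by linarith
  have hb0 : (0 : ℝ) < b := by exact_mod_cast (by omega : 0 < b)
  set L := Real.log b with hLdef
  set r : Fin (n + 1) → ℝ := Fin.snoc (fun k => L * (h k + 1 / 2)) (-∑ k, L * (h k + 1 / 2)) with hr
  have hrs : ∑ j, r j = 0 := by rw [Fin.sum_univ_castSucc]; simp [hr]
  set g := el a (fun j => (b : ℝ) ^ (n + 1) * (b : ℝ) ^ (ht h j) * (i j + θ)) r with hg
  obtain ⟨γ, hγ, c, hcR, e⟩ := hc g
  have hz : zet b γ = ht h := by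
    unfold zet
    congr 1
    funext k
    have h1 : rho γ k.castSucc = L * (h k + 1 / 2) - rho c k.castSucc := by
      have h2 : rho g k.castSucc = r k.castSucc := el_rho ha _ _ hrs _
      rw [e, rho_mul] at h2
      simp only [hr, Fin.snoc_castSucc] at h2
      linarith
    have h2 := abs_le.1 (hcR k.castSucc).2
    rw [Int.floor_eq_iff, le_div_iff₀ hL0, div_lt_iff₀ hL0, h1]
    constructor <;> nlinarith [h2.1, h2.2]
  refine ⟨⟨γ, hγ⟩, hz, fun j => ?_⟩
  change |xi b γ j / (b : ℝ) ^ (zet b γ j) - (i j + θ)| < 1 / 8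
  have hx : g.x j = γ.x j + Real.exp (rho γ j) * c.x j := by rw [e, x_mul]
  have hx2 : g.x j = (b : ℝ) ^ (n + 1) * (b : ℝ) ^ (ht h j) * (i j + θ) := rfl
  have hp := zpow_pos' hb (ht h j)
  have hq : (0 : ℝ) < (b : ℝ) ^ (n + 1) := by positivity
  have e1 : xi b γ j / (b : ℝ) ^ (zet b γ j) - (i j + θ) = -(Real.exp (rho γ j) * c.x j) / ((b : ℝ) ^ (n + 1) * (b : ℝ) ^ (ht h j)) := by
    rw [hz]; unfold xi
    rw [eq_div_iff (by positivity)]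
    have : γ.x j = (b : ℝ) ^ (n + 1) * (b : ℝ) ^ (ht h j) * (i j + θ) - Real.exp (rho γ j) * c.x j := by linarith
    rw [this]
    field_simp
    ring
  rw [e1, abs_div, abs_neg, abs_of_pos (by positivity : (0 : ℝ) < (b : ℝ) ^ (n + 1) * (b : ℝ) ^ (ht h j)), div_lt_iff₀ (by positivity),
    abs_mul, abs_of_pos (Real.exp_pos _)]
  have e2 := exp_rho_le hn hb hL0 γ j
  rw [hz] at e2
  calc _ ≤ (b : ℝ) ^ (ht h j + n) * R := mul_le_mul e2 (hcR j).1 (abs_nonneg _) (zpow_pos' hb _).le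
    _ = (b : ℝ) ^ (ht h j) * (b : ℝ) ^ n * R := by rw [zpow_add₀ hb0.ne', zpow_natCast]
    _ < (b : ℝ) ^ (ht h j) * (b : ℝ) ^ n * (1 / 8 * b) := by gcongr; linarith
    _ = _ := by rw [pow_succ]; ring

lemma three_points (hn : 1 ≤ n) (ha : ∀ i, 0 < a i) {Γ : Subgroup (Gphi a)}
    {R : ℝ} (hR : 0 < R) (hc : ∀ g : Gphi a, ∃ γ ∈ Γ, ∃ c, bd R c ∧ g = γ * c)
    {b : ℕ} (hb : 2 ≤ b) (hL : 2 * R < Real.log b) (hbR : 8 * R < b) (τ : Tl n) :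
    ∃ F : Finset Γ, F.card = 3 ∧ ∀ x ∈ F, tile b (fun p : Γ => zet b p.1) (fun p : Γ => xi b p.1) x = τ := by
  classical
  obtain ⟨h, i⟩ := τ
  have key : ∀ θ : ℝ, 1 / 8 < θ → θ < 7 / 8 → ∃ γ : Γ, tile b (fun p : Γ => zet b p.1) (fun p : Γ => xi b p.1) γ = ⟨h, i⟩ ∧
      |xi b γ.1 0 / (b : ℝ) ^ (zet b γ.1 0) - (i 0 + θ)| < 1 / 8 := by
    intro θ h1 h2
    obtain ⟨γ, h3, h4⟩ := point_in hn ha hR hc hb hL hbR h i θ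
    refine ⟨γ, ?_, h4 0⟩
    have e1 : (fun k : Fin n => zet b γ.1 k.castSucc) = h := by funext k; rw [h3, ht_cast]
    have e2 : ix b (fun p : Γ => zet b p.1) (fun p : Γ => xi b p.1) γ = i := by
      funext j
      unfold ix
      have := abs_lt.1 (h4 j)
      rw [Int.floor_eq_iff]
      constructor <;> linarith [this.1, this.2]
    unfold tile
    rw [e2]
    exact congrArg (fun v => (⟨v, i⟩ : Tl n)) e1
  obtain ⟨x, hx, hx'⟩ := key (1 / 6) (by norm_num) (by norm_num)
  obtain ⟨y, hy, hy'⟩ := key (1 / 2) (by norm_num) (by norm_num)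
  obtain ⟨z, hz, hz'⟩ := key (5 / 6) (by norm_num) (by norm_num)
  have hx' := abs_lt.1 hx'
  have hy' := abs_lt.1 hy'
  have hz' := abs_lt.1 hz'
  refine ⟨{x, y, z}, card_eq_three.2 ⟨x, y, z, ?_, ?_, ?_, rfl⟩, ?_⟩
  · rintro rfl; linarith [hx'.2, hy'.1]
  · rintro rfl; linarith [hx'.2, hz'.1]
  · rintro rfl; linarith [hy'.2, hz'.1]
  · intro w hw
    simp only [mem_insert, mem_singleton] at hw
    rcases hw with rfl | rfl | rfl <;> assumption

lemma choose_b (R : ℝ) (hR : 0 < R) : ∃ b : ℕ, 2 ≤ b ∧ Even b ∧ 1 ≤ Real.log b ∧ 2 * R < Real.log b ∧ 8 * R < b := by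
  obtain ⟨k, hk⟩ := exists_nat_gt (Real.exp (2 * R + 1) + 8 * R)
  have h0 := Real.exp_pos (2 * R + 1)
  have hk0 : (0 : ℝ) < k := by linarith
  have hkn : 0 < k := by exact_mod_cast hk0
  have h1 : 2 * R + 1 < Real.log (2 * k : ℕ) := by
    rw [Real.lt_log_iff_exp_lt (by push_cast; linarith)]
    push_cast; linarith
  refine ⟨2 * k, by omega, by simp, by linarith, by linarith, ?_⟩
  push_cast; linarith

theorem main (n : ℕ) (hn : 1 ≤ n) (a : Fin n → ℝ) (ha : ∀ i, 0 < a i)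
    (Γ : Subgroup (Gphi a))
    (hdiscrete : ∀ γ ∈ Γ, ∃ U : Set (Gphi a), IsOpen U ∧ U ∩ (Γ : Set (Gphi a)) = {γ})
    (hcocompact : ∃ C : Set (Gphi a), IsCompact C ∧
      ∀ g : Gphi a, ∃ γ ∈ Γ, ∃ c ∈ C, g = γ * c) :
    ∃ D : Set (Gphi a), D ⊆ (Γ : Set (Gphi a)) ∧
      ∀ S : Finset (Gphi a), Subgroup.closure (S : Set (Gphi a)) = Γ →
        ((∃ C : ℝ, 0 < C ∧ ∀ γ ∈ Γ, ∃ d ∈ D, (wordDist (S : Set (Gphi a)) d γ : ℝ) ≤ C) ∧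
        ¬ ∃ K : ℝ, 1 ≤ K ∧ ∃ f : D → Γ, Function.Bijective f ∧
          ∀ p q : D,
            K⁻¹ * (wordDist (S : Set (Gphi a)) (p : Gphi a) (q : Gphi a) : ℝ) ≤
                (wordDist (S : Set (Gphi a)) (f p : Gphi a) (f q : Gphi a) : ℝ) ∧
              (wordDist (S : Set (Gphi a)) (f p : Gphi a) (f q : Gphi a) : ℝ) ≤
                K * (wordDist (S : Set (Gphi a)) (p : Gphi a) (q : Gphi a) : ℝ)) := by
  obtain ⟨R, hR, hc⟩ := coarse hcocompact
  obtain ⟨b, hb, ev, hL1, hL, hbR⟩ := choose_b R hR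
  set ζ : Γ → Fin (n + 1) → ℤ := fun p => zet b p.1 with hζ
  set ξ : Γ → Fin (n + 1) → ℝ := fun p => xi b p.1 with hξ
  have hsum : ∀ q, ∑ j, ζ q j = 0 := fun q => zet_sum b q.1
  obtain ⟨D, hD1, hD2⟩ := glue (ζ := ζ) (ξ := ξ) hn hb ev hsum (three_points hn ha hR hc hb hL hbR)
  refine ⟨Subtype.val '' D, ?_, fun S hS => ?_⟩
  · rintro _ ⟨x, -, rfl⟩; exact x.2
  obtain ⟨A, G⟩ := gm_word hn ha hdiscrete hR hc hb hL1 S hS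
  change GM b ζ ξ _ A at G
  constructor
  · refine ⟨A * (0 + 1) + 1, by positivity, fun γ hγ => ?_⟩
    obtain ⟨y, hy, ht'⟩ := hD1 (tile b ζ ξ ⟨γ, hγ⟩)
    refine ⟨y.1, ⟨y, hy, rfl⟩, ?_⟩
    have ez : ζ y = ζ ⟨γ, hγ⟩ := by rw [← tile_ht (b := b) (ξ := ξ) hsum, ht', tile_ht hsum]
    have ei : ix b ζ ξ y = ix b ζ ξ ⟨γ, hγ⟩ := by
      have : (tile b ζ ξ y).2 = (tile b ζ ξ ⟨γ, hγ⟩).2 := by rw [ht']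
      exact this
    have := G.m2 y ⟨γ, hγ⟩ 0 (by intro j; rw [ez]; simp) (by
      intro j
      have h1 := congrFun ei j
      unfold ix at h1
      have h2 := Int.abs_sub_lt_one_of_floor_eq_floor h1
      rw [← ez, ← sub_div, abs_div, abs_of_pos (zpow_pos' hb _), div_lt_one (zpow_pos' hb _)] at h2
      simpa using h2.le)
    have h3 : (wordDist (S : Set (Gphi a)) y.1 γ : ℝ) ≤ A * (0 + 1) := by exact_mod_cast this
    linarith
  · rintro ⟨K', hK', f, hf, hlip⟩
    set e := Equiv.ofBijective f hf with he
    set v : Γ → Γ := fun p => ⟨(e.symm p).1, by obtain ⟨x, -, hx⟩ := (e.symm p).2; rw [← hx]; exact x.2⟩ with hv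
    set K : ℕ := A + ⌈K'⌉₊ + 1 with hK
    have hKK : K' ≤ K := (Nat.le_ceil K').trans (by rw [hK]; exact_mod_cast (by omega))
    have hlip' : ∀ p q : Γ, K'⁻¹ * (wordDist (S : Set (Gphi a)) (v p).1 (v q).1 : ℝ) ≤ wordDist (S : Set (Gphi a)) p.1 q.1 ∧
        (wordDist (S : Set (Gphi a)) p.1 q.1 : ℝ) ≤ K' * wordDist (S : Set (Gphi a)) (v p).1 (v q).1 := by
      intro p q
      have := hlip (e.symm p) (e.symm q)
      have e1 : ∀ p, f (e.symm p) = p := fun p => e.apply_symm_apply p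
      rw [e1, e1] at this
      exact this
    refine hD2 K (fun p q : Γ => wordDist (S : Set (Gphi a)) p.1 q.1) v (by omega) (G.mono hb (by omega)) ?_ ?_ ?_ ?_ ?_
    · intro g p q; exact wordDist_inv _ _ _ _
    · intro p q h
      have : (e.symm p).1 = (e.symm q).1 := congrArg (fun z : Γ => z.1) h
      exact e.symm.injective (Subtype.ext this)
    · ext y
      constructor
      · rintro ⟨p, rfl⟩
        obtain ⟨x, hx, hx2⟩ := (e.symm p).2
        have : v p = x := Subtype.ext hx2.symm
        rw [this]; exact hx
      · intro hy
        refine ⟨e ⟨y.1, y, hy, rfl⟩, Subtype.ext ?_⟩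
        simp [hv]
    · intro p q
      have h1 := (hlip' p q).1
      rw [inv_mul_le_iff₀ (by linarith)] at h1
      have : (wordDist (S : Set (Gphi a)) (v p).1 (v q).1 : ℝ) ≤ K * wordDist (S : Set (Gphi a)) p.1 q.1 :=
        h1.trans (by gcongr)
      exact_mod_cast this
    · intro p q
      have : (wordDist (S : Set (Gphi a)) p.1 q.1 : ℝ) ≤ K * wordDist (S : Set (Gphi a)) (v p).1 (v q).1 :=
        (hlip' p q).2.trans (by gcongr)
      exact_mod_cast this
end NR

/-- Any lattice in a boundary one-dimensional, even-scaling, abelian-by-abelian Lie group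
G_φ contains a non-rectifiable Delone subset. -/
theorem abelian_by_abelian_lattice_contains_nonrectifiable_delone
    (n : ℕ) (hn : 1 ≤ n) (a : Fin n → ℝ) (ha : ∀ i, 0 < a i)
    -- even-scaling: ∃ t > 0 with e^{a_i t} an even positive integer for all i
    (hescale : ∃ t : ℝ, 0 < t ∧ ∀ i, ∃ N : ℕ, 0 < N ∧ Real.exp (a i * t) = 2 * N)
    (Γ : Subgroup (Gphi a))
    (hdiscrete : ∀ γ ∈ Γ, ∃ U : Set (Gphi a), IsOpen U ∧ U ∩ (Γ : Set (Gphi a)) = {γ})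
    (hcocompact : ∃ C : Set (Gphi a), IsCompact C ∧
      ∀ g : Gphi a, ∃ γ ∈ Γ, ∃ c ∈ C, g = γ * c) :
    ∃ D : Set (Gphi a), D ⊆ (Γ : Set (Gphi a)) ∧
      ∀ S : Finset (Gphi a), Subgroup.closure (S : Set (Gphi a)) = Γ →
        -- `D` is a Delone subset of `(Γ, d_S)`:
        ((∃ C : ℝ, 0 < C ∧ ∀ γ ∈ Γ, ∃ d ∈ D, (wordDist (S : Set (Gphi a)) d γ : ℝ) ≤ C) ∧
        -- `D` is non-rectifiable:
        ¬ ∃ K : ℝ, 1 ≤ K ∧ ∃ f : D → Γ, Function.Bijective f ∧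
          ∀ p q : D,
            K⁻¹ * (wordDist (S : Set (Gphi a)) (p : Gphi a) (q : Gphi a) : ℝ) ≤
                (wordDist (S : Set (Gphi a)) (f p : Gphi a) (f q : Gphi a) : ℝ) ∧
              (wordDist (S : Set (Gphi a)) (f p : Gphi a) (f q : Gphi a) : ℝ) ≤
                K * (wordDist (S : Set (Gphi a)) (p : Gphi a) (q : Gphi a) : ℝ)) := by
  exact NR.main n hn a ha Γ hdiscrete hcocompact
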